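/- arXiv:2107.13246 — 4 statements merged into one kernel-verified Lean document; each statement's English description precedes it below -/
import Mathlib

section
/- There exist functions l₁, l₂ : [0,1] → ℝ with the following properties: (1) l₁ extends to a smooth function on (−1,2) that is even about r = 0 and odd about r = 1, and l₂ extends to a smooth function on (−1,2) that is odd about r = 0 and even about r = 1; (2) on (0,1) they solve the system (l₁'/φ₁)' = l₁·l₂²/σ and (l₂'/φ₂)' = l₁²·l₂/σ; (3) l₁(0) = −1, l₁'(0) = 0, l₂(0) = 0, l₁(1) = 0, l₂(1) = 1, l₂'(1) = 0; (4) l₂'(0) > 0 and l₁'(1) > 0; (5) −1 < l₁ < 0 and 0 < l₂ < 1 on (0,1). -/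
section
open Set Filter Topology MeasureTheory
open scoped ContDiff

namespace CrossCurv

/-- weighted average operator -/
noncomputable def Av (j : ℕ) (f : ℝ → ℝ) (r : ℝ) : ℝ := ∫ t in (0:ℝ)..1, t ^ j * f (r * t)

lemma scale_mem {a b r t : ℝ} (ha : a < 0) (hb : 0 < b) (hr : r ∈ Ioo a b) (ht : t ∈ Icc (0:ℝ) 1) :
    r * t ∈ Ioo a b := by
  obtain ⟨h1, h2⟩ := hr
  obtain ⟨h3, h4⟩ := ht
  constructor
  · rcases le_or_gt 0 r with h | h
    · nlinarith [mul_nonneg h h3]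
    · nlinarith
  · rcases le_or_gt 0 r with h | h
    · nlinarith
    · nlinarith

lemma exists_cpt {a b r : ℝ} (ha : a < 0) (hb : 0 < b) (hr : r ∈ Ioo a b) :
    ∃ α β : ℝ, a < α ∧ α < 0 ∧ 0 < β ∧ β < b ∧ α < r ∧ r < β := by
  refine ⟨(a + min r 0) / 2, (b + max r 0) / 2, ?_⟩
  obtain ⟨h1, h2⟩ := hr
  rcases le_total r 0 with h | h
  · rw [min_eq_left h, max_eq_right h]
    refine ⟨?_, ?_, ?_, ?_, ?_, ?_⟩ <;> linarith
  · rw [min_eq_right h, max_eq_left h]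
    refine ⟨?_, ?_, ?_, ?_, ?_, ?_⟩ <;> linarith

lemma Av_cont {a b : ℝ} (ha : a < 0) (hb : 0 < b) (j : ℕ) {f : ℝ → ℝ}
    (hf : ContinuousOn f (Ioo a b)) : ContinuousOn (Av j f) (Ioo a b) := by
  intro r hr
  apply ContinuousAt.continuousWithinAt
  obtain ⟨α, β, h1, h2, h3, h4, h5, h6⟩ := exists_cpt ha hb hr
  let F : ℝ → ℝ := fun x => f (max α (min β x))
  have hF : Continuous F := by
    apply hf.comp_continuous (by fun_prop)
    intro x
    constructor
    · exact lt_of_lt_of_le h1 (le_max_left _ _)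
    · exact max_lt (by linarith) (lt_of_le_of_lt (min_le_left _ _) h4)
  have hA : Continuous (Av j F) := by
    unfold Av
    apply intervalIntegral.continuous_parametric_intervalIntegral_of_continuous'
    simp only [Function.uncurry_def]
    fun_prop
  apply hA.continuousAt.congr
  filter_upwards [Ioo_mem_nhds h5 h6] with x hx
  unfold Av
  apply intervalIntegral.integral_congr
  intro t ht
  rw [uIcc_of_le zero_le_one] at ht
  have := scale_mem h2 h3 hx ht
  simp only [F]
  rw [min_eq_right this.2.le, max_eq_right this.1.le]

lemma Av_int {a b : ℝ} (ha : a < 0) (hb : 0 < b) (j : ℕ) {f : ℝ → ℝ}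
    (hf : ContinuousOn f (Ioo a b)) {r : ℝ} (hr : r ∈ Ioo a b) :
    ContinuousOn (fun t : ℝ => t ^ j * f (r * t)) (Icc 0 1) := by
  apply ContinuousOn.mul (by fun_prop)
  apply hf.comp (by fun_prop)
  intro t ht
  exact scale_mem ha hb hr ht

lemma Av_deriv {a b : ℝ} (ha : a < 0) (hb : 0 < b) (j : ℕ) {f f' : ℝ → ℝ}
    (hf : ∀ r ∈ Ioo a b, HasDerivAt f (f' r) r) (hf' : ContinuousOn f' (Ioo a b))
    {r : ℝ} (hr : r ∈ Ioo a b) : HasDerivAt (Av j f) (Av (j+1) f' r) r := by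
  obtain ⟨α, β, h1, h2, h3, h4, h5, h6⟩ := exists_cpt ha hb hr
  have hfc : ContinuousOn f (Ioo a b) := fun x hx => (hf x hx).continuousAt.continuousWithinAt
  have hsub : Icc α β ⊆ Ioo a b := fun x hx => ⟨by linarith [hx.1], by linarith [hx.2]⟩
  obtain ⟨C, hC⟩ := isCompact_Icc.exists_bound_of_continuousOn (hf'.mono hsub)
  have key := intervalIntegral.hasDerivAt_integral_of_dominated_loc_of_deriv_le (μ := volume)
    (a := 0) (b := 1) (bound := fun _ => C)
    (F := fun r t => t ^ j * f (r * t)) (F' := fun r t => t ^ (j+1) * f' (r * t)) (x₀ := r)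
    (s := Ioo α β) (Ioo_mem_nhds h5 h6) ?_ ?_ ?_ ?_ ?_ ?_
  · exact key.2
  · filter_upwards [Ioo_mem_nhds h5 h6] with x hx
    rw [uIoc_of_le zero_le_one]
    exact ((Av_int ha hb j hfc (hsub (Ioo_subset_Icc_self hx))).mono
      Ioc_subset_Icc_self).aestronglyMeasurable measurableSet_Ioc
  · exact (Av_int ha hb j hfc hr).intervalIntegrable_of_Icc zero_le_one
  · rw [uIoc_of_le zero_le_one]
    exact ((Av_int ha hb (j+1) hf' hr).mono
      Ioc_subset_Icc_self).aestronglyMeasurable measurableSet_Ioc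
  · filter_upwards with t ht x hx
    rw [uIoc_of_le zero_le_one] at ht
    have ht' : t ∈ Icc (0:ℝ) 1 := Ioc_subset_Icc_self ht
    rw [norm_mul]
    have h7 : ‖t ^ (j+1)‖ ≤ 1 := by
      rw [Real.norm_eq_abs, abs_of_nonneg (pow_nonneg ht'.1 _)]
      exact pow_le_one₀ ht'.1 ht'.2
    have h8 := hC _ (Ioo_subset_Icc_self (scale_mem h2 h3 hx ht'))
    calc _ ≤ 1 * C := mul_le_mul h7 h8 (norm_nonneg _) zero_le_one
      _ = C := one_mul _
  · exact intervalIntegrable_const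
  · filter_upwards with t ht x hx
    rw [uIoc_of_le zero_le_one] at ht
    have ht' : t ∈ Icc (0:ℝ) 1 := Ioc_subset_Icc_self ht
    have h9 := hf _ (hsub (Ioo_subset_Icc_self (scale_mem h2 h3 hx ht')))
    have h10 : HasDerivAt (fun x => x * t) t x := by simpa using (hasDerivAt_id x).mul_const t
    have h11 := (HasDerivAt.comp x h9 h10).const_mul (t ^ j)
    have h12 : t ^ (j+1) * f' (x * t) = t ^ j * (f' (x * t) * t) := by ring
    rw [h12]
    exact h11

lemma Av_contDiff {a b : ℝ} (ha : a < 0) (hb : 0 < b) (n : ℕ) : ∀ (j : ℕ) {f : ℝ → ℝ},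
    ContDiffOn ℝ n f (Ioo a b) → ContDiffOn ℝ n (Av j f) (Ioo a b) := by
  induction n with
  | zero =>
    intro j f hf
    simp only [Nat.cast_zero, contDiffOn_zero] at hf ⊢
    exact Av_cont ha hb j hf
  | succ n ih =>
    intro j f hf
    push_cast at hf ⊢
    rw [contDiffOn_succ_iff_deriv_of_isOpen isOpen_Ioo] at hf ⊢
    obtain ⟨h1, -, h2⟩ := hf
    have hd : ∀ r ∈ Ioo a b, HasDerivAt f (deriv f r) r := fun r hr =>
      (h1.differentiableAt (isOpen_Ioo.mem_nhds hr)).hasDerivAt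
    have hA := fun r hr => Av_deriv ha hb j hd h2.continuousOn (r := r) hr
    refine ⟨fun r hr => (hA r hr).differentiableAt.differentiableWithinAt, by simp, ?_⟩
    exact (ih (j+1) h2).congr (fun r hr => (hA r hr).deriv)

lemma Av_smooth {a b : ℝ} (ha : a < 0) (hb : 0 < b) (j : ℕ) {f : ℝ → ℝ}
    (hf : ContDiffOn ℝ ∞ f (Ioo a b)) : ContDiffOn ℝ ∞ (Av j f) (Ioo a b) := by
  rw [contDiffOn_infty] at hf ⊢
  exact fun n => Av_contDiff ha hb n j (hf n)

lemma Av_mul_pow (j : ℕ) (f : ℝ → ℝ) (r : ℝ) :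
    r ^ (j+1) * Av j f r = ∫ s in (0:ℝ)..r, s ^ j * f s := by
  have := intervalIntegral.mul_integral_comp_mul_left (a := 0) (b := 1)
    (f := fun s => s ^ j * f s) r
  simp only [mul_zero, mul_one] at this
  rw [← this, pow_succ', mul_assoc, Av, ← intervalIntegral.integral_const_mul]
  congr 1
  apply intervalIntegral.integral_congr
  intro t _
  simp only
  ring

lemma smooth_deriv {a b : ℝ} {f : ℝ → ℝ} (hf : ContDiffOn ℝ ∞ f (Ioo a b)) :
    ContDiffOn ℝ ∞ (deriv f) (Ioo a b) :=
  ((contDiffOn_infty_iff_deriv_of_isOpen isOpen_Ioo).1 hf).2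

lemma smooth_hasDeriv {a b : ℝ} {f : ℝ → ℝ} (hf : ContDiffOn ℝ ∞ f (Ioo a b)) {r : ℝ}
    (hr : r ∈ Ioo a b) : HasDerivAt f (deriv f r) r :=
  ((hf.differentiableOn (by simp)).differentiableAt (isOpen_Ioo.mem_nhds hr)).hasDerivAt

/-- Hadamard lemma -/
lemma hadamard {a b : ℝ} (ha : a < 0) (hb : 0 < b) {f : ℝ → ℝ}
    (hf : ContDiffOn ℝ ∞ f (Ioo a b)) {r : ℝ} (hr : r ∈ Ioo a b) :
    f r = f 0 + r * Av 0 (deriv f) r := by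
  have h := Av_mul_pow 0 (deriv f) r
  simp only [zero_add, pow_one, pow_zero, one_mul] at h
  rw [h, intervalIntegral.integral_eq_sub_of_hasDerivAt]
  · ring
  · intro x hx
    exact smooth_hasDeriv hf (ordConnected_Ioo.uIcc_subset ⟨ha, hb⟩ hr hx)
  · apply ContinuousOn.intervalIntegrable
    exact (smooth_deriv hf).continuousOn.mono (ordConnected_Ioo.uIcc_subset ⟨ha, hb⟩ hr)

lemma Av_even {j : ℕ} {f : ℝ → ℝ} {b : ℝ} (hb : 0 < b) (hf : ∀ t ∈ Ioo (-b) b, f (-t) = f t) :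
    ∀ t ∈ Ioo (-b) b, Av j f (-t) = Av j f t := by
  intro r hr
  unfold Av
  apply intervalIntegral.integral_congr
  intro t ht
  rw [uIcc_of_le zero_le_one] at ht
  simp only
  rw [neg_mul, hf _ (scale_mem (by linarith) hb hr ht)]

end CrossCurv


namespace CrossCurv

structure OpData (z φ E e c : ℝ → ℝ) : Prop where
  hz : ∀ r ∈ Ioo (0:ℝ) 1, 0 < z r
  hzc : ContinuousOn z (Ico 0 1)
  z0 : z 0 = 1
  hzm : Measurable z
  hzd : ∀ r ∈ Ioo (0:ℝ) 1, HasDerivAt z (-(φ r * E r)) r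
  hE : ContinuousOn E (Ioc 0 1)
  E1 : E 1 = 0
  hEd : ∀ r ∈ Ioo (0:ℝ) 1, HasDerivAt E (-(e r)) r
  he : ContinuousOn e (Ioo 0 1)
  hc : ContinuousOn c (Ioo 0 1)
  hcp : ∀ r ∈ Ioo (0:ℝ) 1, 0 < c r
  hφ : ContinuousOn φ (Ioo 0 1)
  hφp : ∀ r ∈ Ioo (0:ℝ) 1, 0 < φ r
  hec : ∀ r ∈ Ioo (0:ℝ) 1, z r * c r ≤ e r

/-- inner integral -/
noncomputable def TI (z e c : ℝ → ℝ) (u v : ℝ → ENNReal) (t : ℝ) : ENNReal :=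
  ∫⁻ s in Ioo t 1, u s * (ENNReal.ofReal (e s) - ENNReal.ofReal (z s * c s) * v s ^ 2)

/-- the monotone operator -/
noncomputable def TO (z φ e c : ℝ → ℝ) (u v : ℝ → ENNReal) (r : ℝ) : ENNReal :=
  ENNReal.ofReal (z r) * (1 + ∫⁻ t in Ioo 0 r, ENNReal.ofReal (φ t / z t ^ 2) * TI z e c u v t)

lemma TI_mono {z e c : ℝ → ℝ} {u u' v v' : ℝ → ENNReal} (hu : u ≤ u') (hv : v' ≤ v) (t : ℝ) :
    TI z e c u v t ≤ TI z e c u' v' t := by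
  unfold TI
  apply lintegral_mono
  intro s
  have h1 := hu s
  have h2 := hv s
  simp only
  gcongr

lemma TO_mono {z φ e c : ℝ → ℝ} {u u' v v' : ℝ → ENNReal} (hu : u ≤ u') (hv : v' ≤ v) :
    TO z φ e c u v ≤ TO z φ e c u' v' := by
  intro r
  unfold TO
  gcongr
  exact TI_mono hu hv _

lemma TO_meas {z φ e c : ℝ → ℝ} (hz : Measurable z) (u v : ℝ → ENNReal) :
    Measurable (TO z φ e c u v) := by
  unfold TO
  apply Measurable.mul (by fun_prop)
  apply Measurable.const_add
  apply Monotone.measurable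
  intro a b hab
  exact lintegral_mono_set (Ioo_subset_Ioo_right hab)

lemma lint_deriv {F f : ℝ → ℝ} {a b : ℝ} (hab : a ≤ b) (hF : ContinuousOn F (Icc a b))
    (hd : ∀ x ∈ Ioo a b, HasDerivAt F (f x) x) (hp : ∀ x ∈ Ioo a b, 0 ≤ f x) :
    ∫⁻ x in Ioo a b, ENNReal.ofReal (f x) = ENNReal.ofReal (F b - F a) := by
  have hi := intervalIntegral.integrableOn_deriv_of_nonneg hF hd hp
  have h1 := intervalIntegral.integral_eq_sub_of_hasDerivAt_of_le hab hF hd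
    ((intervalIntegrable_iff_integrableOn_Ioc_of_le hab).2 hi)
  rw [← h1, intervalIntegral.integral_of_le hab, integral_Ioc_eq_integral_Ioo,
    ofReal_integral_eq_lintegral_ofReal]
  · exact hi.mono_set Ioo_subset_Ioc_self
  · exact (ae_restrict_iff' measurableSet_Ioo).2 (ae_of_all _ hp)

namespace OpData

variable {z φ E e c : ℝ → ℝ}

lemma e_nonneg (h : OpData z φ E e c) {r : ℝ} (hr : r ∈ Ioo (0:ℝ) 1) : 0 ≤ e r :=
  le_trans (mul_nonneg (h.hz r hr).le (h.hcp r hr).le) (h.hec r hr)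

lemma hEd' (h : OpData z φ E e c) {r : ℝ} (hr : r ∈ Ioo (0:ℝ) 1) :
    HasDerivAt (fun x => - E x) (e r) r :=
  (h.hEd r hr).fun_neg.congr_deriv (neg_neg _)

lemma e_int (h : OpData z φ E e c) {t : ℝ} (ht : t ∈ Ioo (0:ℝ) 1) :
    IntegrableOn e (Ioc t 1) := by
  apply intervalIntegral.integrableOn_deriv_of_nonneg (g := fun x => - E x)
  · exact (h.hE.mono (fun x hx => ⟨by linarith [ht.1, hx.1], hx.2⟩)).neg
  · intro x hx
    exact h.hEd' ⟨by linarith [ht.1, hx.1], hx.2⟩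
  · intro x hx
    exact h.e_nonneg ⟨by linarith [ht.1, hx.1], hx.2⟩

lemma e_integral (h : OpData z φ E e c) {t : ℝ} (ht : t ∈ Ioo (0:ℝ) 1) :
    ∫ s in t..1, e s = E t := by
  rw [intervalIntegral.integral_eq_sub_of_hasDerivAt_of_le (f := fun x => - E x) ht.2.le]
  · simp [h.E1]
  · exact (h.hE.mono (fun x hx => ⟨by linarith [ht.1, hx.1], hx.2⟩)).neg
  · intro x hx
    exact h.hEd' ⟨by linarith [ht.1, hx.1], hx.2⟩
  · exact (intervalIntegrable_iff_integrableOn_Ioc_of_le ht.2.le).2 (h.e_int ht)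

lemma e_lint (h : OpData z φ E e c) {t : ℝ} (ht : t ∈ Ioo (0:ℝ) 1) :
    ∫⁻ s in Ioo t 1, ENNReal.ofReal (e s) = ENNReal.ofReal (E t) := by
  rw [lint_deriv (F := fun x => - E x) ht.2.le]
  · simp [h.E1]
  · exact (h.hE.mono (fun x hx => ⟨by linarith [ht.1, hx.1], hx.2⟩)).neg
  · intro x hx
    exact h.hEd' ⟨by linarith [ht.1, hx.1], hx.2⟩
  · intro x hx
    exact h.e_nonneg ⟨by linarith [ht.1, hx.1], hx.2⟩

lemma E_nonneg (h : OpData z φ E e c) {t : ℝ} (ht : t ∈ Ioo (0:ℝ) 1) : 0 ≤ E t := by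
  rw [← h.e_integral ht]
  apply intervalIntegral.integral_nonneg_of_ae_restrict ht.2.le
  have h0 : ∀ᵐ x ∂(volume.restrict (Ioo t 1)), 0 ≤ e x :=
    (ae_restrict_iff' measurableSet_Ioo).2 (ae_of_all _ fun x hx =>
      h.e_nonneg ⟨by linarith [ht.1, hx.1], hx.2⟩)
  rw [← restrict_Ioo_eq_restrict_Icc]
  exact h0

lemma zinv_cont (h : OpData z φ E e c) {r : ℝ} (hr : r ∈ Ioo (0:ℝ) 1) :
    ContinuousOn (fun x => (z x)⁻¹) (Icc 0 r) := by
  apply ContinuousOn.inv₀ (h.hzc.mono (fun x hx => ⟨hx.1, by linarith [hx.2, hr.2]⟩))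
  intro x hx
  rcases eq_or_lt_of_le hx.1 with h0 | h0
  · rw [← h0, h.z0]; norm_num
  · exact (h.hz x ⟨h0, by linarith [hx.2, hr.2]⟩).ne'

lemma zinv_deriv (h : OpData z φ E e c) {r : ℝ} (hr : r ∈ Ioo (0:ℝ) 1) :
    HasDerivAt (fun x => (z x)⁻¹) (φ r / z r ^ 2 * E r) r := by
  apply ((h.hzd r hr).fun_inv (h.hz r hr).ne').congr_deriv
  ring

lemma zinv_nonneg (h : OpData z φ E e c) {r : ℝ} (hr : r ∈ Ioo (0:ℝ) 1) :
    0 ≤ φ r / z r ^ 2 * E r :=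
  mul_nonneg (div_nonneg (h.hφp r hr).le (sq_nonneg _)) (h.E_nonneg hr)

lemma z_le_one (h : OpData z φ E e c) {r : ℝ} (hr : r ∈ Ioo (0:ℝ) 1) : 1 ≤ (z r)⁻¹ := by
  have : MonotoneOn (fun x => (z x)⁻¹) (Icc 0 r) := by
    apply monotoneOn_of_hasDerivWithinAt_nonneg (convex_Icc _ _) (h.zinv_cont hr)
      (f' := fun r => φ r / z r ^ 2 * E r)
    · intro x hx
      rw [interior_Icc] at hx
      exact (h.zinv_deriv ⟨hx.1, by linarith [hx.2, hr.2]⟩).hasDerivWithinAt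
    · intro x hx
      rw [interior_Icc] at hx
      exact h.zinv_nonneg ⟨hx.1, by linarith [hx.2, hr.2]⟩
  have := this (left_mem_Icc.2 hr.1.le) (right_mem_Icc.2 hr.1.le) hr.1.le
  simpa [h.z0] using this

lemma TI_le (h : OpData z φ E e c) {u v : ℝ → ENNReal} (hu : u ≤ 1) {t : ℝ}
    (ht : t ∈ Ioo (0:ℝ) 1) : TI z e c u v t ≤ ENNReal.ofReal (E t) := by
  rw [← h.e_lint ht]
  apply lintegral_mono
  intro s
  have := hu s
  calc _ ≤ (1 : ENNReal) * ENNReal.ofReal (e s) := mul_le_mul' this tsub_le_self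
    _ = _ := one_mul _

lemma TO_le (h : OpData z φ E e c) {u v : ℝ → ENNReal} (hu : u ≤ 1) {r : ℝ}
    (hr : r ∈ Ioo (0:ℝ) 1) : TO z φ e c u v r ≤ 1 := by
  have h1 : ∫⁻ t in Ioo 0 r, ENNReal.ofReal (φ t / z t ^ 2) * TI z e c u v t
      ≤ ENNReal.ofReal ((z r)⁻¹ - 1) := by
    calc _ ≤ ∫⁻ t in Ioo 0 r, ENNReal.ofReal (φ t / z t ^ 2 * E t) := by
          apply setLIntegral_mono' measurableSet_Ioo
          intro t ht
          have ht' : t ∈ Ioo (0:ℝ) 1 := ⟨ht.1, by linarith [ht.2, hr.2]⟩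
          rw [ENNReal.ofReal_mul (div_nonneg (h.hφp t ht').le (sq_nonneg _))]
          gcongr
          exact h.TI_le hu ht'
      _ = _ := by
          rw [lint_deriv hr.1.le (h.zinv_cont hr)]
          · simp [h.z0]
          · intro x hx
            exact h.zinv_deriv ⟨hx.1, by linarith [hx.2, hr.2]⟩
          · intro x hx
            exact h.zinv_nonneg ⟨hx.1, by linarith [hx.2, hr.2]⟩
  unfold TO
  calc _ ≤ ENNReal.ofReal (z r) * (1 + ENNReal.ofReal ((z r)⁻¹ - 1)) := by gcongr
    _ = 1 := by
      rw [← ENNReal.ofReal_one, ← ENNReal.ofReal_add zero_le_one (by linarith [h.z_le_one hr]),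
        ← ENNReal.ofReal_mul (h.hz r hr).le]
      congr 1
      have := (h.hz r hr).ne'
      field_simp
      ring

lemma fix (h : OpData z φ E e c) {u v : ℝ → ENNReal} (hu : u ≤ 1) (hv : v ≤ 1)
    (hum : Measurable u) (hvm : Measurable v)
    (hfix : ∀ r ∈ Ioo (0:ℝ) 1, u r = TO z φ e c u v r) :
    ∃ H : ℝ → ℝ, ∀ r ∈ Ioo (0:ℝ) 1, z r ≤ (u r).toReal ∧ (u r).toReal ≤ 1 ∧
      HasDerivAt (fun r => (u r).toReal)
        (-(φ r * E r * (u r).toReal / z r) + φ r * H r / z r) r ∧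
      (ContinuousAt (fun r => (v r).toReal) r →
        HasDerivAt H (-((u r).toReal * (e r - z r * c r * (v r).toReal ^ 2))) r) := by
  set ur : ℝ → ℝ := fun r => (u r).toReal with hur
  set vr : ℝ → ℝ := fun r => (v r).toReal with hvr
  have hu1 : ∀ r, u r = ENNReal.ofReal (ur r) := fun r =>
    (ENNReal.ofReal_toReal (ne_top_of_le_ne_top ENNReal.one_ne_top (hu r))).symm
  have hv1 : ∀ r, v r = ENNReal.ofReal (vr r) := fun r =>
    (ENNReal.ofReal_toReal (ne_top_of_le_ne_top ENNReal.one_ne_top (hv r))).symm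
  have hu0 : ∀ r, 0 ≤ ur r := fun r => ENNReal.toReal_nonneg
  have hv0 : ∀ r, 0 ≤ vr r := fun r => ENNReal.toReal_nonneg
  have hule : ∀ r, ur r ≤ 1 := fun r => by
    simpa using ENNReal.toReal_mono ENNReal.one_ne_top (hu r)
  have hvle : ∀ r, vr r ≤ 1 := fun r => by
    simpa using ENNReal.toReal_mono ENNReal.one_ne_top (hv r)
  have hurm : Measurable ur := hum.ennreal_toReal
  have hvrm : Measurable vr := hvm.ennreal_toReal
  set f : ℝ → ℝ := fun s => ur s * (e s - z s * c s * vr s ^ 2) with hf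
  have hIz : ContinuousOn z (Ioo 0 1) := h.hzc.mono Ioo_subset_Ico_self
  have hb : ∀ s ∈ Ioo (0:ℝ) 1, 0 ≤ e s - z s * c s * vr s ^ 2 ∧
      e s - z s * c s * vr s ^ 2 ≤ e s := by
    intro s hs
    have h1 := h.hec s hs
    have h2 : 0 ≤ z s * c s := mul_nonneg (h.hz s hs).le (h.hcp s hs).le
    have h3 : vr s ^ 2 ≤ 1 := pow_le_one₀ (hv0 s) (hvle s)
    constructor
    · nlinarith
    · nlinarith [mul_nonneg h2 (sq_nonneg (vr s))]
  have hf0 : ∀ s ∈ Ioo (0:ℝ) 1, 0 ≤ f s := fun s hs => mul_nonneg (hu0 s) (hb s hs).1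
  have hfe : ∀ s ∈ Ioo (0:ℝ) 1, f s ≤ e s := fun s hs => by
    have := hb s hs
    calc f s ≤ 1 * (e s - z s * c s * vr s ^ 2) :=
          mul_le_mul_of_nonneg_right (hule s) this.1
      _ ≤ e s := by rw [one_mul]; exact this.2
  have hfm : AEStronglyMeasurable f (volume.restrict (Ioo 0 1)) := by
    apply AEStronglyMeasurable.mul hurm.aestronglyMeasurable
    apply AEStronglyMeasurable.sub (h.he.aestronglyMeasurable measurableSet_Ioo)
    exact ((hIz.mul h.hc).aestronglyMeasurable measurableSet_Ioo).mul
      (hvrm.pow_const 2).aestronglyMeasurable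
  have hfi : ∀ t ∈ Ioo (0:ℝ) 1, IntegrableOn f (Ioo t 1) := by
    intro t ht
    have hsub : Ioo t 1 ⊆ Ioo (0:ℝ) 1 := Ioo_subset_Ioo_left ht.1.le
    apply Integrable.mono' ((h.e_int ht).mono_set Ioo_subset_Ioc_self)
      (hfm.mono_measure (Measure.restrict_mono_set _ hsub))
    refine (ae_restrict_iff' measurableSet_Ioo).2 (ae_of_all _ fun s hs => ?_)
    rw [Real.norm_eq_abs, abs_of_nonneg (hf0 s (hsub hs))]
    exact hfe s (hsub hs)
  have hfii : ∀ t ∈ Ioo (0:ℝ) 1, IntervalIntegrable f volume t 1 := fun t ht =>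
    (intervalIntegrable_iff_integrableOn_Ioo_of_le ht.2.le).2 (hfi t ht)
  set H : ℝ → ℝ := fun t => ∫ s in t..1, f s with hH
  have hTI : ∀ t ∈ Ioo (0:ℝ) 1, TI z e c u v t = ENNReal.ofReal (H t) := by
    intro t ht
    have hsub : Ioo t 1 ⊆ Ioo (0:ℝ) 1 := Ioo_subset_Ioo_left ht.1.le
    simp only [hH]
    rw [intervalIntegral.integral_of_le ht.2.le, integral_Ioc_eq_integral_Ioo,
      ofReal_integral_eq_lintegral_ofReal (hfi t ht)
      ((ae_restrict_iff' measurableSet_Ioo).2 (ae_of_all _ fun s hs => hf0 s (hsub hs)))]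
    unfold TI
    apply setLIntegral_congr_fun measurableSet_Ioo
    intro s hs
    simp only [hf]
    have h2 : 0 ≤ z s * c s := mul_nonneg (h.hz s (hsub hs)).le (h.hcp s (hsub hs)).le
    rw [ENNReal.ofReal_mul (hu0 s), ENNReal.ofReal_sub _ (mul_nonneg h2 (sq_nonneg _)),
      ENNReal.ofReal_mul h2, ENNReal.ofReal_pow (hv0 s), ← hu1, ← hv1]
  have hH0 : ∀ t ∈ Ioo (0:ℝ) 1, 0 ≤ H t := by
    intro t ht
    simp only [hH]
    rw [intervalIntegral.integral_of_le ht.2.le, integral_Ioc_eq_integral_Ioo]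
    exact setIntegral_nonneg measurableSet_Ioo fun s hs => hf0 s (Ioo_subset_Ioo_left ht.1.le hs)
  have hHE : ∀ t ∈ Ioo (0:ℝ) 1, H t ≤ E t := by
    intro t ht
    have := h.TI_le (v := v) hu ht
    rw [hTI t ht] at this
    exact (ENNReal.ofReal_le_ofReal_iff (h.E_nonneg ht)).1 this
  have hHc : ContinuousOn H (Ioo 0 1) := by
    intro t ht
    apply ContinuousAt.continuousWithinAt
    have hm : (t/2) ∈ Ioo (0:ℝ) 1 := ⟨by linarith [ht.1], by linarith [ht.1, ht.2]⟩
    have h1 : ContinuousOn (fun x => ∫ s in (t/2)..x, f s) (uIcc (t/2) 1) :=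
      intervalIntegral.continuousOn_primitive_interval'
        (hfii _ hm) (left_mem_uIcc)
    rw [uIcc_of_le hm.2.le] at h1
    have h2 : ContinuousAt (fun x => ∫ s in (t/2)..x, f s) t :=
      h1.continuousAt (Icc_mem_nhds (by linarith [ht.1]) ht.2)
    have h3 : ContinuousAt (fun x => (∫ s in (t/2)..1, f s) - ∫ s in (t/2)..x, f s) t :=
      continuousAt_const.sub h2
    apply h3.congr
    filter_upwards [Ioo_mem_nhds (show t/2 < t by linarith [ht.1]) ht.2] with x hx
    have hx' : x ∈ Ioo (0:ℝ) 1 := ⟨by linarith [hm.1, hx.1], hx.2⟩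
    simp only [hH]
    rw [sub_eq_iff_eq_add, add_comm]
    refine (intervalIntegral.integral_add_adjacent_intervals ?_ (hfii x hx')).symm
    exact (hfii _ hm).trans (hfii x hx').symm
  set G : ℝ → ℝ := fun t => φ t / z t ^ 2 * H t with hG
  have hGc : ContinuousOn G (Ioo 0 1) :=
    (h.hφ.div (hIz.pow 2) (fun x hx => pow_ne_zero 2 (h.hz x hx).ne')).mul hHc
  have hG0 : ∀ t ∈ Ioo (0:ℝ) 1, 0 ≤ G t := fun t ht =>
    mul_nonneg (div_nonneg (h.hφp t ht).le (sq_nonneg _)) (hH0 t ht)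
  have hGi : ∀ r ∈ Ioo (0:ℝ) 1, IntegrableOn G (Ioo 0 r) := by
    intro r hr
    have hsub : Ioo 0 r ⊆ Ioo (0:ℝ) 1 := Ioo_subset_Ioo_right hr.2.le
    have h1 : IntegrableOn (fun t => φ t / z t ^ 2 * E t) (Ioc 0 r) :=
      intervalIntegral.integrableOn_deriv_of_nonneg (h.zinv_cont hr)
        (fun x hx => h.zinv_deriv (hsub hx)) (fun x hx => h.zinv_nonneg (hsub hx))
    apply Integrable.mono' (h1.mono_set Ioo_subset_Ioc_self)
      ((hGc.mono hsub).aestronglyMeasurable measurableSet_Ioo)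
    refine (ae_restrict_iff' measurableSet_Ioo).2 (ae_of_all _ fun s hs => ?_)
    rw [Real.norm_eq_abs, abs_of_nonneg (hG0 s (hsub hs))]
    exact mul_le_mul_of_nonneg_left (hHE s (hsub hs))
      (div_nonneg (h.hφp s (hsub hs)).le (sq_nonneg _))
  have hform : ∀ r ∈ Ioo (0:ℝ) 1, ur r = z r * (1 + ∫ t in (0:ℝ)..r, G t) ∧
      0 ≤ ∫ t in (0:ℝ)..r, G t := by
    intro r hr
    have hsub : Ioo 0 r ⊆ Ioo (0:ℝ) 1 := Ioo_subset_Ioo_right hr.2.le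
    have hn : 0 ≤ ∫ t in (0:ℝ)..r, G t := by
      rw [intervalIntegral.integral_of_le hr.1.le, integral_Ioc_eq_integral_Ioo]
      exact setIntegral_nonneg measurableSet_Ioo fun s hs => hG0 s (hsub hs)
    refine ⟨?_, hn⟩
    have h1 : ∫⁻ t in Ioo 0 r, ENNReal.ofReal (φ t / z t ^ 2) * TI z e c u v t
        = ENNReal.ofReal (∫ t in (0:ℝ)..r, G t) := by
      rw [intervalIntegral.integral_of_le hr.1.le, integral_Ioc_eq_integral_Ioo,
        ofReal_integral_eq_lintegral_ofReal (hGi r hr)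
        ((ae_restrict_iff' measurableSet_Ioo).2 (ae_of_all _ fun s hs => hG0 s (hsub hs)))]
      apply setLIntegral_congr_fun measurableSet_Ioo
      intro s hs
      simp only [hG]
      rw [ENNReal.ofReal_mul (div_nonneg (h.hφp s (hsub hs)).le (sq_nonneg _)), hTI s (hsub hs)]
    have h2 := hfix r hr
    unfold TO at h2
    rw [h1, ← ENNReal.ofReal_one, ← ENNReal.ofReal_add zero_le_one hn,
      ← ENNReal.ofReal_mul (h.hz r hr).le] at h2
    simp only [hur]
    rw [h2, ENNReal.toReal_ofReal]
    exact mul_nonneg (h.hz r hr).le (by linarith)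
  have hder : ∀ r ∈ Ioo (0:ℝ) 1, HasDerivAt ur
      (-(φ r * E r * ur r / z r) + φ r * H r / z r) r := by
    intro r hr
    have hnhds := isOpen_Ioo.mem_nhds hr
    have h1 : HasDerivAt (fun x => ∫ t in (0:ℝ)..x, G t) (G r) r := by
      apply intervalIntegral.integral_hasDerivAt_right
      · exact (intervalIntegrable_iff_integrableOn_Ioo_of_le hr.1.le).2 (hGi r hr)
      · exact hGc.stronglyMeasurableAtFilter isOpen_Ioo r hr
      · exact hGc.continuousAt hnhds
    have h2 := (h.hzd r hr).mul (h1.const_add 1)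
    have h3 : HasDerivAt ur (-(φ r * E r) * (1 + ∫ t in (0:ℝ)..r, G t) + z r * G r) r := by
      apply h2.congr_of_eventuallyEq
      filter_upwards [hnhds] with x hx
      exact (hform x hx).1
    apply h3.congr_deriv
    have hz := (h.hz r hr).ne'
    rw [(hform r hr).1]
    simp only [hG]
    field_simp
  refine ⟨H, fun r hr => ⟨?_, hule r, hder r hr, ?_⟩⟩
  · have := hform r hr
    change z r ≤ ur r
    rw [this.1]
    nlinarith [h.hz r hr, this.2]
  · intro hvc
    have hnhds := isOpen_Ioo.mem_nhds hr
    apply intervalIntegral.integral_hasDerivAt_left (hfii r hr)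
    · exact ⟨Ioo 0 1, hnhds, hfm⟩
    · apply ContinuousAt.mul (hder r hr).continuousAt
      apply ContinuousAt.sub (h.he.continuousAt hnhds)
      exact ((hIz.continuousAt hnhds).mul (h.hc.continuousAt hnhds)).mul (hvc.pow 2)

end OpData

end CrossCurv


namespace CrossCurv

lemma OpData.sol {z φ E e c : ℝ → ℝ} (h : OpData z φ E e c) {u v H : ℝ → ℝ}
    (h1 : ∀ r ∈ Ioo (0:ℝ) 1, HasDerivAt u (-(φ r * E r * u r / z r) + φ r * H r / z r) r)
    (h2 : ∀ r ∈ Ioo (0:ℝ) 1, HasDerivAt H (-(u r * (e r - z r * c r * v r ^ 2))) r) :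
    ∀ r ∈ Ioo (0:ℝ) 1, HasDerivAt u (φ r * ((H r - E r * u r) / z r)) r ∧
      HasDerivAt (fun r => (H r - E r * u r) / z r) (u r * v r ^ 2 * c r) r := by
  intro r hr
  have hz := (h.hz r hr).ne'
  constructor
  · apply (h1 r hr).congr_deriv
    field_simp
    ring
  · have h3 := ((h2 r hr).fun_sub ((h.hEd r hr).fun_mul (h1 r hr))).fun_div (h.hzd r hr) hz
    apply h3.congr_deriv
    field_simp
    ring

structure YD (y₁ y₂ : ℝ → ℝ) : Prop where
  hy₁ : ContDiffOn ℝ ∞ y₁ (Ioo (-1 : ℝ) 2)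
  hy₂ : ContDiffOn ℝ ∞ y₂ (Ioo (-1 : ℝ) 2)
  hy₁pos : ∀ r ∈ Ioo (0 : ℝ) 1, 0 < y₁ r
  hy₂pos : ∀ r ∈ Ioo (0 : ℝ) 1, 0 < y₂ r
  h₁odd : ∀ t ∈ Ioo (-1 : ℝ) 1, y₁ (-t) = - y₁ t
  h₁even : ∀ t ∈ Ioo (-1 : ℝ) 1, y₁ (1 + t) = y₁ (1 - t)
  h₂even : ∀ t ∈ Ioo (-1 : ℝ) 1, y₂ (-t) = y₂ t
  h₂odd : ∀ t ∈ Ioo (-1 : ℝ) 1, y₂ (1 + t) = - y₂ (1 - t)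
  hy₁'0 : deriv y₁ 0 = 1
  hy₁1 : 0 < y₁ 1
  hy₂0 : 0 < y₂ 0
  hy₂'1 : deriv y₂ 1 = -1

/-- reflection -/
def fl (f : ℝ → ℝ) : ℝ → ℝ := fun r => f (1 - r)

lemma fl_smooth {f : ℝ → ℝ} (hf : ContDiffOn ℝ ∞ f (Ioo (-1 : ℝ) 2)) :
    ContDiffOn ℝ ∞ (fl f) (Ioo (-1 : ℝ) 2) := by
  apply hf.comp (by fun_prop : ContDiffOn ℝ ∞ (fun r : ℝ => 1 - r) (Ioo (-1 : ℝ) 2))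
  intro x hx
  exact ⟨by linarith [hx.2], by linarith [hx.1]⟩

lemma fl_hasDeriv {f : ℝ → ℝ} {f' r : ℝ} (h : HasDerivAt f f' (1 - r)) :
    HasDerivAt (fl f) (-f') r := by
  have h1 : HasDerivAt (fun r : ℝ => 1 - r) (-1) r := by
    simpa using (hasDerivAt_id r).const_sub 1
  exact (HasDerivAt.comp r h h1).congr_deriv (by ring)

lemma fl_fl (f : ℝ → ℝ) : fl (fl f) = f := by
  funext r
  simp [fl]

namespace YD

variable {y₁ y₂ : ℝ → ℝ}

lemma flip (h : YD y₁ y₂) : YD (fl y₂) (fl y₁) where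
  hy₁ := fl_smooth h.hy₂
  hy₂ := fl_smooth h.hy₁
  hy₁pos := fun r hr => h.hy₂pos _ ⟨by linarith [hr.2], by linarith [hr.1]⟩
  hy₂pos := fun r hr => h.hy₁pos _ ⟨by linarith [hr.2], by linarith [hr.1]⟩
  h₁odd := fun t ht => by
    have := h.h₂odd t ht
    simpa [fl] using this
  h₁even := fun t ht => by
    have := h.h₂even t ht
    simpa [fl] using this
  h₂even := fun t ht => by
    have := h.h₁even t ht
    simpa [fl] using this
  h₂odd := fun t ht => by
    have := h.h₁odd t ht
    simpa [fl] using this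
  hy₁'0 := by
    have h1 := smooth_hasDeriv h.hy₂ (r := 1 - 0) (by norm_num)
    have := (fl_hasDeriv h1).deriv
    rw [this, sub_zero, h.hy₂'1]; norm_num
  hy₁1 := by simpa [fl] using h.hy₂0
  hy₂0 := by simpa [fl] using h.hy₁1
  hy₂'1 := by
    have h1 := smooth_hasDeriv h.hy₁ (r := 1 - 1) (by norm_num)
    have := (fl_hasDeriv h1).deriv
    rw [this, sub_self, h.hy₁'0]

end YD

/-- `y / r` -/
noncomputable def kk (y : ℝ → ℝ) : ℝ → ℝ := Av 0 (deriv y)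

namespace YD

variable {y₁ y₂ : ℝ → ℝ}

lemma k_smooth (h : YD y₁ y₂) : ContDiffOn ℝ ∞ (kk y₁) (Ioo (-1 : ℝ) 2) :=
  Av_smooth (by norm_num) (by norm_num) 0 (smooth_deriv h.hy₁)

lemma y_zero (h : YD y₁ y₂) : y₁ 0 = 0 := by
  have := h.h₁odd 0 (by norm_num)
  simp only [neg_zero] at this
  linarith

lemma y_eq (h : YD y₁ y₂) {r : ℝ} (hr : r ∈ Ioo (-1 : ℝ) 2) : y₁ r = r * kk y₁ r := by
  have := hadamard (by norm_num) (by norm_num) h.hy₁ hr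
  rw [this, h.y_zero, zero_add]; rfl

lemma k_zero (h : YD y₁ y₂) : kk y₁ 0 = 1 := by
  simp [kk, Av, h.hy₁'0]

lemma k_pos (h : YD y₁ y₂) {r : ℝ} (hr : r ∈ Icc (0 : ℝ) 1) : 0 < kk y₁ r := by
  rcases eq_or_lt_of_le hr.1 with h0 | h0
  · rw [← h0, h.k_zero]; norm_num
  · have hy := h.y_eq (r := r) ⟨by linarith, by linarith [hr.2]⟩
    have hp : 0 < y₁ r := by
      rcases eq_or_lt_of_le hr.2 with h1 | h1
      · rw [h1]; exact h.hy₁1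
      · exact h.hy₁pos r ⟨h0, h1⟩
    rw [hy] at hp
    exact (mul_pos_iff_of_pos_left h0).1 hp

lemma k_even (h : YD y₁ y₂) : ∀ r ∈ Ioo (-1 : ℝ) 1, kk y₁ (-r) = kk y₁ r := by
  intro r hr
  by_cases h0 : r = 0
  · simp [h0]
  · have h1 := h.y_eq (r := r) ⟨by linarith [hr.1], by linarith [hr.2]⟩
    have h2 := h.y_eq (r := -r) ⟨by linarith [hr.2], by linarith [hr.1]⟩
    have h3 := h.h₁odd r hr
    rw [h1, h2] at h3
    apply mul_left_cancel₀ h0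
    linarith

/-- second factor: `y₂ = (1-r) k₂` -/
lemma y2_eq (h : YD y₁ y₂) {r : ℝ} (hr : r ∈ Ioo (-1 : ℝ) 2) :
    y₂ r = (1 - r) * fl (kk (fl y₂)) r := by
  have := h.flip.y_eq (r := 1 - r) ⟨by linarith [hr.2], by linarith [hr.1]⟩
  simpa [fl] using this

lemma k2_pos (h : YD y₁ y₂) {r : ℝ} (hr : r ∈ Icc (0 : ℝ) 1) : 0 < fl (kk (fl y₂)) r :=
  h.flip.k_pos (r := 1 - r) ⟨by linarith [hr.2], by linarith [hr.1]⟩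

lemma exists_op (h : YD y₁ y₂) : ∃ (n : ℕ) (E e : ℝ → ℝ),
    OpData (fun r => (1 - r) ^ (n+1)) (fun r => y₁ r / y₂ r) E e
      (fun r => 1 / (y₁ r * y₂ r)) := by
  set k := kk y₁ with hk
  set l := fl (kk (fl y₂)) with hl
  have hks : ContDiffOn ℝ ∞ k (Ioo (-1 : ℝ) 2) := h.k_smooth
  have hls : ContDiffOn ℝ ∞ l (Ioo (-1 : ℝ) 2) := fl_smooth h.flip.k_smooth
  have hkd : ∀ r ∈ Ioo (-1:ℝ) 2, HasDerivAt k (deriv k r) r := fun r hr => smooth_hasDeriv hks hr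
  have hld : ∀ r ∈ Ioo (-1:ℝ) 2, HasDerivAt l (deriv l r) r := fun r hr => smooth_hasDeriv hls hr
  have hkdc := (smooth_deriv hks).continuousOn
  have hldc := (smooth_deriv hls).continuousOn
  have hkc := hks.continuousOn
  have hlc := hls.continuousOn
  have hsub : Icc (0:ℝ) 1 ⊆ Ioo (-1:ℝ) 2 := fun x hx => ⟨by linarith [hx.1], by linarith [hx.2]⟩
  have hsub' : Ioo (0:ℝ) 1 ⊆ Ioo (-1:ℝ) 2 := fun x hx => hsub (Ioo_subset_Icc_self hx)
  have hkp : ∀ r ∈ Icc (0:ℝ) 1, 0 < k r := fun r hr => h.k_pos hr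
  have hlp : ∀ r ∈ Icc (0:ℝ) 1, 0 < l r := fun r hr => h.k2_pos hr
  have hy1 : ∀ r ∈ Icc (0:ℝ) 1, y₁ r = r * k r := fun r hr => h.y_eq (hsub hr)
  have hy2 : ∀ r ∈ Icc (0:ℝ) 1, y₂ r = (1 - r) * l r := fun r hr => h.y2_eq (hsub hr)
  obtain ⟨B, hB⟩ := isCompact_Icc.exists_bound_of_continuousOn
    (f := fun r => l r * deriv k r / k r - deriv l r) (s := Icc (0:ℝ) 1)
    ((((hlc.mul hkdc).mono hsub).div (hkc.mono hsub) (fun x hx => (hkp x hx).ne')).sub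
      (hldc.mono hsub))
  obtain ⟨x0, hx0, hmin⟩ := isCompact_Icc.exists_isMinOn (nonempty_Icc.2 zero_le_one)
    (hlc.mono hsub)
  set κ := l x0 with hκ
  have hκp : 0 < κ := hlp x0 hx0
  obtain ⟨n, hn⟩ := exists_nat_ge ((B + 1 / κ) / κ)
  have hn' : B + 1 / κ ≤ ((n:ℝ) + 1) * κ := by
    rw [div_le_iff₀ hκp] at hn
    nlinarith
  set N : ℝ := (n:ℝ) + 1 with hN
  have hN1 : 1 ≤ N := by simp [hN]
  set q : ℝ → ℝ := fun r => l r / (r * k r) with hq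
  set q' : ℝ → ℝ := fun r =>
    (deriv l r * (r * k r) - l r * (1 * k r + r * deriv k r)) / (r * k r) ^ 2 with hq'
  have hqd : ∀ r ∈ Ioo (0:ℝ) 1, HasDerivAt q (q' r) r := by
    intro r hr
    have hne : r * k r ≠ 0 := (mul_pos hr.1 (hkp r (Ioo_subset_Icc_self hr))).ne'
    exact (hld r (hsub' hr)).fun_div ((hasDerivAt_id' r).fun_mul (hkd r (hsub' hr))) hne
  have hzd : ∀ (m : ℕ) (r : ℝ), HasDerivAt (fun r : ℝ => (1 - r) ^ (m+1))
      (-(((m:ℝ)+1) * (1 - r) ^ m)) r := by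
    intro m r
    have h1 : HasDerivAt (fun r : ℝ => 1 - r) (-1) r := by
      simpa using (hasDerivAt_id r).const_sub 1
    apply (h1.fun_pow (m+1)).congr_deriv
    simp
  refine ⟨n, fun r => N * (1 - r) ^ (n+1) * q r,
    fun r => N * (N * (1 - r) ^ n * q r) - N * (1 - r) ^ (n+1) * q' r, ?_⟩
  have hIk := hkc.mono hsub'
  have hIl := hlc.mono hsub'
  have hIk' := hkdc.mono hsub'
  have hIl' := hldc.mono hsub'
  have hne : ∀ r ∈ Ioo (0:ℝ) 1, r * k r ≠ 0 := fun r hr =>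
    (mul_pos hr.1 (hkp r (Ioo_subset_Icc_self hr))).ne'
  have hyc1 : ContinuousOn y₁ (Ioo 0 1) := h.hy₁.continuousOn.mono hsub'
  have hyc2 : ContinuousOn y₂ (Ioo 0 1) := h.hy₂.continuousOn.mono hsub'
  constructor
  · intro r hr
    exact pow_pos (by linarith [hr.2]) _
  · fun_prop
  · simp
  · fun_prop
  · intro r hr
    have hr' := Ioo_subset_Icc_self hr
    apply (hzd n r).congr_deriv
    rw [hy1 r hr', hy2 r hr']
    simp only [hq]
    have h1 := (hkp r hr').ne'
    have h2 := (hlp r hr').ne'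
    have h3 : (1 - r) ≠ 0 := by linarith [hr.2]
    have h4 := hr.1.ne'
    field_simp
    ring
  · apply ContinuousOn.mul (by fun_prop)
    have hs : Ioc (0:ℝ) 1 ⊆ Icc 0 1 := Ioc_subset_Icc_self
    apply ContinuousOn.div (hlc.mono (hs.trans hsub))
      (continuousOn_id.mul (hkc.mono (hs.trans hsub)))
    intro x hx
    exact (mul_pos hx.1 (hkp x (hs hx))).ne'
  · simp
  · intro r hr
    apply (((hzd n r).const_mul N).fun_mul (hqd r hr)).congr_deriv
    ring
  · apply ContinuousOn.sub
    · apply ContinuousOn.mul (by fun_prop)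
      apply ContinuousOn.mul (by fun_prop)
      exact hIl.div (continuousOn_id.mul hIk) hne
    · apply ContinuousOn.mul (by fun_prop)
      apply ContinuousOn.div
      · fun_prop
      · fun_prop
      · intro x hx
        exact pow_ne_zero 2 (hne x hx)
  · apply ContinuousOn.div (by fun_prop) (by fun_prop)
    intro x hx
    exact (mul_pos (h.hy₁pos x hx) (h.hy₂pos x hx)).ne'
  · intro r hr
    exact one_div_pos.2 (mul_pos (h.hy₁pos r hr) (h.hy₂pos r hr))
  · exact hyc1.div hyc2 fun x hx => (h.hy₂pos x hx).ne'
  · intro r hr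
    exact div_pos (h.hy₁pos r hr) (h.hy₂pos r hr)
  · intro r hr
    have hr' := Ioo_subset_Icc_self hr
    have h1 := (hkp r hr')
    have h2 := (hlp r hr')
    have h3 : 0 < (1 - r) := by linarith [hr.2]
    have h4 := hr.1
    rw [← sub_nonneg]
    have hid : N * (N * (1 - r) ^ n * q r) - N * (1 - r) ^ (n+1) * q' r
        - (1 - r) ^ (n+1) * (1 / (y₁ r * y₂ r)) =
        (1 - r) ^ n / (r * k r) * (N * (N * l r) + N * (1 - r) *
          (l r / r + (l r * deriv k r / k r - deriv l r)) - 1 / l r) := by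
      rw [hy1 r hr', hy2 r hr']
      simp only [hq, hq']
      have h1' := h1.ne'
      have h2' := h2.ne'
      have h3' := h3.ne'
      have h4' := h4.ne'
      field_simp
      ring
    rw [hid]
    apply mul_nonneg (div_nonneg (pow_nonneg h3.le _) (mul_pos h4 h1).le)
    have h5 := hB r hr'
    rw [Real.norm_eq_abs, abs_le] at h5
    have h6 : κ ≤ l r := hmin hr'
    have h7 : 1 / l r ≤ 1 / κ := one_div_le_one_div_of_le hκp h6
    have h8 : 0 ≤ l r / r := (div_pos h2 h4).le
    set X := l r * deriv k r / k r - deriv l r with hX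
    have hB0 : 0 ≤ B := by linarith [h5.1, h5.2]
    have h9 : -B ≤ (1 - r) * (l r / r + X) := by nlinarith
    have h10 : 0 < 1 / κ := one_div_pos.2 hκp
    have h11 : N * κ ≤ N * l r := by nlinarith
    have h12 : 1 / κ ≤ N * l r + (1 - r) * (l r / r + X) := by linarith
    nlinarith

end YD

/-- solution of the first order system on `(0,1)` -/
structure Sol (y₁ y₂ u v J Q : ℝ → ℝ) : Prop where
  ub : ∃ n : ℕ, ∀ r ∈ Ioo (0:ℝ) 1, (1 - r) ^ n ≤ u r
  vb : ∃ n : ℕ, ∀ r ∈ Ioo (0:ℝ) 1, r ^ n ≤ v r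
  u1 : ∀ r ∈ Ioo (0:ℝ) 1, u r ≤ 1
  v1 : ∀ r ∈ Ioo (0:ℝ) 1, v r ≤ 1
  du : ∀ r ∈ Ioo (0:ℝ) 1, HasDerivAt u (y₁ r / y₂ r * J r) r
  dJ : ∀ r ∈ Ioo (0:ℝ) 1, HasDerivAt J (u r * v r ^ 2 / (y₁ r * y₂ r)) r
  dv : ∀ r ∈ Ioo (0:ℝ) 1, HasDerivAt v (y₂ r / y₁ r * Q r) r
  dQ : ∀ r ∈ Ioo (0:ℝ) 1, HasDerivAt Q (u r ^ 2 * v r / (y₁ r * y₂ r)) r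

lemma refl_mem {r : ℝ} (hr : r ∈ Ioo (0:ℝ) 1) : 1 - r ∈ Ioo (0:ℝ) 1 :=
  ⟨by linarith [hr.2], by linarith [hr.1]⟩

lemma Sol.flip {y₁ y₂ u v J Q : ℝ → ℝ} (h : Sol y₁ y₂ u v J Q) :
    Sol (fl y₂) (fl y₁) (fl v) (fl u) (fun r => - fl Q r) (fun r => - fl J r) where
  ub := by
    obtain ⟨n, hn⟩ := h.vb
    exact ⟨n, fun r hr => hn _ (refl_mem hr)⟩
  vb := by
    obtain ⟨n, hn⟩ := h.ub
    refine ⟨n, fun r hr => ?_⟩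
    simpa [fl] using hn _ (refl_mem hr)
  u1 := fun r hr => h.v1 _ (refl_mem hr)
  v1 := fun r hr => h.u1 _ (refl_mem hr)
  du := fun r hr => by
    apply (fl_hasDeriv (h.dv _ (refl_mem hr))).congr_deriv
    simp only [fl]; ring
  dv := fun r hr => by
    apply (fl_hasDeriv (h.du _ (refl_mem hr))).congr_deriv
    simp only [fl]; ring
  dJ := fun r hr => by
    apply (fl_hasDeriv (h.dQ _ (refl_mem hr))).fun_neg.congr_deriv
    simp only [fl, neg_neg]; ring
  dQ := fun r hr => by
    apply (fl_hasDeriv (h.dJ _ (refl_mem hr))).fun_neg.congr_deriv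
    simp only [fl, neg_neg]; ring

lemma YD.exists_sol {y₁ y₂ : ℝ → ℝ} (h : YD y₁ y₂) : ∃ u v J Q, Sol y₁ y₂ u v J Q := by
  obtain ⟨n, E, e, hop⟩ := h.exists_op
  obtain ⟨n', E', e', hop'⟩ := h.flip.exists_op
  set z : ℝ → ℝ := fun r => (1 - r) ^ (n+1) with hz
  set z' : ℝ → ℝ := fun r => (1 - r) ^ (n'+1) with hz'
  set φ : ℝ → ℝ := fun r => y₁ r / y₂ r with hφ
  set φ' : ℝ → ℝ := fun r => fl y₂ r / fl y₁ r with hφ'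
  set c : ℝ → ℝ := fun r => 1 / (y₁ r * y₂ r) with hc
  set c' : ℝ → ℝ := fun r => 1 / (fl y₂ r * fl y₁ r) with hc'
  let ρ : (ℝ → ENNReal) → (ℝ → ENNReal) := fun f r => f (1 - r)
  let Φ : ((ℝ → ENNReal) × (ℝ → ENNReal)ᵒᵈ) →o ((ℝ → ENNReal) × (ℝ → ENNReal)ᵒᵈ) :=
    { toFun := fun p => (1 ⊓ TO z φ e c p.1 (ρ (OrderDual.ofDual p.2)),
        OrderDual.toDual (1 ⊓ TO z' φ' e' c' (OrderDual.ofDual p.2) (ρ p.1)))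
      monotone' := by
        intro p p' hp
        have h1 : p.1 ≤ p'.1 := hp.1
        have h2 : OrderDual.ofDual p'.2 ≤ OrderDual.ofDual p.2 := hp.2
        refine ⟨?_, ?_⟩
        · exact inf_le_inf_left _ (TO_mono h1 (fun r => h2 (1 - r)))
        · exact OrderDual.toDual_le_toDual.2
            (inf_le_inf_left _ (TO_mono h2 (fun r => h1 (1 - r)))) }
  have hfix := Φ.map_lfp
  set p := OrderHom.lfp Φ with hp
  set u := p.1 with hu
  set w := OrderDual.ofDual p.2 with hw
  have hfu : 1 ⊓ TO z φ e c u (ρ w) = u := congrArg Prod.fst hfix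
  have hfw : 1 ⊓ TO z' φ' e' c' w (ρ u) = w := congrArg (fun q => OrderDual.ofDual q.2) hfix
  have hu1 : u ≤ 1 := by rw [← hfu]; exact inf_le_left
  have hw1 : w ≤ 1 := by rw [← hfw]; exact inf_le_left
  have hum : Measurable u := by
    rw [← hfu]; exact measurable_const.inf (TO_meas hop.hzm _ _)
  have hwm : Measurable w := by
    rw [← hfw]; exact measurable_const.inf (TO_meas hop'.hzm _ _)
  have hρm : ∀ f : ℝ → ENNReal, Measurable f → Measurable (ρ f) := fun f hf =>
    hf.comp (by fun_prop)
  have hfu' : ∀ r ∈ Ioo (0:ℝ) 1, u r = TO z φ e c u (ρ w) r := by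
    intro r hr
    conv_lhs => rw [← hfu]
    exact min_eq_right (hop.TO_le hu1 hr)
  have hfw' : ∀ r ∈ Ioo (0:ℝ) 1, w r = TO z' φ' e' c' w (ρ u) r := by
    intro r hr
    conv_lhs => rw [← hfw]
    exact min_eq_right (hop'.TO_le hw1 hr)
  obtain ⟨H, hH⟩ := hop.fix hu1 (v := ρ w) (fun r => hw1 (1 - r)) hum (hρm w hwm) hfu'
  obtain ⟨H', hH'⟩ := hop'.fix hw1 (v := ρ u) (fun r => hu1 (1 - r)) hwm (hρm u hum) hfw'
  set ur : ℝ → ℝ := fun r => (u r).toReal with hur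
  set wr : ℝ → ℝ := fun r => (w r).toReal with hwr
  have s1 := hop.sol (u := ur) (v := fl wr) (H := H) (fun r hr => (hH r hr).2.2.1) (fun r hr => by
    apply (hH r hr).2.2.2
    have h1 := (hH' _ (refl_mem hr)).2.2.1
    exact (fl_hasDeriv h1).continuousAt)
  have s2 := hop'.sol (u := wr) (v := fl ur) (H := H') (fun r hr => (hH' r hr).2.2.1)
    (fun r hr => by
    apply (hH' r hr).2.2.2
    have h1 := (hH _ (refl_mem hr)).2.2.1
    exact (fl_hasDeriv h1).continuousAt)
  refine ⟨ur, fl wr, fun r => (H r - E r * ur r) / z r,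
    fun r => - fl (fun r => (H' r - E' r * wr r) / z' r) r, ?_⟩
  constructor
  · exact ⟨n+1, fun r hr => (hH r hr).1⟩
  · refine ⟨n'+1, fun r hr => ?_⟩
    have := (hH' _ (refl_mem hr)).1
    simpa [hz', fl] using this
  · exact fun r hr => (hH r hr).2.1
  · exact fun r hr => (hH' _ (refl_mem hr)).2.1
  · exact fun r hr => (s1 r hr).1
  · intro r hr
    apply (s1 r hr).2.congr_deriv
    simp only [hc]; ring
  · intro r hr
    apply (fl_hasDeriv (s2 _ (refl_mem hr)).1).congr_deriv
    simp only [hφ', fl, sub_sub_cancel]; ring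
  · intro r hr
    apply (fl_hasDeriv (s2 _ (refl_mem hr)).2).fun_neg.congr_deriv
    simp only [hc', fl, sub_sub_cancel, neg_neg]; ring

end CrossCurv


namespace CrossCurv

lemma even_deriv_odd {f : ℝ → ℝ} {b : ℝ} (hf : ∀ t ∈ Ioo (-b) b, f (-t) = f t) :
    ∀ t ∈ Ioo (-b) b, deriv f (-t) = - deriv f t := by
  intro t ht
  have h1 : (fun s => f (-s)) =ᶠ[𝓝 t] f := by
    filter_upwards [isOpen_Ioo.mem_nhds ht] with s hs using hf s hs
  have h2 := h1.deriv_eq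
  rw [deriv_comp_neg] at h2
  linarith

/-- an even smooth function vanishing at the origin is divisible by the square -/
lemma even_div {f : ℝ → ℝ} (hf : ContDiffOn ℝ ∞ f (Ioo (-1 : ℝ) 1))
    (he : ∀ t ∈ Ioo (-1 : ℝ) 1, f (-t) = f t) (h0 : f 0 = 0) :
    ∃ m : ℝ → ℝ, ContDiffOn ℝ ∞ m (Ioo (-1 : ℝ) 1) ∧
      (∀ t ∈ Ioo (-1 : ℝ) 1, m (-t) = m t) ∧ ∀ r ∈ Ioo (-1 : ℝ) 1, f r = r ^ 2 * m r := by
  have hodd := even_deriv_odd he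
  have hd0 : deriv f 0 = 0 := by
    have := hodd 0 (by norm_num)
    simp only [neg_zero] at this
    linarith
  have hs1 := smooth_deriv hf
  have hs2 := smooth_deriv hs1
  have he2 : ∀ t ∈ Ioo (-1 : ℝ) 1, deriv (deriv f) (-t) = deriv (deriv f) t := by
    intro t ht
    have h1 : (fun s => deriv f (-s)) =ᶠ[𝓝 t] (fun s => - deriv f s) := by
      filter_upwards [isOpen_Ioo.mem_nhds ht] with s hs using hodd s hs
    have h2 := h1.deriv_eq
    rw [deriv_comp_neg, deriv.fun_neg] at h2
    linarith
  set p := Av 0 (deriv (deriv f)) with hp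
  have hps : ContDiffOn ℝ ∞ p (Ioo (-1 : ℝ) 1) := Av_smooth (by norm_num) (by norm_num) 0 hs2
  have hpd : ∀ r ∈ Ioo (-1 : ℝ) 1, deriv f r = r * p r := by
    intro r hr
    rw [hadamard (by norm_num) (by norm_num) hs1 hr, hd0, zero_add]
  refine ⟨Av 1 p, Av_smooth (by norm_num) (by norm_num) 1 hps, ?_, ?_⟩
  · exact Av_even (by norm_num) (Av_even (by norm_num) he2)
  · intro r hr
    have hsub : uIcc 0 r ⊆ Ioo (-1 : ℝ) 1 := by
      intro x hx
      rw [mem_uIcc] at hx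
      constructor <;> rcases hx with h | h <;> linarith [hr.1, hr.2, h.1, h.2]
    rw [show (2:ℕ) = 1 + 1 from rfl, Av_mul_pow, intervalIntegral.integral_eq_sub_of_hasDerivAt
      (f := f)]
    · rw [h0, sub_zero]
    · intro x hx
      rw [pow_one, ← hpd x (hsub hx)]
      exact smooth_hasDeriv hf (hsub hx)
    · apply ContinuousOn.intervalIntegrable
      exact (ContinuousOn.mul (by fun_prop) hps.continuousOn).mono hsub

structure LS (g h m u v J Q : ℝ → ℝ) : Prop where
  gs : ContDiffOn ℝ ∞ g (Ioo (-1 : ℝ) 1)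
  hs : ContDiffOn ℝ ∞ h (Ioo (-1 : ℝ) 1)
  ms : ContDiffOn ℝ ∞ m (Ioo (-1 : ℝ) 1)
  ge : ∀ t ∈ Ioo (-1 : ℝ) 1, g (-t) = g t
  he : ∀ t ∈ Ioo (-1 : ℝ) 1, h (-t) = h t
  me : ∀ t ∈ Ioo (-1 : ℝ) 1, m (-t) = m t
  gp : ∀ t ∈ Ioo (-1 : ℝ) 1, 0 < g t
  hp : ∀ t ∈ Ioo (-1 : ℝ) 1, 0 < h t
  gm : ∀ r ∈ Ioo (-1 : ℝ) 1, 1 / h r - (g r + r * deriv g r) = r ^ 2 * m r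
  ub : ∃ n : ℕ, ∀ r ∈ Ioo (0:ℝ) 1, (1 - r) ^ n ≤ u r
  vb : ∃ n : ℕ, ∀ r ∈ Ioo (0:ℝ) 1, r ^ n ≤ v r
  u1 : ∀ r ∈ Ioo (0:ℝ) 1, u r ≤ 1
  v1 : ∀ r ∈ Ioo (0:ℝ) 1, v r ≤ 1
  du : ∀ r ∈ Ioo (0:ℝ) 1, HasDerivAt u (r * g r * J r) r
  dJ : ∀ r ∈ Ioo (0:ℝ) 1, HasDerivAt J (u r * v r ^ 2 / (r * h r)) r
  dv : ∀ r ∈ Ioo (0:ℝ) 1, HasDerivAt v (Q r / (r * g r)) r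
  dQ : ∀ r ∈ Ioo (0:ℝ) 1, HasDerivAt Q (u r ^ 2 * v r / (r * h r)) r

lemma exists_LS {y₁ y₂ u v J Q : ℝ → ℝ} (hy : YD y₁ y₂) (hS : Sol y₁ y₂ u v J Q) :
    ∃ g h m, LS g h m u v J Q := by
  have hsub : Ioo (-1 : ℝ) 1 ⊆ Ioo (-1 : ℝ) 2 := Ioo_subset_Ioo_right (by norm_num)
  have hks : ContDiffOn ℝ ∞ (kk y₁) (Ioo (-1 : ℝ) 1) := hy.k_smooth.mono hsub
  have hys : ContDiffOn ℝ ∞ y₂ (Ioo (-1 : ℝ) 1) := hy.hy₂.mono hsub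
  have pos_of_even : ∀ f : ℝ → ℝ, (∀ t ∈ Ioo (-1 : ℝ) 1, f (-t) = f t) →
      (∀ t ∈ Ico (0 : ℝ) 1, 0 < f t) → ∀ t ∈ Ioo (-1 : ℝ) 1, 0 < f t := by
    intro f hf hp t ht
    rcases le_or_gt 0 t with h | h
    · exact hp t ⟨h, ht.2⟩
    · rw [← hf t ht]
      exact hp (-t) ⟨by linarith, by linarith [ht.1]⟩
  have hyp : ∀ t ∈ Ioo (-1 : ℝ) 1, 0 < y₂ t := by
    apply pos_of_even y₂ hy.h₂even
    intro t ht
    rcases eq_or_lt_of_le ht.1 with h | h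
    · rw [← h]; exact hy.hy₂0
    · exact hy.hy₂pos t ⟨h, ht.2⟩
  have hkp : ∀ t ∈ Ioo (-1 : ℝ) 1, 0 < kk y₁ t :=
    pos_of_even _ hy.k_even (fun t ht => hy.k_pos ⟨ht.1, ht.2.le⟩)
  set g : ℝ → ℝ := fun r => kk y₁ r / y₂ r with hg
  set h : ℝ → ℝ := fun r => kk y₁ r * y₂ r with hh
  have gs : ContDiffOn ℝ ∞ g (Ioo (-1 : ℝ) 1) := hks.div hys (fun t ht => (hyp t ht).ne')
  have hs : ContDiffOn ℝ ∞ h (Ioo (-1 : ℝ) 1) := hks.mul hys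
  have ge : ∀ t ∈ Ioo (-1 : ℝ) 1, g (-t) = g t := by
    intro t ht; simp only [hg, hy.k_even t ht, hy.h₂even t ht]
  have he : ∀ t ∈ Ioo (-1 : ℝ) 1, h (-t) = h t := by
    intro t ht; simp only [hh, hy.k_even t ht, hy.h₂even t ht]
  have gp : ∀ t ∈ Ioo (-1 : ℝ) 1, 0 < g t := fun t ht => div_pos (hkp t ht) (hyp t ht)
  have hp : ∀ t ∈ Ioo (-1 : ℝ) 1, 0 < h t := fun t ht => mul_pos (hkp t ht) (hyp t ht)
  obtain ⟨m, ms, me, gm⟩ := even_div (f := fun r => 1 / h r - (g r + r * deriv g r))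
    (by
      apply ContDiffOn.sub (contDiffOn_const.div hs (fun t ht => (hp t ht).ne'))
      exact gs.add (contDiffOn_id.mul (smooth_deriv gs)))
    (by
      intro t ht
      simp only [he t ht, ge t ht, even_deriv_odd ge t ht]; ring)
    (by
      simp only [hg, hh, hy.k_zero]; simp)
  have y1e : ∀ r ∈ Ioo (0:ℝ) 1, y₁ r = r * kk y₁ r := fun r hr =>
    hy.y_eq ⟨by linarith [hr.1], by linarith [hr.2]⟩
  have mm : ∀ r ∈ Ioo (0:ℝ) 1, r ∈ Ioo (-1:ℝ) 1 := fun r hr => ⟨by linarith [hr.1], hr.2⟩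
  refine ⟨g, h, m, gs, hs, ms, ge, he, me, gp, hp, gm, hS.ub, hS.vb, hS.u1, hS.v1, ?_, ?_, ?_, ?_⟩
  · intro r hr
    apply (hS.du r hr).congr_deriv
    rw [y1e r hr]; simp only [hg]; ring
  · intro r hr
    apply (hS.dJ r hr).congr_deriv
    rw [y1e r hr]; simp only [hh]; ring
  · intro r hr
    apply (hS.dv r hr).congr_deriv
    have := hr.1
    have := hkp r (mm r hr)
    have := hyp r (mm r hr)
    rw [y1e r hr]; simp only [hg]; field_simp
  · intro r hr
    apply (hS.dQ r hr).congr_deriv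
    rw [y1e r hr]; simp only [hh]; ring

end CrossCurv


namespace CrossCurv

lemma mono_of_hasDeriv {f f' : ℝ → ℝ} {a b : ℝ} (hab : a ≤ b)
    (hf : ∀ x ∈ Icc a b, HasDerivAt f (f' x) x) (h0 : ∀ x ∈ Icc a b, 0 ≤ f' x) : f a ≤ f b := by
  have : MonotoneOn f (Icc a b) := by
    apply monotoneOn_of_deriv_nonneg (convex_Icc a b)
    · exact fun x hx => (hf x hx).continuousAt.continuousWithinAt
    · exact fun x hx => (hf x (interior_subset hx)).differentiableAt.differentiableWithinAt
    · intro x hx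
      rw [(hf x (interior_subset hx)).deriv]
      exact h0 x (interior_subset hx)
  exact this (left_mem_Icc.2 hab) (right_mem_Icc.2 hab) hab

lemma strict_of_hasDeriv {f f' : ℝ → ℝ} {a b : ℝ} (hab : a < b)
    (hf : ∀ x ∈ Icc a b, HasDerivAt f (f' x) x) (h0 : ∀ x ∈ Icc a b, 0 < f' x) : f a < f b := by
  have : StrictMonoOn f (Icc a b) := by
    apply strictMonoOn_of_deriv_pos (convex_Icc a b)
    · exact fun x hx => (hf x hx).continuousAt.continuousWithinAt
    · intro x hx
      rw [(hf x (interior_subset hx)).deriv]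
      exact h0 x (interior_subset hx)
  exact this (left_mem_Icc.2 hab.le) (right_mem_Icc.2 hab.le) hab

lemma lim_of_bdd_deriv {f f' : ℝ → ℝ} {b C : ℝ} (hb : 0 < b)
    (hf : ∀ r ∈ Ioo 0 b, HasDerivAt f (f' r) r) (hC : ∀ r ∈ Ioo 0 b, |f' r| ≤ C) :
    ∃ l, Tendsto f (𝓝[>] 0) (𝓝 l) := by
  have hC0 : 0 ≤ C := (abs_nonneg _).trans (hC (b/2) ⟨by linarith, by linarith⟩)
  have h1 : LipschitzOnWith C.toNNReal f (Ioo 0 b) := by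
    apply (convex_Ioo 0 b).lipschitzOnWith_of_nnnorm_hasDerivWithin_le
      (fun x hx => (hf x hx).hasDerivWithinAt)
    intro x hx
    rw [← NNReal.coe_le_coe, coe_nnnorm, Real.coe_toNNReal _ hC0]
    exact hC x hx
  obtain ⟨F, hF, hFe⟩ := h1.extend_real
  refine ⟨F 0, ?_⟩
  have h2 : Tendsto F (𝓝[>] 0) (𝓝 (F 0)) :=
    (hF.continuous.tendsto 0).mono_left nhdsWithin_le_nhds
  apply h2.congr'
  filter_upwards [Ioo_mem_nhdsGT hb] with x hx using (hFe hx).symm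

namespace LS
variable {g h m u v J Q : ℝ → ℝ}

lemma mm {r : ℝ} (hr : r ∈ Ioo (0:ℝ) 1) : r ∈ Ioo (-1:ℝ) 1 := ⟨by linarith [hr.1], hr.2⟩

lemma up (H : LS g h m u v J Q) {r : ℝ} (hr : r ∈ Ioo (0:ℝ) 1) : 0 < u r := by
  obtain ⟨n, hn⟩ := H.ub
  exact lt_of_lt_of_le (pow_pos (by linarith [hr.2]) n) (hn r hr)

lemma vp (H : LS g h m u v J Q) {r : ℝ} (hr : r ∈ Ioo (0:ℝ) 1) : 0 < v r := by
  obtain ⟨n, hn⟩ := H.vb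
  exact lt_of_lt_of_le (pow_pos hr.1 n) (hn r hr)

lemma Q_lt (H : LS g h m u v J Q) {r s : ℝ} (hr : r ∈ Ioo (0:ℝ) 1) (hs : s ∈ Ioo (0:ℝ) 1)
    (hrs : r < s) : Q r < Q s := by
  have hm : ∀ x ∈ Icc r s, x ∈ Ioo (0:ℝ) 1 := fun x hx =>
    ⟨by linarith [hx.1, hr.1], by linarith [hx.2, hs.2]⟩
  apply strict_of_hasDeriv hrs (fun x hx => H.dQ x (hm x hx))
  intro x hx
  have h1 := H.up (hm x hx)
  have h2 := H.vp (hm x hx)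
  have h3 := H.hp x (mm (hm x hx))
  have h4 := (hm x hx).1
  positivity

lemma Q_nonneg (H : LS g h m u v J Q) {r₀ : ℝ} (hr₀ : r₀ ∈ Ioo (0:ℝ) 1) : 0 ≤ Q r₀ := by
  by_contra hneg
  push Not at hneg
  have hsub : Icc 0 r₀ ⊆ Ioo (-1:ℝ) 1 := fun x hx => ⟨by linarith [hx.1], by linarith [hx.2, hr₀.2]⟩
  obtain ⟨G, hG⟩ := isCompact_Icc.exists_bound_of_continuousOn (H.gs.continuousOn.mono hsub)
  have hGp : 0 < G := by
    have h1 := hG r₀ ⟨hr₀.1.le, le_rfl⟩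
    have h2 := H.gp r₀ (mm hr₀)
    rw [Real.norm_eq_abs, abs_of_pos h2] at h1
    linarith
  set δ := - Q r₀ with hδ
  have hδp : 0 < δ := by linarith
  set s := r₀ * Real.exp (-(2 * G / δ)) with hsd
  have he : Real.exp (-(2 * G / δ)) < 1 := by
    rw [Real.exp_lt_one_iff]
    have : 0 < 2 * G / δ := by positivity
    linarith
  have hs0 : 0 < s := mul_pos hr₀.1 (Real.exp_pos _)
  have hsr : s < r₀ := by
    have := mul_lt_mul_of_pos_left he hr₀.1
    linarith
  have hm : ∀ x ∈ Icc s r₀, x ∈ Ioo (0:ℝ) 1 := fun x hx =>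
    ⟨by linarith [hx.1], by linarith [hx.2, hr₀.2]⟩
  have key := mono_of_hasDeriv (f := fun x => -(v x + δ / G * Real.log x))
    (f' := fun x => -(Q x / (x * g x) + δ / G * x⁻¹)) hsr.le
    (by
      intro x hx
      have h1 := H.dv x (hm x hx)
      have h2 := (Real.hasDerivAt_log (hm x hx).1.ne').const_mul (δ / G)
      exact (h1.fun_add h2).fun_neg)
    (by
      intro x hx
      have hx0 := (hm x hx).1
      have hg0 := H.gp x (mm (hm x hx))
      have hg1 := hG x ⟨hx0.le, hx.2⟩
      rw [Real.norm_eq_abs, abs_of_pos hg0] at hg1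
      have hQ : Q x ≤ - δ := by
        rcases eq_or_lt_of_le hx.2 with h | h
        · rw [h]; simp [hδ]
        · have := H.Q_lt (hm x hx) hr₀ h
          linarith
      have h3 : Q x / (x * g x) ≤ - δ / (x * g x) := by gcongr
      have h4 : δ / (x * G) ≤ δ / (x * g x) := by gcongr
      have h5 : δ / G * x⁻¹ = δ / (x * G) := by field_simp
      rw [h5]
      rw [neg_div] at h3
      linarith)
  have hlog : Real.log s = Real.log r₀ - 2 * G / δ := by
    rw [hsd, Real.log_mul hr₀.1.ne' (Real.exp_pos _).ne', Real.log_exp]; ring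
  simp only [hlog] at key
  have h1 := H.v1 s (hm s ⟨le_rfl, hsr.le⟩)
  have h2 := H.vp hr₀
  have h3 : δ / G * (2 * G / δ) = 2 := by field_simp
  nlinarith

lemma Q_pos (H : LS g h m u v J Q) {r : ℝ} (hr : r ∈ Ioo (0:ℝ) 1) : 0 < Q r := by
  have h1 : r / 2 ∈ Ioo (0:ℝ) 1 := ⟨by linarith [hr.1], by linarith [hr.1, hr.2]⟩
  exact lt_of_le_of_lt (H.Q_nonneg h1) (H.Q_lt h1 hr (by linarith [hr.1]))

lemma v_lt (H : LS g h m u v J Q) {r s : ℝ} (hr : r ∈ Ioo (0:ℝ) 1) (hs : s ∈ Ioo (0:ℝ) 1)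
    (hrs : r < s) : v r < v s := by
  have hm : ∀ x ∈ Icc r s, x ∈ Ioo (0:ℝ) 1 := fun x hx =>
    ⟨by linarith [hx.1, hr.1], by linarith [hx.2, hs.2]⟩
  apply strict_of_hasDeriv hrs (fun x hx => H.dv x (hm x hx))
  intro x hx
  have h1 := H.Q_pos (hm x hx)
  have h3 := H.gp x (mm (hm x hx))
  have h4 := (hm x hx).1
  positivity

lemma u_bern (H : LS g h m u v J Q) : ∃ N : ℝ, 0 ≤ N ∧ ∀ r ∈ Ioo (0:ℝ) 1, 1 - u r ≤ N * r := by
  obtain ⟨n, hn⟩ := H.ub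
  refine ⟨n, n.cast_nonneg, fun r hr => ?_⟩
  have h1 := one_add_mul_le_pow (a := -r) (by linarith [hr.2]) n
  have h2 := hn r hr
  rw [← sub_eq_add_neg] at h1
  linarith

lemma u_lim (H : LS g h m u v J Q) : Tendsto u (𝓝[>] 0) (𝓝 1) := by
  obtain ⟨N, hN, h⟩ := H.u_bern
  have h1 : Tendsto (fun r : ℝ => 1 - N * r) (𝓝[>] 0) (𝓝 1) := by
    have : ContinuousAt (fun r : ℝ => 1 - N * r) 0 := by fun_prop
    have h2 := this.tendsto
    simp only [mul_zero, sub_zero] at h2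
    exact h2.mono_left nhdsWithin_le_nhds
  apply tendsto_of_tendsto_of_tendsto_of_le_of_le' h1 tendsto_const_nhds
  · filter_upwards [Ioo_mem_nhdsGT one_pos] with x hx
    linarith [h x hx]
  · filter_upwards [Ioo_mem_nhdsGT one_pos] with x hx using H.u1 x hx

lemma dR (H : LS g h m u v J Q) {r : ℝ} (hr : r ∈ Ioo (0:ℝ) 1) :
    HasDerivAt (fun r => r * Q r - r * g r * v r)
      (v r * ((u r ^ 2 - 1) / h r + r ^ 2 * m r)) r := by
  have h0 := hasDerivAt_id' r
  have h1 := H.dQ r hr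
  have h2 := H.dv r hr
  have h3 := smooth_hasDeriv H.gs (mm hr)
  have h4 := (h0.fun_mul h1).fun_sub ((h0.fun_mul h3).fun_mul h2)
  apply h4.congr_deriv
  rw [← H.gm r (mm hr)]
  have := hr.1
  have := H.gp r (mm hr)
  have := H.hp r (mm hr)
  field_simp
  ring

lemma bounds (H : LS g h m u v J Q) : ∃ A > 0, ∀ r ∈ Icc (0:ℝ) (1/2),
    g r ≤ A ∧ 1 / g r ≤ A ∧ 1 / h r ≤ A ∧ |m r| ≤ A := by
  have hsub : Icc 0 (1/2) ⊆ Ioo (-1:ℝ) 1 := fun x hx => ⟨by linarith [hx.1], by linarith [hx.2]⟩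
  obtain ⟨A1, h1⟩ := isCompact_Icc.exists_bound_of_continuousOn (H.gs.continuousOn.mono hsub)
  obtain ⟨A2, h2⟩ := isCompact_Icc.exists_bound_of_continuousOn
    ((continuousOn_const (c := (1:ℝ))).div (H.gs.continuousOn.mono hsub)
      (fun x hx => (H.gp x (hsub hx)).ne'))
  obtain ⟨A3, h3⟩ := isCompact_Icc.exists_bound_of_continuousOn
    ((continuousOn_const (c := (1:ℝ))).div (H.hs.continuousOn.mono hsub)
      (fun x hx => (H.hp x (hsub hx)).ne'))
  obtain ⟨A4, h4⟩ := isCompact_Icc.exists_bound_of_continuousOn (H.ms.continuousOn.mono hsub)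
  refine ⟨|A1| + |A2| + |A3| + |A4| + 1, by positivity, fun r hr => ?_⟩
  have a1 := (le_abs_self _).trans (h1 r hr)
  have a2 : 1 / g r ≤ A2 := (le_abs_self _).trans (h2 r hr)
  have a3 : 1 / h r ≤ A3 := (le_abs_self _).trans (h3 r hr)
  have a4 := h4 r hr
  rw [Real.norm_eq_abs] at a4
  have := abs_nonneg A1; have := abs_nonneg A2; have := abs_nonneg A3; have := abs_nonneg A4
  have := le_abs_self A1; have := le_abs_self A2; have := le_abs_self A3; have := le_abs_self A4
  refine ⟨by linarith, by linarith, by linarith, by linarith⟩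

lemma R_bound (H : LS g h m u v J Q) : ∃ C, 0 ≤ C ∧ ∀ r ∈ Ioo (0:ℝ) (1/2),
    |r * Q r - r * g r * v r| ≤ C * r ^ 2 * v r := by
  obtain ⟨A, hA, hb⟩ := H.bounds
  obtain ⟨N, hN, hu⟩ := H.u_bern
  set C := 2 * N * A + A with hC
  have hC0 : 0 ≤ C := by positivity
  refine ⟨C, hC0, fun r hr => ?_⟩
  have hrm : r ∈ Ioo (0:ℝ) 1 := ⟨hr.1, by linarith [hr.2]⟩
  set R := fun r => r * Q r - r * g r * v r with hR
  set B := Q (1/2) + A with hB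
  have hdb : ∀ x ∈ Ioc 0 r, |v x * ((u x ^ 2 - 1) / h x + x ^ 2 * m x)| ≤ C * r * v r := by
    intro x hx
    have hxm : x ∈ Ioo (0:ℝ) 1 := ⟨hx.1, by linarith [hx.2, hrm.2]⟩
    obtain ⟨b1, b2, b3, b4⟩ := hb x ⟨hx.1.le, by linarith [hx.2, hr.2]⟩
    have hv := H.vp hxm
    have hvr : v x ≤ v r := by
      rcases eq_or_lt_of_le hx.2 with h | h
      · rw [h]
      · exact (H.v_lt hxm hrm h).le
    have hup := H.up hxm
    have hu1 := H.u1 x hxm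
    have hux := hu x hxm
    have hhp := H.hp x (mm hxm)
    have e1 : |(u x ^ 2 - 1) / h x| ≤ 2 * N * A * x := by
      rw [abs_div, abs_of_pos hhp, div_eq_mul_one_div]
      have : |u x ^ 2 - 1| ≤ 2 * (N * x) := by
        rw [abs_of_nonpos (by nlinarith)]
        nlinarith
      have h0 : 0 ≤ 2 * (N * x) := (abs_nonneg _).trans this
      calc |u x ^ 2 - 1| * (1 / h x) ≤ (2 * (N * x)) * A := by gcongr
        _ = 2 * N * A * x := by ring
    have e2 : |x ^ 2 * m x| ≤ A * x := by
      rw [abs_mul, abs_of_nonneg (sq_nonneg x)]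
      calc x ^ 2 * |m x| ≤ x ^ 2 * A := by gcongr
        _ ≤ A * x := by nlinarith [hxm.1, hxm.2, mul_pos hA hxm.1]
    have e3 := (abs_add_le ((u x ^ 2 - 1) / h x) (x ^ 2 * m x)).trans (add_le_add e1 e2)
    rw [abs_mul, abs_of_pos hv]
    calc v x * |(u x ^ 2 - 1) / h x + x ^ 2 * m x| ≤ v r * (C * r) := by
          have : 2 * N * A * x + A * x ≤ C * r := by
            have := mul_le_mul_of_nonneg_left hx.2 hC0
            rw [hC] at this ⊢
            linarith
          apply mul_le_mul hvr (e3.trans this) (abs_nonneg _)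
          linarith
      _ = C * r * v r := by ring
  have key : ∀ s ∈ Ioo 0 r, |R r| ≤ C * r ^ 2 * v r + s * B := by
    intro s hs
    have hsm : s ∈ Ioo (0:ℝ) 1 := ⟨hs.1, by linarith [hs.2, hrm.2]⟩
    have h1 := (convex_Icc s r).norm_image_sub_le_of_norm_hasDerivWithin_le (f := R)
      (f' := fun x => v x * ((u x ^ 2 - 1) / h x + x ^ 2 * m x)) (C := C * r * v r)
      (x := s) (y := r)
      (fun x hx => (H.dR (r := x) ⟨by linarith [hx.1, hs.1], by linarith [hx.2, hrm.2]⟩).hasDerivWithinAt)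
      (fun x hx => hdb x ⟨by linarith [hx.1, hs.1], hx.2⟩)
      (left_mem_Icc.2 hs.2.le) (right_mem_Icc.2 hs.2.le)
    rw [Real.norm_eq_abs, Real.norm_eq_abs, abs_of_pos (by linarith [hs.2] : 0 < r - s)] at h1
    have h2 : |R s| ≤ s * B := by
      have q1 := H.Q_pos hsm
      have q2 := H.Q_lt hsm (s := 1/2) (by norm_num) (by linarith [hs.2, hr.2])
      obtain ⟨b1, -⟩ := hb s ⟨hs.1.le, by linarith [hs.2, hr.2]⟩
      have hg := H.gp s (mm hsm)
      have hv := H.vp hsm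
      have hv1 := H.v1 s hsm
      have e : R s = s * (Q s - g s * v s) := by simp only [hR]; ring
      rw [e, abs_mul, abs_of_pos hs.1]
      apply mul_le_mul_of_nonneg_left _ hs.1.le
      have : g s * v s ≤ A := by nlinarith
      have : 0 < g s * v s := by positivity
      rw [abs_le]
      constructor <;> rw [hB] <;> linarith
    have h3 : C * r * v r * (r - s) ≤ C * r ^ 2 * v r := by
      have : 0 ≤ C * r * v r := mul_nonneg (mul_nonneg hC0 hr.1.le) (H.vp hrm).le
      nlinarith [hs.1]
    have h4 : |R r| ≤ |R r - R s| + |R s| := by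
      have := abs_add_le (R r - R s) (R s)
      simpa using this
    linarith
  have ht : Tendsto (fun s : ℝ => C * r ^ 2 * v r + s * B) (𝓝[>] 0) (𝓝 (C * r ^ 2 * v r)) := by
    have : ContinuousAt (fun s : ℝ => C * r ^ 2 * v r + s * B) 0 := by fun_prop
    have h2 := this.tendsto
    simp only [zero_mul, add_zero] at h2
    exact h2.mono_left nhdsWithin_le_nhds
  apply ge_of_tendsto ht
  filter_upwards [Ioo_mem_nhdsGT hr.1] with s hs using key s hs

lemma w_lim (H : LS g h m u v J Q) : ∃ w₀ > 0, Tendsto (fun r => v r / r) (𝓝[>] 0) (𝓝 w₀) := by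
  obtain ⟨A, hA, hb⟩ := H.bounds
  obtain ⟨C, hC, hR⟩ := H.R_bound
  obtain ⟨l, hl⟩ := lim_of_bdd_deriv (f := fun r => Real.log (v r) - Real.log r)
    (f' := fun r => (r * Q r - r * g r * v r) / (r ^ 2 * g r * v r)) (b := 1/2) (C := C * A)
    (by norm_num)
    (by
      intro r hr
      have hrm : r ∈ Ioo (0:ℝ) 1 := ⟨hr.1, by linarith [hr.2]⟩
      have h1 := H.vp hrm
      have h2 := ((H.dv r hrm).log h1.ne').fun_sub (Real.hasDerivAt_log hr.1.ne')
      apply h2.congr_deriv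
      have := hr.1
      have := H.gp r (mm hrm)
      field_simp)
    (by
      intro r hr
      have hrm : r ∈ Ioo (0:ℝ) 1 := ⟨hr.1, by linarith [hr.2]⟩
      have h1 := H.vp hrm
      have h2 := H.gp r (mm hrm)
      have h3 := hr.1
      obtain ⟨-, b2, -⟩ := hb r ⟨hr.1.le, hr.2.le⟩
      have hp : 0 < r ^ 2 * g r * v r := by positivity
      rw [abs_div, abs_of_pos hp, div_le_iff₀ hp]
      refine (hR r hr).trans ?_
      have : 1 ≤ A * g r := by
        rw [div_le_iff₀ h2] at b2; exact b2
      calc C * r ^ 2 * v r = (C * r ^ 2 * v r) * 1 := by ring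
        _ ≤ (C * r ^ 2 * v r) * (A * g r) := by gcongr
        _ = C * A * (r ^ 2 * g r * v r) := by ring)
  refine ⟨Real.exp l, Real.exp_pos l, ?_⟩
  apply (hl.rexp).congr'
  filter_upwards [Ioo_mem_nhdsGT one_pos] with r hr
  rw [Real.exp_sub, Real.exp_log (H.vp hr), Real.exp_log hr.1]

lemma J_lim (H : LS g h m u v J Q) : ∃ J₀, Tendsto J (𝓝[>] 0) (𝓝 J₀) := by
  obtain ⟨A, hA, hb⟩ := H.bounds
  obtain ⟨w₀, hw₀, hw⟩ := H.w_lim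
  have h1 : ∀ᶠ r in 𝓝[>] (0:ℝ), v r / r < w₀ + 1 := hw.eventually_lt_const (by linarith)
  have h2 : {r : ℝ | v r / r < w₀ + 1 ∧ r < 1/2} ∈ 𝓝[>] (0:ℝ) := by
    filter_upwards [h1, Ioo_mem_nhdsGT (show (0:ℝ) < 1/2 by norm_num)] with r h1 h2
    exact ⟨h1, h2.2⟩
  obtain ⟨b, hb0, hbs⟩ := (mem_nhdsGT_iff_exists_Ioo_subset).1 h2
  apply lim_of_bdd_deriv (b := b) (C := (w₀ + 1) ^ 2 * A) hb0
    (f' := fun r => u r * v r ^ 2 / (r * h r))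
  · intro r hr
    have := hbs hr
    exact H.dJ r ⟨hr.1, by linarith [this.2]⟩
  · intro r hr
    obtain ⟨c1, c2⟩ := hbs hr
    have hrm : r ∈ Ioo (0:ℝ) 1 := ⟨hr.1, by linarith⟩
    obtain ⟨-, -, b3, -⟩ := hb r ⟨hr.1.le, c2.le⟩
    have h1 := H.vp hrm
    have h2 := H.hp r (mm hrm)
    have h3 := hr.1
    have h4 := H.up hrm
    have h5 := H.u1 r hrm
    have e : u r * v r ^ 2 / (r * h r) = (u r * r) * (v r / r) ^ 2 * (1 / h r) := by
      field_simp
    rw [e, abs_of_pos (by positivity)]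
    have h6 : u r * r ≤ 1 := by nlinarith
    calc (u r * r) * (v r / r) ^ 2 * (1 / h r) ≤ 1 * (w₀ + 1) ^ 2 * A := by gcongr
      _ = _ := by ring

end LS
end CrossCurv


namespace CrossCurv

/-- even extension with prescribed value at the origin -/
noncomputable def evx (f : ℝ → ℝ) (a : ℝ) : ℝ → ℝ := fun r => if r = 0 then a else f |r|

lemma evx_neg (f : ℝ → ℝ) (a r : ℝ) : evx f a (-r) = evx f a r := by simp [evx]

lemma evx_zero (f : ℝ → ℝ) (a : ℝ) : evx f a 0 = a := by simp [evx]

lemma evx_pos (f : ℝ → ℝ) (a : ℝ) {r : ℝ} (hr : 0 < r) : evx f a r = f r := by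
  simp [evx, hr.ne', abs_of_pos hr]

lemma evx_cont {f : ℝ → ℝ} {a : ℝ} (hf : ∀ r ∈ Ioo (0:ℝ) 1, ContinuousAt f r)
    (ha : Tendsto f (𝓝[>] 0) (𝓝 a)) : ∀ r ∈ Ioo (-1:ℝ) 1, ContinuousAt (evx f a) r := by
  intro r hr
  rcases eq_or_ne r 0 with rfl | h
  · rw [continuousAt_iff_punctured_nhds, evx_zero]
    apply (ha.comp tendsto_abs_nhdsNE_zero).congr'
    filter_upwards [self_mem_nhdsWithin] with x hx
    have hx' : x ≠ 0 := hx
    simp [evx, hx']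
  · have h1 : |r| ∈ Ioo (0:ℝ) 1 := ⟨abs_pos.2 h, abs_lt.2 hr⟩
    have h2 : ContinuousAt (fun x => f |x|) r :=
      ContinuousAt.comp (g := f) (f := fun x : ℝ => |x|) (hf _ h1) continuous_abs.continuousAt
    apply h2.congr
    filter_upwards [isOpen_ne.mem_nhds h] with x hx
    have hx' : x ≠ 0 := hx
    simp [evx, hx']

lemma evx_deriv {f G : ℝ → ℝ} {a : ℝ} (hf : ∀ r ∈ Ioo (0:ℝ) 1, HasDerivAt f (G r) r)
    (ha : Tendsto f (𝓝[>] 0) (𝓝 a)) (hG : ContinuousAt G 0)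
    (hodd : ∀ r ∈ Ioo (-1:ℝ) 1, G (-r) = - G r) :
    ∀ r ∈ Ioo (-1:ℝ) 1, HasDerivAt (evx f a) (G r) r := by
  have hpos : ∀ r ∈ Ioo (0:ℝ) 1, HasDerivAt (evx f a) (G r) r := by
    intro r hr
    apply (hf r hr).congr_of_eventuallyEq
    filter_upwards [isOpen_Ioo.mem_nhds hr] with x hx using evx_pos f a hx.1
  have hneg : ∀ r ∈ Ioo (-1:ℝ) 0, HasDerivAt (evx f a) (G r) r := by
    intro r hr
    have h1 := hpos (-r) ⟨by linarith [hr.2], by linarith [hr.1]⟩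
    have h2 : HasDerivAt (fun x => evx f a (-x)) (G (-r) * (-1)) r :=
      h1.comp r (hasDerivAt_neg r)
    rw [hodd r ⟨hr.1, by linarith [hr.2]⟩] at h2
    simp only [evx_neg, mul_neg, mul_one, neg_neg] at h2
    exact h2
  intro r hr
  rcases lt_trichotomy r 0 with h | rfl | h
  · exact hneg r ⟨hr.1, h⟩
  · have hc := evx_cont (fun r hr => (hf r hr).continuousAt) ha 0 hr
    have A : HasDerivWithinAt (evx f a) (G 0) (Ici 0) 0 := by
      apply hasDerivWithinAt_Ici_of_tendsto_deriv (s := Ioo 0 1)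
        (fun y hy => (hpos y hy).differentiableAt.differentiableWithinAt) hc.continuousWithinAt
        (Ioo_mem_nhdsGT one_pos)
      have : Tendsto G (𝓝[>] 0) (𝓝 (G 0)) := tendsto_inf_left hG
      apply this.congr'
      filter_upwards [Ioo_mem_nhdsGT one_pos] with y hy using (hpos y hy).deriv.symm
    have B : HasDerivWithinAt (evx f a) (G 0) (Iic 0) 0 := by
      apply hasDerivWithinAt_Iic_of_tendsto_deriv (s := Ioo (-1) 0)
        (fun y hy => (hneg y hy).differentiableAt.differentiableWithinAt) hc.continuousWithinAt
        (Ioo_mem_nhdsLT (by norm_num))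
      have : Tendsto G (𝓝[<] 0) (𝓝 (G 0)) := tendsto_inf_left hG
      apply this.congr'
      filter_upwards [Ioo_mem_nhdsLT (show (-1:ℝ) < 0 by norm_num)] with y hy
        using (hneg y hy).deriv.symm
    simpa using B.union A
  · exact hpos r ⟨h, hr.2⟩

lemma cd_succ {f f' : ℝ → ℝ} (n : ℕ) (hf : ∀ r ∈ Ioo (-1:ℝ) 1, HasDerivAt f (f' r) r)
    (hf' : ContDiffOn ℝ n f' (Ioo (-1:ℝ) 1)) : ContDiffOn ℝ (n + 1 : ℕ) f (Ioo (-1:ℝ) 1) := by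
  rw [Nat.cast_add, Nat.cast_one, contDiffOn_succ_iff_deriv_of_isOpen isOpen_Ioo]
  refine ⟨fun r hr => (hf r hr).differentiableAt.differentiableWithinAt, by simp, ?_⟩
  exact hf'.congr (fun r hr => (hf r hr).deriv)

lemma eq_Av {f p : ℝ → ℝ} (j : ℕ) (hp : ContinuousOn p (Ioo (-1:ℝ) 1))
    (hf : ∀ r ∈ Ioo (-1:ℝ) 1, HasDerivAt f (r ^ j * p r) r) :
    ∀ r ∈ Ioo (-1:ℝ) 1, f r = f 0 + r ^ (j+1) * Av j p r := by
  intro r hr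
  have hsub : uIcc 0 r ⊆ Ioo (-1 : ℝ) 1 := by
    intro x hx
    rw [mem_uIcc] at hx
    constructor <;> rcases hx with h | h <;> linarith [hr.1, hr.2, h.1, h.2]
  rw [Av_mul_pow, intervalIntegral.integral_eq_sub_of_hasDerivAt (f := f)]
  · ring
  · exact fun x hx => hf x (hsub hx)
  · apply ContinuousOn.intervalIntegrable
    exact (ContinuousOn.mul (by fun_prop) hp).mono hsub

lemma LS.R_lim {g h m u v J Q : ℝ → ℝ} (H : LS g h m u v J Q) :
    Tendsto (fun r => r * Q r - r * g r * v r) (𝓝[>] 0) (𝓝 0) := by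
  obtain ⟨C, hC, hR⟩ := H.R_bound
  have ht : Tendsto (fun s : ℝ => C * s ^ 2) (𝓝[>] 0) (𝓝 0) := by
    have : ContinuousAt (fun s : ℝ => C * s ^ 2) 0 := by fun_prop
    have h2 := this.tendsto
    simp only [ne_eq, OfNat.ofNat_ne_zero, not_false_eq_true, zero_pow, mul_zero] at h2
    exact h2.mono_left nhdsWithin_le_nhds
  apply squeeze_zero_norm' _ ht
  filter_upwards [Ioo_mem_nhdsGT (show (0:ℝ) < 1/2 by norm_num)] with r hr
  have h1 := H.v1 r ⟨hr.1, by linarith [hr.2]⟩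
  refine (hR r hr).trans ?_
  have : 0 ≤ C * r ^ 2 := by positivity
  nlinarith

lemma LS.regular {g h m u v J Q : ℝ → ℝ} (H : LS g h m u v J Q) :
    ∃ U W : ℝ → ℝ, ContDiffOn ℝ ∞ U (Ioo (-1:ℝ) 1) ∧ ContDiffOn ℝ ∞ W (Ioo (-1:ℝ) 1) ∧
      (∀ r, U (-r) = U r) ∧ (∀ r, W (-r) = W r) ∧ U 0 = 1 ∧ 0 < W 0 ∧
      ∀ r ∈ Ioo (0:ℝ) 1, U r = u r ∧ r * W r = v r := by
  obtain ⟨w₀, hw₀, hw⟩ := H.w_lim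
  obtain ⟨J₀, hJ⟩ := H.J_lim
  have hn : (-1:ℝ) < 0 := by norm_num
  have h0m : (0:ℝ) ∈ Ioo (-1:ℝ) 1 := by norm_num
  have cu : ∀ r ∈ Ioo (0:ℝ) 1, ContinuousAt u r := fun r hr => (H.du r hr).continuousAt
  have cv : ∀ r ∈ Ioo (0:ℝ) 1, ContinuousAt (fun r => v r / r) r := fun r hr =>
    (H.dv r hr).continuousAt.div continuousAt_id hr.1.ne'
  have cJ : ∀ r ∈ Ioo (0:ℝ) 1, ContinuousAt J r := fun r hr => (H.dJ r hr).continuousAt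
  set U := evx u 1 with hU
  set W := evx (fun r => v r / r) w₀ with hW
  set X := evx J J₀ with hX
  have Uc : ∀ r ∈ Ioo (-1:ℝ) 1, ContinuousAt U r := evx_cont cu H.u_lim
  have Wc : ∀ r ∈ Ioo (-1:ℝ) 1, ContinuousAt W r := evx_cont cv hw
  have Xc : ∀ r ∈ Ioo (-1:ℝ) 1, ContinuousAt X r := evx_cont cJ hJ
  have Ucc : ContinuousOn U (Ioo (-1:ℝ) 1) := fun r hr => (Uc r hr).continuousWithinAt
  have Wcc : ContinuousOn W (Ioo (-1:ℝ) 1) := fun r hr => (Wc r hr).continuousWithinAt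
  have Xcc : ContinuousOn X (Ioo (-1:ℝ) 1) := fun r hr => (Xc r hr).continuousWithinAt
  have gcc := H.gs.continuousOn
  have hcc := H.hs.continuousOn
  have mcc := H.ms.continuousOn
  have hne : ∀ r ∈ Ioo (-1:ℝ) 1, h r ≠ 0 := fun r hr => (H.hp r hr).ne'
  have gne : ∀ r ∈ Ioo (-1:ℝ) 1, g r ≠ 0 := fun r hr => (H.gp r hr).ne'
  have toAt : ∀ {f : ℝ → ℝ}, ContinuousOn f (Ioo (-1:ℝ) 1) → ContinuousAt f 0 :=
    fun hf => hf.continuousAt (isOpen_Ioo.mem_nhds h0m)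
  have Ue : ∀ r, U (-r) = U r := evx_neg _ _
  have We : ∀ r, W (-r) = W r := evx_neg _ _
  have Xe : ∀ r, X (-r) = X r := evx_neg _ _
  have U0 : U 0 = 1 := evx_zero _ _
  have dU : ∀ r ∈ Ioo (-1:ℝ) 1, HasDerivAt U (r ^ 1 * (g r * X r)) r := by
    apply evx_deriv _ H.u_lim
    · exact toAt (ContinuousOn.mul (by fun_prop) (gcc.mul Xcc))
    · intro r hr
      rw [H.ge r hr, Xe]; ring
    · intro r hr
      apply (H.du r hr).congr_deriv
      rw [hX, evx_pos _ _ hr.1]; ring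
  have dX : ∀ r ∈ Ioo (-1:ℝ) 1, HasDerivAt X (r * (U r * W r ^ 2 / h r)) r := by
    apply evx_deriv _ hJ
    · exact toAt (ContinuousOn.mul (by fun_prop) ((Ucc.mul (Wcc.pow 2)).div hcc hne))
    · intro r hr
      rw [H.he r hr, Ue, We]; ring
    · intro r hr
      apply (H.dJ r hr).congr_deriv
      rw [hU, hW, evx_pos _ _ hr.1, evx_pos _ _ hr.1]
      have := hr.1
      have := hne r (LS.mm hr)
      field_simp
  set P := Av 1 (fun r => g r * X r) with hP
  have Pcc : ContinuousOn P (Ioo (-1:ℝ) 1) := Av_cont hn one_pos 1 (gcc.mul Xcc)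
  have Pe : ∀ r ∈ Ioo (-1:ℝ) 1, P (-r) = P r :=
    Av_even one_pos (fun r hr => by rw [H.ge r hr, Xe])
  have UP : ∀ r ∈ Ioo (-1:ℝ) 1, U r = 1 + r ^ 2 * P r := by
    intro r hr
    have := eq_Av 1 (gcc.mul Xcc) dU r hr
    rw [U0] at this
    exact this
  set M := fun r => P r * (U r + 1) / h r + m r with hM
  have Mcc : ContinuousOn M (Ioo (-1:ℝ) 1) :=
    ((Pcc.mul (Ucc.add continuousOn_const)).div hcc hne).add mcc
  have Me : ∀ r ∈ Ioo (-1:ℝ) 1, M (-r) = M r := by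
    intro r hr
    simp only [hM, Pe r hr, Ue, H.he r hr, H.me r hr]
  have dR : ∀ r ∈ Ioo (-1:ℝ) 1, HasDerivAt (evx (fun r => r * Q r - r * g r * v r) 0)
      (r ^ 3 * (W r * M r)) r := by
    apply evx_deriv _ H.R_lim
    · exact toAt (ContinuousOn.mul (by fun_prop) (Wcc.mul Mcc))
    · intro r hr
      rw [We, Me r hr]; ring
    · intro r hr
      apply (H.dR hr).congr_deriv
      have e : u r = U r := (evx_pos _ _ hr.1).symm
      have e2 : W r = v r / r := evx_pos _ _ hr.1
      have e3 : u r ^ 2 - 1 = r ^ 2 * P r * (U r + 1) := by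
        rw [e]
        linear_combination (U r + 1) * UP r (LS.mm hr)
      rw [e3, e2]
      simp only [hM]
      have := hr.1
      have := hne r (LS.mm hr)
      field_simp
  set S := Av 3 (fun r => W r * M r) with hS
  have Scc : ContinuousOn S (Ioo (-1:ℝ) 1) := Av_cont hn one_pos 3 (Wcc.mul Mcc)
  have Se : ∀ r ∈ Ioo (-1:ℝ) 1, S (-r) = S r :=
    Av_even one_pos (fun r hr => by rw [Me r hr, We])
  have RS : ∀ r ∈ Ioo (0:ℝ) 1, r * Q r - r * g r * v r = r ^ 4 * S r := by
    intro r hr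
    have := eq_Av 3 (Wcc.mul Mcc) dR r (LS.mm hr)
    rw [evx_zero, evx_pos _ _ hr.1, zero_add] at this
    exact this
  have dW : ∀ r ∈ Ioo (-1:ℝ) 1, HasDerivAt W (r * (S r / g r)) r := by
    apply evx_deriv _ hw
    · exact toAt (ContinuousOn.mul (by fun_prop) (Scc.div gcc gne))
    · intro r hr
      rw [H.ge r hr, Se r hr]; ring
    · intro r hr
      apply ((H.dv r hr).fun_div (hasDerivAt_id' r) hr.1.ne').congr_deriv
      have h1 := hr.1
      have h2 := gne r (LS.mm hr)
      have h3 := RS r hr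
      field_simp
      have : r * (r * r ^ 2 * S r - (Q r - g r * v r)) = 0 := by linear_combination -h3
      rcases mul_eq_zero.1 this with h | h
      · exact absurd h h1.ne'
      · linarith
  have main : ∀ n : ℕ, ContDiffOn ℝ n U (Ioo (-1:ℝ) 1) ∧ ContDiffOn ℝ n W (Ioo (-1:ℝ) 1) ∧
      ContDiffOn ℝ n X (Ioo (-1:ℝ) 1) := by
    intro n
    induction n with
    | zero => simp only [Nat.cast_zero, contDiffOn_zero]; exact ⟨Ucc, Wcc, Xcc⟩
    | succ n ih =>
      obtain ⟨iU, iW, iX⟩ := ih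
      have ig : ContDiffOn ℝ n g (Ioo (-1:ℝ) 1) := contDiffOn_infty.1 H.gs n
      have ihh : ContDiffOn ℝ n h (Ioo (-1:ℝ) 1) := contDiffOn_infty.1 H.hs n
      have im : ContDiffOn ℝ n m (Ioo (-1:ℝ) 1) := contDiffOn_infty.1 H.ms n
      have iP : ContDiffOn ℝ n P (Ioo (-1:ℝ) 1) := Av_contDiff hn one_pos n 1 (ig.mul iX)
      have iM : ContDiffOn ℝ n M (Ioo (-1:ℝ) 1) :=
        ((iP.mul (iU.add contDiffOn_const)).div ihh hne).add im
      have iS : ContDiffOn ℝ n S (Ioo (-1:ℝ) 1) := Av_contDiff hn one_pos n 3 (iW.mul iM)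
      refine ⟨cd_succ n dU ?_, cd_succ n dW ?_, cd_succ n dX ?_⟩
      · exact (contDiffOn_id.pow 1).mul (ig.mul iX)
      · exact contDiffOn_id.mul (iS.div ig gne)
      · exact contDiffOn_id.mul ((iU.mul (iW.pow 2)).div ihh hne)
  refine ⟨U, W, contDiffOn_infty.2 fun n => (main n).1, contDiffOn_infty.2 fun n => (main n).2.1,
    Ue, We, U0, ?_, ?_⟩
  · rw [hW, evx_zero]; exact hw₀
  · intro r hr
    refine ⟨evx_pos _ _ hr.1, ?_⟩
    rw [hW, evx_pos _ _ hr.1]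
    have := hr.1
    field_simp

end CrossCurv


namespace CrossCurv

lemma deriv_zero_of_even {f : ℝ → ℝ} (hf : ∀ t ∈ Ioo (-1:ℝ) 1, f (-t) = f t) : deriv f 0 = 0 := by
  have := even_deriv_odd hf 0 (by norm_num)
  simp only [neg_zero] at this
  linarith

lemma hasDeriv_id_mul {W : ℝ → ℝ} (hW : ContDiffOn ℝ ∞ W (Ioo (-1:ℝ) 1)) :
    HasDerivAt (fun r => r * W r) (W 0) 0 := by
  have h1 := smooth_hasDeriv hW (r := 0) (by norm_num)
  exact ((hasDerivAt_id' (0:ℝ)).fun_mul h1).congr_deriv (by ring)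

lemma fl_smooth' {f : ℝ → ℝ} (hf : ContDiffOn ℝ ∞ f (Ioo (-1 : ℝ) 1)) :
    ContDiffOn ℝ ∞ (fl f) (Ioo (0 : ℝ) 2) := by
  apply hf.comp (by fun_prop : ContDiffOn ℝ ∞ (fun r : ℝ => 1 - r) (Ioo (0 : ℝ) 2))
  intro x hx
  exact ⟨by linarith [hx.2], by linarith [hx.1]⟩

lemma glue_smooth {f a b : ℝ → ℝ} (ha : ContDiffOn ℝ ∞ a (Ioo (-1:ℝ) 1))
    (hb : ContDiffOn ℝ ∞ b (Ioo (0:ℝ) 2)) (hfa : ∀ r ∈ Ioo (-1:ℝ) 1, f r = a r)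
    (hfb : ∀ r ∈ Ioo (0:ℝ) 2, f r = b r) : ContDiffOn ℝ ∞ f (Ioo (-1:ℝ) 2) := by
  have h1 := (ha.congr hfa).union_of_isOpen (hb.congr hfb) isOpen_Ioo isOpen_Ioo
  apply h1.mono
  intro x hx
  rcases lt_or_ge x 1 with h | h
  · exact Or.inl ⟨hx.1, h⟩
  · exact Or.inr ⟨by linarith, hx.2⟩

theorem main {y₁ y₂ : ℝ → ℝ} (hy : YD y₁ y₂) :
    ∃ l₁ l₂ : ℝ → ℝ,
      ContDiffOn ℝ ∞ l₁ (Ioo (-1 : ℝ) 2) ∧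
      ContDiffOn ℝ ∞ l₂ (Ioo (-1 : ℝ) 2) ∧
      (∀ t ∈ Ioo (-1 : ℝ) 1, l₁ (-t) = l₁ t) ∧
      (∀ t ∈ Ioo (-1 : ℝ) 1, l₁ (1 + t) = - l₁ (1 - t)) ∧
      (∀ t ∈ Ioo (-1 : ℝ) 1, l₂ (-t) = - l₂ t) ∧
      (∀ t ∈ Ioo (-1 : ℝ) 1, l₂ (1 + t) = l₂ (1 - t)) ∧
      (∀ t ∈ Ioo (0 : ℝ) 1,
        deriv (fun s => deriv l₁ s / (y₁ s / y₂ s)) t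
          = l₁ t * (l₂ t) ^ 2 / (y₁ t * y₂ t)) ∧
      (∀ t ∈ Ioo (0 : ℝ) 1,
        deriv (fun s => deriv l₂ s / (y₂ s / y₁ s)) t
          = (l₁ t) ^ 2 * l₂ t / (y₁ t * y₂ t)) ∧
      l₁ 0 = -1 ∧ deriv l₁ 0 = 0 ∧ l₂ 0 = 0 ∧
      l₁ 1 = 0 ∧ l₂ 1 = 1 ∧ deriv l₂ 1 = 0 ∧
      0 < deriv l₂ 0 ∧ 0 < deriv l₁ 1 ∧
      (∀ t ∈ Ioo (0 : ℝ) 1, -1 < l₁ t ∧ l₁ t < 0 ∧ 0 < l₂ t ∧ l₂ t < 1) := by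
  obtain ⟨u, v, J, Q, hS⟩ := hy.exists_sol
  obtain ⟨g, h, m, H⟩ := exists_LS hy hS
  obtain ⟨g', h', m', H'⟩ := exists_LS hy.flip hS.flip
  obtain ⟨U, W, Us, Ws, Ue, We, U0, W0, e⟩ := H.regular
  obtain ⟨U', W', Us', Ws', Ue', We', U0', W0', e'⟩ := H'.regular
  have E1 : ∀ r ∈ Ioo (0:ℝ) 1, U' (1 - r) = v r ∧ (1 - r) * W' (1 - r) = u r := by
    intro r hr
    have := e' (1 - r) (refl_mem hr)
    simpa [fl] using this
  set l₁ : ℝ → ℝ := fun r => if r < 1 then - U r else - ((1 - r) * W' (1 - r)) with hl₁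
  set l₂ : ℝ → ℝ := fun r => if r < 1 then r * W r else U' (1 - r) with hl₂
  have a1 : ∀ r ∈ Ioo (-1:ℝ) 1, l₁ r = - U r := fun r hr => by simp [hl₁, hr.2]
  have a2 : ∀ r ∈ Ioo (-1:ℝ) 1, l₂ r = r * W r := fun r hr => by simp [hl₂, hr.2]
  have b1 : ∀ r ∈ Ioo (0:ℝ) 2, l₁ r = - ((1 - r) * W' (1 - r)) := by
    intro r hr
    rcases lt_or_ge r 1 with h | h
    · rw [a1 r ⟨by linarith [hr.1], h⟩, (E1 r ⟨hr.1, h⟩).2, (e r ⟨hr.1, h⟩).1]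
    · simp only [hl₁, if_neg (not_lt.2 h)]
  have b2 : ∀ r ∈ Ioo (0:ℝ) 2, l₂ r = U' (1 - r) := by
    intro r hr
    rcases lt_or_ge r 1 with h | h
    · rw [a2 r ⟨by linarith [hr.1], h⟩, (E1 r ⟨hr.1, h⟩).1, (e r ⟨hr.1, h⟩).2]
    · simp only [hl₂, if_neg (not_lt.2 h)]
  have c1 : ∀ r ∈ Ioo (0:ℝ) 1, l₁ r = - u r := fun r hr => by
    rw [a1 r (LS.mm hr), (e r hr).1]
  have c2 : ∀ r ∈ Ioo (0:ℝ) 1, l₂ r = v r := fun r hr => by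
    rw [a2 r (LS.mm hr), (e r hr).2]
  have even1 : ∀ t ∈ Ioo (-1 : ℝ) 1, l₁ (-t) = l₁ t := by
    intro t ht
    rw [a1 t ht, a1 (-t) ⟨by linarith [ht.2], by linarith [ht.1]⟩, Ue]
  have d1 : ∀ r ∈ Ioo (0:ℝ) 1, deriv l₁ r = - (y₁ r / y₂ r * J r) := by
    intro r hr
    have : l₁ =ᶠ[𝓝 r] fun r => - u r := by
      filter_upwards [isOpen_Ioo.mem_nhds hr] with x hx using c1 x hx
    rw [this.deriv_eq]
    exact (hS.du r hr).fun_neg.deriv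
  have d2 : ∀ r ∈ Ioo (0:ℝ) 1, deriv l₂ r = y₂ r / y₁ r * Q r := by
    intro r hr
    have : l₂ =ᶠ[𝓝 r] v := by
      filter_upwards [isOpen_Ioo.mem_nhds hr] with x hx using c2 x hx
    rw [this.deriv_eq]
    exact (hS.dv r hr).deriv
  have m02 : ∀ t ∈ Ioo (-1:ℝ) 1, 1 + t ∈ Ioo (0:ℝ) 2 ∧ 1 - t ∈ Ioo (0:ℝ) 2 := fun t ht =>
    ⟨⟨by linarith [ht.1], by linarith [ht.2]⟩, ⟨by linarith [ht.2], by linarith [ht.1]⟩⟩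
  have n1 : Ioo (0:ℝ) 2 ∈ 𝓝 (1:ℝ) := isOpen_Ioo.mem_nhds (by norm_num)
  have n0 : Ioo (-1:ℝ) 1 ∈ 𝓝 (0:ℝ) := isOpen_Ioo.mem_nhds (by norm_num)
  refine ⟨l₁, l₂, ?_, ?_, even1, ?_, ?_, ?_, ?_, ?_, ?_, deriv_zero_of_even even1, ?_, ?_, ?_, ?_,
    ?_, ?_, ?_⟩
  · exact glue_smooth Us.neg (fl_smooth' (f := fun x => -(x * W' x))
      (contDiffOn_id.mul Ws').neg) a1 b1
  · exact glue_smooth (contDiffOn_id.mul Ws) (fl_smooth' Us') a2 b2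
  · intro t ht
    rw [b1 _ (m02 t ht).1, b1 _ (m02 t ht).2]
    rw [show 1 - (1 + t) = -t by ring, show 1 - (1 - t) = t by ring, We']; ring
  · intro t ht
    rw [a2 t ht, a2 (-t) ⟨by linarith [ht.2], by linarith [ht.1]⟩, We]; ring
  · intro t ht
    rw [b2 _ (m02 t ht).1, b2 _ (m02 t ht).2]
    rw [show 1 - (1 + t) = -t by ring, show 1 - (1 - t) = t by ring, Ue']
  · intro t ht
    have : (fun s => deriv l₁ s / (y₁ s / y₂ s)) =ᶠ[𝓝 t] fun s => - J s := by
      filter_upwards [isOpen_Ioo.mem_nhds ht] with x hx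
      have := hy.hy₁pos x hx
      have := hy.hy₂pos x hx
      rw [d1 x hx]
      field_simp
    rw [this.deriv_eq, (hS.dJ t ht).fun_neg.deriv, c1 t ht, c2 t ht]
    ring
  · intro t ht
    have : (fun s => deriv l₂ s / (y₂ s / y₁ s)) =ᶠ[𝓝 t] Q := by
      filter_upwards [isOpen_Ioo.mem_nhds ht] with x hx
      have := hy.hy₁pos x hx
      have := hy.hy₂pos x hx
      rw [d2 x hx]
      field_simp
    rw [this.deriv_eq, (hS.dQ t ht).deriv, c1 t ht, c2 t ht]
    ring
  · rw [a1 0 (by norm_num), U0]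
  · rw [a2 0 (by norm_num), zero_mul]
  · rw [b1 1 (by norm_num)]; simp
  · rw [b2 1 (by norm_num)]; simpa using U0'
  · have : l₂ =ᶠ[𝓝 1] fl U' := by
      filter_upwards [n1] with x hx using b2 x hx
    rw [this.deriv_eq]
    have h1 := smooth_hasDeriv Us' (r := 1 - 1) (by norm_num)
    rw [(fl_hasDeriv h1).deriv, sub_self, deriv_zero_of_even (fun t _ => Ue' t), neg_zero]
  · have : l₂ =ᶠ[𝓝 0] fun x => x * W x := by
      filter_upwards [n0] with x hx using a2 x hx
    rw [this.deriv_eq, (hasDeriv_id_mul Ws).deriv]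
    exact W0
  · have : l₁ =ᶠ[𝓝 1] fl (fun x => -(x * W' x)) := by
      filter_upwards [n1] with x hx using b1 x hx
    have h1 : HasDerivAt (fun x => -(x * W' x)) (-(W' 0)) (1 - 1) := by
      rw [sub_self]; exact (hasDeriv_id_mul Ws').fun_neg
    rw [this.deriv_eq, (fl_hasDeriv h1).deriv, neg_neg]
    exact W0'
  · intro t ht
    rw [c1 t ht, c2 t ht]
    have p1 := H.up ht
    have p2 := H.vp ht
    have q1 : t / 2 ∈ Ioo (0:ℝ) 1 := ⟨by linarith [ht.1], by linarith [ht.1, ht.2]⟩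
    have q2 : (1 + t) / 2 ∈ Ioo (0:ℝ) 1 := ⟨by linarith [ht.1], by linarith [ht.1, ht.2]⟩
    have s1 := H'.v_lt (refl_mem ht) (refl_mem q1) (by linarith [ht.1])
    simp only [fl, sub_sub_cancel] at s1
    have s2 := H.v_lt ht q2 (by linarith [ht.2])
    have s3 := H.u1 _ q1
    have s4 := H.v1 _ q2
    exact ⟨by linarith, by linarith, p2, by linarith⟩

end CrossCurv


end

/-- global existence for the `SO(2)×SO(2)` boundary-value problem.
Here `y₁, y₂` are smooth on `(-1,2)`, positive on `(0,1)`, with the stated parity and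
boundary behaviour, `φ₁ = y₁/y₂`, `φ₂ = y₂/y₁`, `σ = y₁ y₂`.  There exist `l₁, l₂`
(given by restrictions to `[0,1]` of smooth functions on `(-1,2)` with the stated
parity) solving the system with the boundary conditions and sign properties. -/
theorem stmt_8 (y₁ y₂ : ℝ → ℝ)
    (hy₁ : ContDiffOn ℝ (⊤ : ℕ∞) y₁ (Set.Ioo (-1 : ℝ) 2))
    (hy₂ : ContDiffOn ℝ (⊤ : ℕ∞) y₂ (Set.Ioo (-1 : ℝ) 2))
    (hy₁pos : ∀ r ∈ Set.Ioo (0 : ℝ) 1, 0 < y₁ r)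
    (hy₂pos : ∀ r ∈ Set.Ioo (0 : ℝ) 1, 0 < y₂ r)
    (h₁odd : ∀ t ∈ Set.Ioo (-1 : ℝ) 1, y₁ (-t) = - y₁ t)
    (h₁even : ∀ t ∈ Set.Ioo (-1 : ℝ) 1, y₁ (1 + t) = y₁ (1 - t))
    (h₂even : ∀ t ∈ Set.Ioo (-1 : ℝ) 1, y₂ (-t) = y₂ t)
    (h₂odd : ∀ t ∈ Set.Ioo (-1 : ℝ) 1, y₂ (1 + t) = - y₂ (1 - t))
    (hy₁'0 : deriv y₁ 0 = 1) (hy₁1 : 0 < y₁ 1) (hy₂0 : 0 < y₂ 0)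
    (hy₂'1 : deriv y₂ 1 = -1) :
    ∃ l₁ l₂ : ℝ → ℝ,
      ContDiffOn ℝ (⊤ : ℕ∞) l₁ (Set.Ioo (-1 : ℝ) 2) ∧
      ContDiffOn ℝ (⊤ : ℕ∞) l₂ (Set.Ioo (-1 : ℝ) 2) ∧
      (∀ t ∈ Set.Ioo (-1 : ℝ) 1, l₁ (-t) = l₁ t) ∧
      (∀ t ∈ Set.Ioo (-1 : ℝ) 1, l₁ (1 + t) = - l₁ (1 - t)) ∧
      (∀ t ∈ Set.Ioo (-1 : ℝ) 1, l₂ (-t) = - l₂ t) ∧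
      (∀ t ∈ Set.Ioo (-1 : ℝ) 1, l₂ (1 + t) = l₂ (1 - t)) ∧
      (∀ t ∈ Set.Ioo (0 : ℝ) 1,
        deriv (fun s => deriv l₁ s / (y₁ s / y₂ s)) t
          = l₁ t * (l₂ t) ^ 2 / (y₁ t * y₂ t)) ∧
      (∀ t ∈ Set.Ioo (0 : ℝ) 1,
        deriv (fun s => deriv l₂ s / (y₂ s / y₁ s)) t
          = (l₁ t) ^ 2 * l₂ t / (y₁ t * y₂ t)) ∧
      l₁ 0 = -1 ∧ deriv l₁ 0 = 0 ∧ l₂ 0 = 0 ∧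
      l₁ 1 = 0 ∧ l₂ 1 = 1 ∧ deriv l₂ 1 = 0 ∧
      0 < deriv l₂ 0 ∧ 0 < deriv l₁ 1 ∧
      (∀ t ∈ Set.Ioo (0 : ℝ) 1, -1 < l₁ t ∧ l₁ t < 0 ∧ 0 < l₂ t ∧ l₂ t < 1) := by
  exact CrossCurv.main ⟨hy₁, hy₂, hy₁pos, hy₂pos, h₁odd, h₁even, h₂even, h₂odd, hy₁'0, hy₁1, hy₂0, hy₂'1⟩
end

section
/- Suppose l₁, l₂ : [0,1] → ℝ are C² functions that solve on (0,1) the system (l₁'/φ₁)' = l₁·l₂²/σ and (l₂'/φ₂)' = l₁²·l₂/σ and satisfy l₁(0) = −1, l₁'(0) = 0, l₂(0) = 0, l₁(1) = 0, l₂(1) = 1, l₂'(1) = 0. Then l₁(t) < 0 and l₂(t) > 0 for all t ∈ (0,1). -/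
open Set Filter Topology

lemma key_neg (p q l w : ℝ → ℝ)
    (hp : ∀ t ∈ Ioo (0 : ℝ) 1, 0 < p t) (hq : ∀ t ∈ Ioo (0 : ℝ) 1, 0 ≤ q t)
    (hpc : ContinuousOn p (Ioo 0 1)) (hqc : ContinuousOn q (Ioo 0 1))
    (hlc : ContinuousOn l (Icc 0 1))
    (hl : ∀ t ∈ Ioo (0 : ℝ) 1, HasDerivAt l (p t * w t) t)
    (hw : ∀ t ∈ Ioo (0 : ℝ) 1, HasDerivAt w (q t * l t) t)
    (hlim : Tendsto (fun t => l t * w t) (𝓝[<] 1) (𝓝 0))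
    (h0 : l 0 < 0) : ∀ t ∈ Ioo (0 : ℝ) 1, l t < 0 := by
  have hF : ∀ t ∈ Ioo (0 : ℝ) 1, HasDerivAt (fun t => l t * w t)
      (p t * w t * w t + l t * (q t * l t)) t := fun t ht => (hl t ht).mul (hw t ht)
  have hFm : MonotoneOn (fun t => l t * w t) (Ioo 0 1) := by
    apply monotoneOn_of_deriv_nonneg (convex_Ioo 0 1)
    · exact fun t ht => (hF t ht).continuousAt.continuousWithinAt
    · intro t ht
      rw [interior_Ioo] at ht
      exact (hF t ht).differentiableAt.differentiableWithinAt
    · intro t ht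
      rw [interior_Ioo] at ht
      rw [(hF t ht).deriv]
      have h1 := hp t ht
      have h2 := hq t ht
      have : 0 ≤ p t * (w t)^2 + q t * (l t)^2 := by positivity
      linarith
  have hFn : ∀ t ∈ Ioo (0 : ℝ) 1, l t * w t ≤ 0 := by
    intro t ht
    refine ge_of_tendsto hlim ?_
    filter_upwards [Ioo_mem_nhdsLT ht.2] with s hs
    exact hFm ht ⟨ht.1.trans hs.1, hs.2⟩ hs.1.le
  have hG : ∀ t ∈ Ioo (0 : ℝ) 1, HasDerivAt (fun t => l t * l t)
      (p t * w t * l t + l t * (p t * w t)) t := fun t ht => (hl t ht).mul (hl t ht)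
  have hGm : AntitoneOn (fun t => l t * l t) (Ioo 0 1) := by
    apply antitoneOn_of_deriv_nonpos (convex_Ioo 0 1)
    · exact fun t ht => (hG t ht).continuousAt.continuousWithinAt
    · intro t ht
      rw [interior_Ioo] at ht
      exact (hG t ht).differentiableAt.differentiableWithinAt
    · intro t ht
      rw [interior_Ioo] at ht
      rw [(hG t ht).deriv]
      nlinarith [mul_nonneg (hp t ht).le (neg_nonneg.2 (hFn t ht))]
  have hne : ∀ t ∈ Ioo (0 : ℝ) 1, l t ≠ 0 := by
    intro t ht hz
    have hzr : ∀ s ∈ Ioo t 1, l s = 0 := by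
      intro s hs
      have := hGm ht ⟨ht.1.trans hs.1, hs.2⟩ hs.1.le
      simp only [hz, mul_zero] at this
      nlinarith [mul_self_nonneg (l s), mul_self_eq_zero.1 (le_antisymm this (mul_self_nonneg (l s)))]
    obtain ⟨b, hb⟩ := exists_between ht.2
    have hbI : b ∈ Ioo (0 : ℝ) 1 := ⟨ht.1.trans hb.1, hb.2⟩
    have hlb : l b = 0 := hzr b hb
    have hwb : w b = 0 := by
      have h1 : HasDerivAt l 0 b := by
        refine (hasDerivAt_const b (0 : ℝ)).congr_of_eventuallyEq ?_
        filter_upwards [Ioo_mem_nhds hb.1 hb.2] with s hs using hzr s hs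
      have h2 := (hl b hbI).unique h1
      exact (mul_eq_zero.1 h2).resolve_left (hp b hbI).ne'
    have hzl : ∀ a ∈ Ioo 0 b, l a = 0 := by
      intro a ha
      have hsub : Icc a b ⊆ Ioo (0 : ℝ) 1 := fun x hx => ⟨ha.1.trans_le hx.1, hx.2.trans_lt hb.2⟩
      obtain ⟨M, hM⟩ := (isCompact_Icc (a := a) (b := b)).exists_bound_of_continuousOn
        ((hpc.add hqc).mono hsub)
      have hE : ∀ t ∈ Icc a b, HasDerivAt (fun t => (l t * l t + w t * w t) * Real.exp (M * t))
          (((p t * w t * l t + l t * (p t * w t)) + (q t * l t * w t + w t * (q t * l t)))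
            * Real.exp (M * t) + (l t * l t + w t * w t) * (Real.exp (M * t) * (M * 1))) t := by
        intro t ht
        have ht' := hsub ht
        exact (((hl t ht').mul (hl t ht')).add ((hw t ht').mul (hw t ht'))).mul
          (((hasDerivAt_id t).const_mul M).exp)
      have hEm : MonotoneOn (fun t => (l t * l t + w t * w t) * Real.exp (M * t)) (Icc a b) := by
        apply monotoneOn_of_deriv_nonneg (convex_Icc a b)
        · exact fun t ht => (hE t ht).continuousAt.continuousWithinAt
        · intro t ht
          exact (hE t (interior_subset ht)).differentiableAt.differentiableWithinAt
        · intro t ht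
          have ht' := interior_subset ht
          rw [(hE t ht').deriv]
          have h1 := hp t (hsub ht')
          have h2 := hq t (hsub ht')
          have h3 : p t + q t ≤ M := (le_abs_self _).trans (hM t ht')
          have h4 : 0 ≤ (p t + q t) * (l t + w t)^2 + (M - (p t + q t)) * (l t ^2 + w t^2) :=
            add_nonneg (by positivity) (mul_nonneg (by linarith) (by positivity))
          have h5 := mul_nonneg h4 (Real.exp_pos (M * t)).le
          linarith
      have h := hEm (left_mem_Icc.2 ha.2.le) (right_mem_Icc.2 ha.2.le) ha.2.le
      simp only [hlb, hwb, mul_zero, add_zero, zero_mul] at h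
      have h' : l a * l a + w a * w a ≤ 0 := by
        by_contra hc
        push Not at hc
        exact absurd h (not_le.2 (mul_pos hc (Real.exp_pos _)))
      nlinarith [mul_self_nonneg (w a), mul_self_nonneg (l a),
        mul_self_eq_zero.1 (le_antisymm (by nlinarith [mul_self_nonneg (w a)]) (mul_self_nonneg (l a)))]
    have hc0 : Tendsto l (𝓝[>] 0) (𝓝 (l 0)) := by
      have := (hlc 0 (by simp)).mono Ioo_subset_Icc_self
      rwa [ContinuousWithinAt, nhdsWithin_Ioo_eq_nhdsGT one_pos] at this
    have : (0 : ℝ) ≤ l 0 := by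
      refine ge_of_tendsto hc0 ?_
      filter_upwards [Ioo_mem_nhdsGT hbI.1] with s hs
      exact (hzl s hs).ge
    linarith
  intro t ht
  by_contra hc
  push Not at hc
  obtain ⟨s, hs, hs0⟩ := intermediate_value_Icc ht.1.le
    (hlc.mono (Icc_subset_Icc_right ht.2.le)) ⟨h0.le, hc⟩
  have hs1 : s ≠ 0 := by rintro rfl; exact h0.ne hs0
  exact hne s ⟨lt_of_le_of_ne hs.1 hs1.symm, hs.2.trans_lt ht.2⟩ hs0

/-- interior derivatives of a solution -/
lemma sol_deriv (φ l : ℝ → ℝ) (hφ : ∀ t ∈ Ioo (0 : ℝ) 1, 0 < φ t)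
    (hφd : ∀ t ∈ Ioo (0 : ℝ) 1, DifferentiableAt ℝ φ t)
    (hl : ContDiffOn ℝ 2 l (Icc 0 1)) (t : ℝ) (ht : t ∈ Ioo (0 : ℝ) 1) :
    HasDerivAt l (φ t * (deriv l t / φ t)) t ∧
      DifferentiableAt ℝ (fun s => deriv l s / φ s) t := by
  have hc : ContDiffAt ℝ 2 l t := hl.contDiffAt (Icc_mem_nhds ht.1 ht.2)
  have hd : DifferentiableAt ℝ (deriv l) t := by
    have h2 : ContDiffOn ℝ 1 (deriv l) (Ioo 0 1) :=
      (hl.mono Ioo_subset_Icc_self).deriv_of_isOpen isOpen_Ioo (by norm_num)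
    exact (h2.contDiffAt (Ioo_mem_nhds ht.1 ht.2)).differentiableAt (by norm_num)
  refine ⟨?_, hd.div (hφd t ht) (hφ t ht).ne'⟩
  rw [mul_div_cancel₀ _ (hφ t ht).ne']
  exact (hc.differentiableAt (by norm_num)).hasDerivAt

lemma deriv_tendsto (l : ℝ → ℝ) (hl : ContDiffOn ℝ 2 l (Icc 0 1)) (x : ℝ) (hx : x ∈ Icc (0 : ℝ) 1) :
    Tendsto (deriv l) (𝓝[Ioo 0 1] x) (𝓝 (derivWithin l (Icc 0 1) x)) := by
  have h := hl.continuousOn_derivWithin (uniqueDiffOn_Icc one_pos) (by norm_num)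
  refine Tendsto.congr' ?_ ((h x hx).mono Ioo_subset_Icc_self)
  filter_upwards [self_mem_nhdsWithin] with s hs
  exact derivWithin_of_mem_nhds (Icc_mem_nhds hs.1 hs.2)

theorem stmt_9 (y₁ y₂ : ℝ → ℝ)
    (hy₁ : ContDiffOn ℝ (⊤ : ℕ∞) y₁ (Set.Ioo (-1 : ℝ) 2))
    (hy₂ : ContDiffOn ℝ (⊤ : ℕ∞) y₂ (Set.Ioo (-1 : ℝ) 2))
    (hy₁pos : ∀ r ∈ Set.Ioo (0 : ℝ) 1, 0 < y₁ r)
    (hy₂pos : ∀ r ∈ Set.Ioo (0 : ℝ) 1, 0 < y₂ r)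
    (h₁odd : ∀ t ∈ Set.Ioo (-1 : ℝ) 1, y₁ (-t) = - y₁ t)
    (h₁even : ∀ t ∈ Set.Ioo (-1 : ℝ) 1, y₁ (1 + t) = y₁ (1 - t))
    (h₂even : ∀ t ∈ Set.Ioo (-1 : ℝ) 1, y₂ (-t) = y₂ t)
    (h₂odd : ∀ t ∈ Set.Ioo (-1 : ℝ) 1, y₂ (1 + t) = - y₂ (1 - t))
    (hy₁'0 : deriv y₁ 0 = 1) (hy₁1 : 0 < y₁ 1) (hy₂0 : 0 < y₂ 0)
    (hy₂'1 : deriv y₂ 1 = -1)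
    (l₁ l₂ : ℝ → ℝ)
    (hl₁ : ContDiffOn ℝ 2 l₁ (Set.Icc 0 1)) (hl₂ : ContDiffOn ℝ 2 l₂ (Set.Icc 0 1))
    (heq₁ : ∀ t ∈ Set.Ioo (0 : ℝ) 1,
      deriv (fun s => deriv l₁ s / (y₁ s / y₂ s)) t
        = l₁ t * (l₂ t) ^ 2 / (y₁ t * y₂ t))
    (heq₂ : ∀ t ∈ Set.Ioo (0 : ℝ) 1,
      deriv (fun s => deriv l₂ s / (y₂ s / y₁ s)) t
        = (l₁ t) ^ 2 * l₂ t / (y₁ t * y₂ t))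
    (hbc₁ : l₁ 0 = -1) (hbc₂ : derivWithin l₁ (Set.Icc 0 1) 0 = 0) (hbc₃ : l₂ 0 = 0)
    (hbc₄ : l₁ 1 = 0) (hbc₅ : l₂ 1 = 1) (hbc₆ : derivWithin l₂ (Set.Icc 0 1) 1 = 0) :
    ∀ t ∈ Set.Ioo (0 : ℝ) 1, l₁ t < 0 ∧ 0 < l₂ t := by
  have hI : ∀ t ∈ Icc (0 : ℝ) 1, t ∈ Ioo (-1 : ℝ) 2 := fun t ht =>
    ⟨by linarith [ht.1], by linarith [ht.2]⟩
  have hd₁ : ∀ t ∈ Icc (0 : ℝ) 1, DifferentiableAt ℝ y₁ t := fun t ht =>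
    (hy₁.contDiffAt (Ioo_mem_nhds (hI t ht).1 (hI t ht).2)).differentiableAt (by simp)
  have hd₂ : ∀ t ∈ Icc (0 : ℝ) 1, DifferentiableAt ℝ y₂ t := fun t ht =>
    (hy₂.contDiffAt (Ioo_mem_nhds (hI t ht).1 (hI t ht).2)).differentiableAt (by simp)
  have hφ₁ : ∀ t ∈ Ioo (0 : ℝ) 1, 0 < y₁ t / y₂ t := fun t ht =>
    div_pos (hy₁pos t ht) (hy₂pos t ht)
  have hφ₂ : ∀ t ∈ Ioo (0 : ℝ) 1, 0 < y₂ t / y₁ t := fun t ht =>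
    div_pos (hy₂pos t ht) (hy₁pos t ht)
  have hφd₁ : ∀ t ∈ Ioo (0 : ℝ) 1, DifferentiableAt ℝ (fun t => y₁ t / y₂ t) t := fun t ht =>
    (hd₁ t (Ioo_subset_Icc_self ht)).div (hd₂ t (Ioo_subset_Icc_self ht)) (hy₂pos t ht).ne'
  have hφd₂ : ∀ t ∈ Ioo (0 : ℝ) 1, DifferentiableAt ℝ (fun t => y₂ t / y₁ t) t := fun t ht =>
    (hd₂ t (Ioo_subset_Icc_self ht)).div (hd₁ t (Ioo_subset_Icc_self ht)) (hy₁pos t ht).ne'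
  have hs₁ := sol_deriv (fun t => y₁ t / y₂ t) l₁ hφ₁ hφd₁ hl₁
  have hs₂ := sol_deriv (fun t => y₂ t / y₁ t) l₂ hφ₂ hφd₂ hl₂
  have hσ : ∀ t ∈ Ioo (0 : ℝ) 1, 0 < y₁ t * y₂ t := fun t ht =>
    mul_pos (hy₁pos t ht) (hy₂pos t ht)
  have hσc : ContinuousOn (fun t => y₁ t * y₂ t) (Ioo 0 1) := fun t ht =>
    ((hd₁ t (Ioo_subset_Icc_self ht)).mul
      (hd₂ t (Ioo_subset_Icc_self ht))).continuousAt.continuousWithinAt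
  have hc₁ : ContinuousOn l₁ (Icc 0 1) := hl₁.continuousOn
  have hc₂ : ContinuousOn l₂ (Icc 0 1) := hl₂.continuousOn
  have hc₁' := hc₁.mono Ioo_subset_Icc_self
  have hc₂' := hc₂.mono Ioo_subset_Icc_self
  have m0 : (0 : ℝ) ∈ Icc (0 : ℝ) 1 := by simp
  have m1 : (1 : ℝ) ∈ Icc (0 : ℝ) 1 := by simp
  have lim₁ : Tendsto (fun t => l₁ t * (deriv l₁ t / (y₁ t / y₂ t))) (𝓝[<] 1) (𝓝 0) := by
    rw [← nhdsWithin_Ioo_eq_nhdsLT (one_pos : (0 : ℝ) < 1)]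
    have a : Tendsto l₁ (𝓝[Ioo 0 1] 1) (𝓝 (l₁ 1)) := (hc₁ 1 m1).mono Ioo_subset_Icc_self
    have b := deriv_tendsto l₁ hl₁ 1 m1
    have c : Tendsto y₁ (𝓝[Ioo 0 1] 1) (𝓝 (y₁ 1)) :=
      (hd₁ 1 m1).continuousAt.continuousWithinAt
    have d : Tendsto y₂ (𝓝[Ioo 0 1] 1) (𝓝 (y₂ 1)) :=
      (hd₂ 1 m1).continuousAt.continuousWithinAt
    have e := a.mul (b.mul (d.div c hy₁1.ne'))
    rw [hbc₄, zero_mul] at e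
    refine e.congr fun t => ?_
    rw [div_div_eq_mul_div]
    simp only [Pi.div_apply]
    ring
  have lim₂ : Tendsto (fun t => l₂ t * (deriv l₂ t / (y₂ t / y₁ t))) (𝓝[>] 0) (𝓝 0) := by
    rw [← nhdsWithin_Ioo_eq_nhdsGT (one_pos : (0 : ℝ) < 1)]
    have a : Tendsto l₂ (𝓝[Ioo 0 1] 0) (𝓝 (l₂ 0)) := (hc₂ 0 m0).mono Ioo_subset_Icc_self
    have b := deriv_tendsto l₂ hl₂ 0 m0
    have c : Tendsto y₁ (𝓝[Ioo 0 1] 0) (𝓝 (y₁ 0)) :=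
      (hd₁ 0 m0).continuousAt.continuousWithinAt
    have d : Tendsto y₂ (𝓝[Ioo 0 1] 0) (𝓝 (y₂ 0)) :=
      (hd₂ 0 m0).continuousAt.continuousWithinAt
    have e := a.mul (b.mul (c.div d hy₂0.ne'))
    rw [hbc₃, zero_mul] at e
    refine e.congr fun t => ?_
    rw [div_div_eq_mul_div]
    simp only [Pi.div_apply]
    ring
  have A : ∀ t ∈ Ioo (0 : ℝ) 1, l₁ t < 0 := by
    refine key_neg (fun t => y₁ t / y₂ t) (fun t => l₂ t ^ 2 / (y₁ t * y₂ t)) l₁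
      (fun t => deriv l₁ t / (y₁ t / y₂ t)) hφ₁ ?_ ?_ ?_ hc₁ ?_ ?_ lim₁ (by rw [hbc₁]; norm_num)
    · exact fun t ht => div_nonneg (sq_nonneg _) (hσ t ht).le
    · exact fun t ht => (hφd₁ t ht).continuousAt.continuousWithinAt
    · exact (hc₂'.pow 2).div hσc fun t ht => (hσ t ht).ne'
    · exact fun t ht => (hs₁ t ht).1
    · intro t ht
      have h := (hs₁ t ht).2.hasDerivAt
      rw [heq₁ t ht] at h
      exact h.congr_deriv (by ring)
  have hr : ∀ t ∈ Ioo (0 : ℝ) 1, 1 - t ∈ Ioo (0 : ℝ) 1 := fun t ht =>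
    ⟨by linarith [ht.2], by linarith [ht.1]⟩
  have hrd : ∀ t : ℝ, HasDerivAt (fun s : ℝ => 1 - s) (-1) t := fun t => by
    simpa using (hasDerivAt_id t).const_sub 1
  have hrc : Continuous (fun s : ℝ => 1 - s) := by fun_prop
  have B : ∀ t ∈ Ioo (0 : ℝ) 1, -l₂ (1 - t) < 0 := by
    refine key_neg (fun t => y₂ (1 - t) / y₁ (1 - t))
      (fun t => l₁ (1 - t) ^ 2 / (y₁ (1 - t) * y₂ (1 - t))) (fun t => -l₂ (1 - t))
      (fun t => deriv l₂ (1 - t) / (y₂ (1 - t) / y₁ (1 - t)))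
      (fun t ht => hφ₂ _ (hr t ht)) ?_ ?_ ?_ ?_ ?_ ?_ ?_ ?_
    · exact fun t ht => div_nonneg (sq_nonneg _) (hσ _ (hr t ht)).le
    · have h : ContinuousOn (fun t => y₂ t / y₁ t) (Ioo 0 1) :=
        fun t ht => (hφd₂ t ht).continuousAt.continuousWithinAt
      exact h.comp hrc.continuousOn hr
    · have h : ContinuousOn (fun t => l₁ t ^ 2 / (y₁ t * y₂ t)) (Ioo 0 1) :=
        (hc₁'.pow 2).div hσc fun t ht => (hσ t ht).ne'
      exact h.comp hrc.continuousOn hr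
    · refine (hc₂.comp hrc.continuousOn ?_).neg
      exact fun t ht => ⟨by linarith [ht.2], by linarith [ht.1]⟩
    · intro t ht
      have h := ((hs₂ _ (hr t ht)).1.comp t (hrd t)).neg
      exact h.congr_deriv (by ring)
    · intro t ht
      have h := (hs₂ _ (hr t ht)).2.hasDerivAt
      rw [heq₂ _ (hr t ht)] at h
      have h' := HasDerivAt.comp t h (hrd t)
      exact h'.congr_deriv (by ring)
    · have hm : Tendsto (fun s : ℝ => 1 - s) (𝓝[<] 1) (𝓝[>] 0) := by
        refine tendsto_nhdsWithin_iff.2 ⟨?_, ?_⟩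
        · have := (hrc.tendsto 1).mono_left (nhdsWithin_le_nhds (s := Iio 1))
          simpa using this
        · filter_upwards [self_mem_nhdsWithin] with s hs
          have : s < 1 := hs
          show 0 < 1 - s
          linarith
      have h := (lim₂.comp hm).neg
      rw [neg_zero] at h
      refine h.congr fun t => ?_
      simp only [Function.comp]
      ring
    · simp [hbc₅]
  intro t ht
  refine ⟨A t ht, ?_⟩
  have h := B (1 - t) (hr t ht)
  rw [sub_sub_cancel] at h
  linarith
end

section
/- Let T > 0 and let k ≥ 0 be an integer. Let S : [−1,−1+T] → ℝ be a continuous function such that the function t ↦ (1+t)·S(t) is C^k on [−1,−1+T]. Then there exists a unique C^{k+2} function s : [−1,−1+T] → ℝ satisfying s''(t) = 2·s(t)/(1+t)² + (1+t)·S(t) for all t ∈ (−1,−1+T], together with s(−1) = s'(−1) = s''(−1) = 0. Moreover, sup_{t∈(−1,−1+T]} |s(t)|/(1+t)² ≤ (T/4)·sup_{t∈(−1,−1+T]} |S(t)|. -/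
/-- A solution on `[-1,-1+T]` of the singular linear problem
`s'' = 2s/(1+t)² + (1+t)·S(t)` on `(-1,-1+T]` with `s(-1) = s'(-1) = s''(-1) = 0`
(one-sided derivatives at `-1`, taken within `[-1,-1+T]`). -/
def SolLinSO3 (T : ℝ) (S s : ℝ → ℝ) : Prop :=
  (∀ t ∈ Set.Ioc (-1 : ℝ) (-1 + T),
    derivWithin (derivWithin s (Set.Icc (-1) (-1 + T))) (Set.Icc (-1) (-1 + T)) t
      = 2 * s t / (1 + t) ^ 2 + (1 + t) * S t) ∧
  s (-1) = 0 ∧ derivWithin s (Set.Icc (-1) (-1 + T)) (-1) = 0 ∧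
  derivWithin (derivWithin s (Set.Icc (-1) (-1 + T))) (Set.Icc (-1) (-1 + T)) (-1) = 0

open Set MeasureTheory Filter Topology

theorem contDiff_succ_of_hasDerivAt {n : ℕ} {f g : ℝ → ℝ} (h : ∀ x, HasDerivAt f (g x) x)
    (hg : ContDiff ℝ n g) : ContDiff ℝ ((n + 1 : ℕ) : ℕ∞) f := by
  have h1 : deriv f = g := funext fun x => (h x).deriv
  have : ContDiff ℝ ((n : WithTop ℕ∞) + 1) f := by
    rw [contDiff_succ_iff_deriv]
    refine ⟨fun x => (h x).differentiableAt, fun h => ?_, by rwa [h1]⟩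
    simp at h
  exact_mod_cast this

theorem extend_contDiff {T : ℝ} (hT : 0 < T) (n : ℕ) : ∀ (f : ℝ → ℝ),
    ContDiffOn ℝ n f (Icc 0 T) → ∃ F : ℝ → ℝ, ContDiff ℝ n F ∧ EqOn F f (Icc 0 T) := by
  induction n with
  | zero =>
    intro f hf
    refine ⟨IccExtend hT.le ((Icc 0 T).domRestrict f), ?_, ?_⟩
    · rw [Nat.cast_zero, contDiff_zero]
      exact (continuousOn_iff_continuous_domRestrict.1 hf.continuousOn).Icc_extend'
    · intro x hx
      rw [IccExtend_of_mem _ _ hx]; rfl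
  | succ n ih =>
    intro f hf
    have hf' : ContDiffOn ℝ ((n : WithTop ℕ∞) + 1) f (Icc 0 T) := by exact_mod_cast hf
    rw [contDiffOn_succ_iff_derivWithin (uniqueDiffOn_Icc hT)] at hf'
    obtain ⟨hd, -, hc⟩ := hf'
    obtain ⟨G, hG, hGe⟩ := ih _ hc
    have hder : ∀ x, HasDerivAt (fun x => f 0 + ∫ y in (0:ℝ)..x, G y) (G x) x := fun x =>
      (hG.continuous.integral_hasStrictDerivAt 0 x).hasDerivAt.const_add _
    refine ⟨fun x => f 0 + ∫ y in (0:ℝ)..x, G y, ?_, ?_⟩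
    · exact_mod_cast contDiff_succ_of_hasDerivAt hder hG
    · intro x hx
      have hz := constant_of_derivWithin_zero (a := 0) (b := T)
        (f := fun x => (f 0 + ∫ y in (0:ℝ)..x, G y) - f x) ?_ ?_ x hx
      · simpa [sub_eq_zero] using hz
      · exact fun y hy => ((hder y).differentiableAt.differentiableWithinAt).sub (hd y hy)
      · intro y hy
        have hy' := Ico_subset_Icc_self hy
        have := ((hder y).hasDerivWithinAt (s := Icc 0 T)).sub (hd y hy').hasDerivWithinAt
        refine (this.derivWithin (uniqueDiffOn_Icc hT y hy')).trans ?_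
        rw [hGe hy', sub_self]

noncomputable def avgOp (a : ℕ) (f : ℝ → ℝ) (x : ℝ) : ℝ := ∫ θ in (0:ℝ)..1, θ ^ a * f (x * θ)

theorem avgOp_continuous (a : ℕ) {f : ℝ → ℝ} (hf : Continuous f) : Continuous (avgOp a f) := by
  unfold avgOp
  apply intervalIntegral.continuous_parametric_intervalIntegral_of_continuous'
  simp only [Function.uncurry_def]
  fun_prop

theorem avgOp_hasDerivAt (a : ℕ) {f g : ℝ → ℝ} (hf : ∀ x, HasDerivAt f (g x) x)
    (hg : Continuous g) (x : ℝ) : HasDerivAt (avgOp a f) (avgOp (a + 1) g x) x := by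
  have hfc : Continuous f := continuous_iff_continuousAt.2 fun x => (hf x).continuousAt
  obtain ⟨C, hC⟩ := (isCompact_Icc (a := -(|x| + 1)) (b := |x| + 1)).exists_bound_of_continuousOn
    hg.continuousOn
  unfold avgOp
  refine (intervalIntegral.hasDerivAt_integral_of_dominated_loc_of_deriv_le
    (F := fun x θ => θ ^ a * f (x * θ)) (F' := fun x θ => θ ^ (a + 1) * g (x * θ))
    (bound := fun _ => C) (s := Metric.ball x 1) (Metric.ball_mem_nhds x one_pos)
    ?_ ?_ ?_ ?_ ?_ ?_).2
  · refine Eventually.of_forall fun y => Continuous.aestronglyMeasurable ?_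
    fun_prop
  · apply Continuous.intervalIntegrable
    fun_prop
  · apply Continuous.aestronglyMeasurable
    fun_prop
  · refine Eventually.of_forall fun θ hθ y hy => ?_
    rw [uIoc_of_le zero_le_one] at hθ
    have hy1 : |y| ≤ |x| + 1 := by
      rw [Metric.mem_ball, Real.dist_eq] at hy
      have := abs_add_le (y - x) x
      simp only [sub_add_cancel] at this
      linarith
    have hm : y * θ ∈ Icc (-(|x| + 1)) (|x| + 1) := by
      rw [mem_Icc, ← abs_le, abs_mul, abs_of_pos hθ.1]
      nlinarith [abs_nonneg y, hθ.1, hθ.2]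
    have h1 := hC _ hm
    rw [norm_mul, norm_pow]
    have h2 : ‖θ‖ ^ (a + 1) ≤ 1 := by
      rw [Real.norm_eq_abs, abs_of_pos hθ.1]
      exact pow_le_one₀ hθ.1.le hθ.2
    calc _ ≤ 1 * ‖g (y * θ)‖ := by gcongr
      _ ≤ C := by simpa using h1
  · exact intervalIntegrable_const
  · refine Eventually.of_forall fun θ _ y _ => ?_
    have h1 : HasDerivAt (fun y : ℝ => y * θ) θ y := by simpa using (hasDerivAt_id y).mul_const θ
    have := ((hf (y * θ)).comp y h1).const_mul (θ ^ a)
    exact this.congr_deriv (by ring)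

theorem avgOp_contDiff (n : ℕ) : ∀ (a : ℕ) (f : ℝ → ℝ), ContDiff ℝ n f →
    ContDiff ℝ n (avgOp a f) := by
  induction n with
  | zero =>
    intro a f hf
    rw [Nat.cast_zero, contDiff_zero]
    exact avgOp_continuous a hf.continuous
  | succ n ih =>
    intro a f hf
    have hf' : ContDiff ℝ ((n : WithTop ℕ∞) + 1) f := by exact_mod_cast hf
    rw [contDiff_succ_iff_deriv] at hf'
    exact_mod_cast contDiff_succ_of_hasDerivAt
      (avgOp_hasDerivAt a (fun x => (hf'.1 x).hasDerivAt) hf'.2.2.continuous) (ih _ _ hf'.2.2)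

theorem avgOp_mul (a : ℕ) (f : ℝ → ℝ) (x : ℝ) :
    x ^ (a + 1) * avgOp a f x = ∫ y in (0:ℝ)..x, y ^ a * f y := by
  have := intervalIntegral.mul_integral_comp_mul_left (a := 0) (b := 1) (c := x)
    (f := fun y => y ^ a * f y)
  simp only [mul_zero, mul_one] at this
  rw [← this, avgOp, pow_succ', mul_assoc, ← intervalIntegral.integral_const_mul]
  congr 1
  apply intervalIntegral.integral_congr
  intro θ _
  simp only
  ring

/-- The regularized source. -/
theorem exists_source {T : ℝ} (hT : 0 < T) (k : ℕ) (S : ℝ → ℝ)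
    (hSc : ContinuousOn S (Icc 0 T))
    (hSk : ContDiffOn ℝ k (fun x => x * S x) (Icc 0 T)) :
    ∃ R : ℝ → ℝ, ContDiff ℝ (k - 1 : ℕ) R ∧ ContDiff ℝ k (fun x => x * R x) ∧
      EqOn R S (Ioc 0 T) := by
  cases k with
  | zero =>
    obtain ⟨R, hR, hRe⟩ := extend_contDiff hT 0 S (by simpa using hSc)
    refine ⟨R, hR, ?_, fun x hx => hRe (Ioc_subset_Icc_self hx)⟩
    exact contDiff_id.mul hR
  | succ j =>
    obtain ⟨F, hF, hFe⟩ := extend_contDiff hT (j + 1) _ hSk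
    have hF' : ContDiff ℝ ((j : WithTop ℕ∞) + 1) F := by exact_mod_cast hF
    rw [contDiff_succ_iff_deriv] at hF'
    have hF0 : F 0 = 0 := by simpa using hFe (left_mem_Icc.2 hT.le)
    have key : ∀ x, x * avgOp 0 (deriv F) x = F x := by
      intro x
      have h := avgOp_mul 0 (deriv F) x
      simp only [zero_add, pow_one, pow_zero, one_mul] at h
      rw [h, intervalIntegral.integral_deriv_eq_sub (fun y _ => hF'.1 y)
        (hF'.2.2.continuous.intervalIntegrable _ _), hF0, sub_zero]
    refine ⟨avgOp 0 (deriv F), avgOp_contDiff j _ _ hF'.2.2, ?_, fun x hx => ?_⟩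
    · simp_rw [key]; exact hF
    · have h1 := key x
      rw [hFe (Ioc_subset_Icc_self hx)] at h1
      exact mul_left_cancel₀ hx.1.ne' h1

theorem sq_mul_avg_hasDerivAt {R : ℝ → ℝ} (hR : Continuous R) (x : ℝ) :
    HasDerivAt (fun x => x ^ 2 * avgOp 3 R x) (x * R x - 2 * x * avgOp 3 R x) x := by
  have hc := avgOp_continuous 3 hR
  by_cases hx : x = 0
  · subst hx
    rw [hasDerivAt_iff_tendsto_slope]
    have : Tendsto (fun x => x * avgOp 3 R x) (𝓝[≠] 0) (𝓝 (0 * avgOp 3 R 0)) :=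
      ((continuous_id.mul hc).tendsto 0).mono_left nhdsWithin_le_nhds
    simp only [zero_mul, mul_zero, sub_zero] at this ⊢
    refine this.congr' ?_
    filter_upwards [self_mem_nhdsWithin] with y hy
    have hy : y ≠ 0 := hy
    simp [slope_def_field]
    field_simp
  · have h1 : HasDerivAt (fun x => ∫ y in (0:ℝ)..x, y ^ 3 * R y) (x ^ 3 * R x) x :=
      (Continuous.integral_hasStrictDerivAt (by fun_prop) 0 x).hasDerivAt
    have h2 := h1.div (hasDerivAt_pow 2 x) (pow_ne_zero 2 hx)
    have h3 := h2.congr_of_eventuallyEq (f₁ := fun x => x ^ 2 * avgOp 3 R x) ?_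
    · refine h3.congr_deriv ?_
      rw [← avgOp_mul]
      field_simp
      push_cast
      ring
    · filter_upwards [isOpen_ne.mem_nhds hx] with y hy
      have hy : y ≠ 0 := hy
      show _ = (∫ y in (0:ℝ)..y, y ^ 3 * R y) / y ^ 2
      rw [← avgOp_mul]
      field_simp
      try ring

theorem exists_global {T : ℝ} (hT : 0 < T) (k : ℕ) (S : ℝ → ℝ)
    (hSc : ContinuousOn S (Icc 0 T))
    (hSk : ContDiffOn ℝ k (fun x => x * S x) (Icc 0 T)) :
    ∃ s s1 s2 : ℝ → ℝ, (∀ x, HasDerivAt s (s1 x) x) ∧ (∀ x, HasDerivAt s1 (s2 x) x) ∧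
      ContDiff ℝ k s2 ∧ s 0 = 0 ∧ s1 0 = 0 ∧ s2 0 = 0 ∧
      (∀ x ∈ Ioc 0 T, s2 x = 2 * s x / x ^ 2 + x * S x) ∧
      (∀ M : ℝ, (∀ x ∈ Ioc 0 T, |S x| ≤ M) → ∀ x ∈ Ioc 0 T, |s x| / x ^ 2 ≤ T / 4 * M) := by
  obtain ⟨R, hR, hF, hRe⟩ := exists_source hT k S hSc hSk
  have hv := avgOp_continuous 3 hR.continuous
  set v := avgOp 3 R with hvdef
  set u : ℝ → ℝ := fun x => ∫ y in (0:ℝ)..x, v y with hu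
  have hud : ∀ x, HasDerivAt u (v x) x := fun x => (hv.integral_hasStrictDerivAt 0 x).hasDerivAt
  have hu0 : u 0 = 0 := by simp [hu]
  have huk : ContDiff ℝ k u := by
    cases k with
    | zero =>
      rw [Nat.cast_zero, contDiff_zero]
      exact continuous_iff_continuousAt.2 fun x => (hud x).continuousAt
    | succ j => exact_mod_cast contDiff_succ_of_hasDerivAt hud (avgOp_contDiff j _ _ hR)
  refine ⟨fun x => x ^ 2 * u x, fun x => 2 * x * u x + x ^ 2 * v x, fun x => 2 * u x + x * R x,
    ?_, ?_, ?_, ?_, ?_, ?_, ?_, ?_⟩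
  · intro x
    refine ((hasDerivAt_pow 2 x).mul (hud x)).congr_deriv ?_
    push_cast; ring
  · intro x
    have h1 : HasDerivAt (fun x : ℝ => 2 * x) 2 x := by
      simpa using (hasDerivAt_id x).const_mul 2
    refine ((h1.mul (hud x)).add (sq_mul_avg_hasDerivAt hR.continuous x)).congr_deriv ?_
    ring
  · exact (contDiff_const.mul huk).add hF
  · simp
  · simp
  · simp [hu0]
  · intro x hx
    have := hx.1.ne'
    simp only []
    rw [hRe hx]
    field_simp
  · intro M hM x hx
    have hM0 : 0 ≤ M := (abs_nonneg _).trans (hM x hx)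
    have hx2 : 0 < x ^ 2 := pow_pos hx.1 2
    rw [abs_mul, abs_of_pos hx2, mul_div_cancel_left₀ _ hx2.ne']
    have hvb : ∀ y ∈ uIoc 0 x, ‖v y‖ ≤ M / 4 := by
      intro y hy
      rw [uIoc_of_le hx.1.le] at hy
      have hb := intervalIntegral.norm_integral_le_of_norm_le (a := 0) (b := 1) (μ := volume)
        (f := fun θ => θ ^ 3 * R (y * θ)) (g := fun θ : ℝ => θ ^ 3 * M) zero_le_one
        (Eventually.of_forall fun θ hθ => ?_)
        (Continuous.intervalIntegrable (by fun_prop) _ _)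
      · have h2 : ∫ θ in (0:ℝ)..1, θ ^ 3 * M = M / 4 := by
          rw [intervalIntegral.integral_mul_const, integral_pow]; norm_num; ring
        rw [h2] at hb
        exact hb
      · have hm : y * θ ∈ Ioc 0 T :=
          ⟨mul_pos hy.1 hθ.1, by nlinarith [hy.1, hy.2, hθ.1, hθ.2, hx.2]⟩
        rw [norm_mul, Real.norm_eq_abs, Real.norm_eq_abs, abs_of_pos (pow_pos hθ.1 3), hRe hm]
        exact mul_le_mul_of_nonneg_left (hM _ hm) (pow_pos hθ.1 3).le
    have := intervalIntegral.norm_integral_le_of_norm_le_const hvb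
    rw [sub_zero, abs_of_pos hx.1, Real.norm_eq_abs] at this
    refine this.trans ?_
    nlinarith [hx.2]

theorem uniq_zero {T : ℝ} (hT : 0 < T) (w w1 w2 : ℝ → ℝ)
    (h1 : ∀ t ∈ Icc (-1) (-1 + T), HasDerivWithinAt w (w1 t) (Icc (-1) (-1 + T)) t)
    (h2 : ∀ t ∈ Icc (-1) (-1 + T), HasDerivWithinAt w1 (w2 t) (Icc (-1) (-1 + T)) t)
    (hw0 : w (-1) = 0) (hw2 : w2 (-1) = 0) (hw1 : w1 (-1) = 0)
    (hode : ∀ t ∈ Ioc (-1) (-1 + T), w2 t = 2 * w t / (1 + t) ^ 2) :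
    ∀ t ∈ Icc (-1) (-1 + T), w t = 0 := by
  have hlt : (-1 : ℝ) < -1 + T := by linarith
  have hU := uniqueDiffOn_Icc hlt
  have hode' : ∀ t ∈ Icc (-1) (-1 + T), (1 + t) ^ 2 * w2 t = 2 * w t := by
    intro t ht
    rcases eq_or_lt_of_le ht.1 with h | h
    · rw [← h, hw0]; norm_num
    · rw [hode t ⟨h, ht.2⟩]
      have : 1 + t ≠ 0 := by linarith
      field_simp
  have hlin : ∀ (s : Set ℝ) (t : ℝ), HasDerivWithinAt (fun t : ℝ => 1 + t) 1 s t := fun s t => by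
    simpa using (hasDerivWithinAt_id t s).const_add 1
  have hA : ∀ t ∈ Icc (-1) (-1 + T), HasDerivWithinAt
      (fun t => (1 + t) ^ 2 * w1 t - 2 * (1 + t) * w t) 0 (Icc (-1) (-1 + T)) t := by
    intro t ht
    have := (((hlin _ t).pow 2).mul (h2 t ht)).sub (((hlin _ t).const_mul 2).mul (h1 t ht))
    refine this.congr_deriv ?_
    have := hode' t ht
    simp only [Pi.pow_apply]
    push_cast
    linear_combination this
  have hB := constant_of_derivWithin_zero (fun t ht => (hA t ht).differentiableWithinAt)
    (fun t ht => (hA t (Ico_subset_Icc_self ht)).derivWithin (hU t (Ico_subset_Icc_self ht)))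
  have hB' : ∀ t ∈ Icc (-1) (-1 + T), (1 + t) * w1 t = 2 * w t := by
    intro t ht
    rcases eq_or_lt_of_le ht.1 with h | h
    · rw [← h, hw0]; norm_num
    · have := hB t ht
      rw [hw0, hw1] at this
      have hne : 1 + t ≠ 0 := by linarith
      apply mul_left_cancel₀ hne
      linear_combination this
  set c := w1 (-1 + T) / T with hc
  have hC : ∀ t ∈ Icc (-1) (-1 + T), w1 t = c * (1 + t) := by
    intro t ht
    rcases eq_or_lt_of_le ht.1 with h | h
    · rw [← h, hw1]; norm_num
    rcases eq_or_lt_of_le ht.2 with h' | h'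
    · rw [h', hc]; field_simp; ring
    have hsub : Icc t (-1 + T) ⊆ Icc (-1) (-1 + T) := Icc_subset_Icc_left ht.1
    have hD : ∀ r ∈ Icc t (-1 + T), HasDerivWithinAt
        (fun r => w1 r / (1 + r)) 0 (Icc t (-1 + T)) r := by
      intro r hr
      have hne : 1 + r ≠ 0 := by linarith [hr.1]
      have := ((h2 r (hsub hr)).mono hsub).div (hlin _ r) hne
      refine this.congr_deriv ?_
      have e1 := hode' r (hsub hr)
      have e2 := hB' r (hsub hr)
      have : w2 r * (1 + r) - w1 r * 1 = 0 := by
        apply mul_left_cancel₀ hne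
        linear_combination e1 - e2
      rw [this, zero_div]
    have hE := constant_of_derivWithin_zero (fun t ht => (hD t ht).differentiableWithinAt)
      (fun r hr => (hD r (Ico_subset_Icc_self hr)).derivWithin
        (uniqueDiffOn_Icc h' r (Ico_subset_Icc_self hr))) (-1 + T) (right_mem_Icc.2 h'.le)
    have hne : 1 + t ≠ 0 := by linarith
    have e : 1 + (-1 + T) = T := by ring
    simp only [e] at hE
    rw [hc, hE]
    field_simp
  have hm1 : (-1 : ℝ) ∈ Icc (-1) (-1 + T) := left_mem_Icc.2 hlt.le
  have hc0 : c = 0 := by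
    have e1 : HasDerivWithinAt w1 (c * 1) (Icc (-1) (-1 + T)) (-1) :=
      ((hlin _ (-1)).const_mul c).congr hC (hC _ hm1)
    have := (hU _ hm1).eq_deriv _ e1 (h2 _ hm1)
    rw [hw2] at this; simpa using this
  intro t ht
  have := hB' t ht
  rw [hC t ht, hc0] at this
  linarith

theorem stmt_10 (T : ℝ) (hT : 0 < T) (k : ℕ) (S : ℝ → ℝ)
    (hSc : ContinuousOn S (Set.Icc (-1) (-1 + T)))
    (hSk : ContDiffOn ℝ (k : ℕ∞) (fun t => (1 + t) * S t) (Set.Icc (-1) (-1 + T))) :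
    ∃ s : ℝ → ℝ,
      (ContDiffOn ℝ ((k + 2 : ℕ) : ℕ∞) s (Set.Icc (-1) (-1 + T)) ∧ SolLinSO3 T S s) ∧
      (∀ s' : ℝ → ℝ,
        ContDiffOn ℝ ((k + 2 : ℕ) : ℕ∞) s' (Set.Icc (-1) (-1 + T)) → SolLinSO3 T S s' →
        Set.EqOn s' s (Set.Icc (-1) (-1 + T))) ∧
      (∀ M : ℝ, (∀ t ∈ Set.Ioc (-1 : ℝ) (-1 + T), |S t| ≤ M) →
        ∀ t ∈ Set.Ioc (-1 : ℝ) (-1 + T), |s t| / (1 + t) ^ 2 ≤ T / 4 * M) := by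
  have hlt : (-1 : ℝ) < -1 + T := by linarith
  have hU := uniqueDiffOn_Icc hlt
  have hm1 : (-1 : ℝ) ∈ Icc (-1) (-1 + T) := left_mem_Icc.2 hlt.le
  have hmap : MapsTo (fun x : ℝ => x - 1) (Icc 0 T) (Icc (-1) (-1 + T)) := fun x hx =>
    ⟨by linarith [hx.1], by linarith [hx.2]⟩
  obtain ⟨σ, σ1, σ2, hd1, hd2, hk2, h0, h01, h02, hode, hbd⟩ :=
    exists_global hT k (fun x => S (x - 1))
    (hSc.comp (by fun_prop) hmap)
    (by
      have : ContDiffOn ℝ k (fun x : ℝ => x - 1) (Icc 0 T) := by fun_prop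
      have := ContDiffOn.comp (g := fun t => (1 + t) * S t) (by exact_mod_cast hSk) this hmap
      refine this.congr fun x _ => ?_
      simp)
  have hlin : ∀ t : ℝ, HasDerivAt (fun t : ℝ => 1 + t) 1 t := fun t => by
    simpa using (hasDerivAt_id t).const_add 1
  have hs1 : ∀ t, HasDerivAt (fun t => σ (1 + t)) (σ1 (1 + t)) t := fun t => by
    exact ((hd1 (1 + t)).comp t (hlin t)).congr_deriv (by simp)
  have hs2 : ∀ t, HasDerivAt (fun t => σ1 (1 + t)) (σ2 (1 + t)) t := fun t => by
    exact ((hd2 (1 + t)).comp t (hlin t)).congr_deriv (by simp)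
  have hI : ∀ t ∈ Ioc (-1) (-1 + T), 1 + t ∈ Ioc 0 T := fun t ht =>
    ⟨by linarith [ht.1], by linarith [ht.2]⟩
  have hD1 : ∀ t ∈ Icc (-1) (-1 + T),
      derivWithin (fun t => σ (1 + t)) (Icc (-1) (-1 + T)) t = σ1 (1 + t) := fun t ht =>
    (hs1 t).hasDerivWithinAt.derivWithin (hU t ht)
  have hD2 : ∀ t ∈ Icc (-1) (-1 + T),
      derivWithin (derivWithin (fun t => σ (1 + t)) (Icc (-1) (-1 + T))) (Icc (-1) (-1 + T)) t
        = σ2 (1 + t) := fun t ht => by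
    rw [derivWithin_congr hD1 (hD1 t ht)]
    exact (hs2 t).hasDerivWithinAt.derivWithin (hU t ht)
  have hodes : ∀ t ∈ Ioc (-1) (-1 + T),
      σ2 (1 + t) = 2 * σ (1 + t) / (1 + t) ^ 2 + (1 + t) * S t := by
    intro t ht
    rw [hode _ (hI t ht)]
    simp
  refine ⟨fun t => σ (1 + t), ⟨?_, ?_, ?_, ?_, ?_⟩, ?_, ?_⟩
  · have e1 : ContDiff ℝ k (fun t => σ2 (1 + t)) := hk2.comp (by fun_prop)
    have e2 := contDiff_succ_of_hasDerivAt hs2 e1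
    exact (contDiff_succ_of_hasDerivAt hs1 (by exact_mod_cast e2)).contDiffOn
  · intro t ht
    rw [hD2 t (Ioc_subset_Icc_self ht)]
    exact hodes t ht
  · simpa using h0
  · rw [hD1 _ hm1]; simpa using h01
  · rw [hD2 _ hm1]; simpa using h02
  · intro s' hs' hsol
    obtain ⟨q1, q2, q3, q4⟩ := hsol
    have r : ContDiffOn ℝ ((((k : WithTop ℕ∞) + 1)) + 1) s' (Icc (-1) (-1 + T)) := by
      have : ((k : WithTop ℕ∞) + 1) + 1 = ((k + 2 : ℕ) : ℕ∞) := by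
        push_cast; rw [add_assoc, one_add_one_eq_two]; rfl
      rw [this]; exact hs'
    rw [contDiffOn_succ_iff_derivWithin hU] at r
    obtain ⟨r1, -, r⟩ := r
    rw [contDiffOn_succ_iff_derivWithin hU] at r
    obtain ⟨r2, -, r⟩ := r
    intro t ht
    have := uniq_zero hT _ _ _
      (fun t ht => (r1 t ht).hasDerivWithinAt.sub (hs1 t).hasDerivWithinAt)
      (fun t ht => (r2 t ht).hasDerivWithinAt.sub (hs2 t).hasDerivWithinAt)
      (by simp [q2, h0]) (by simp [q4, h02]) (by simp [q3, h01])
      (fun t ht => by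
        simp only [Pi.sub_apply]
        rw [q1 t ht, hodes t ht]; ring) t ht
    exact sub_eq_zero.1 this
  · intro M hM t ht
    refine hbd M (fun x hx => hM _ ⟨by linarith [hx.1], by linarith [hx.2]⟩) _ (hI t ht)
end

section
/- Let ζ : [−1,1] → ℝ be a smooth function, positive on (−1,1], such that the function r ↦ 1/ζ(r) − 1/(1+r)² on (−1,1) extends to a smooth function on [−1,1). Then for every α ∈ ℝ there exist T > 0 and a unique C² function l : [−1,−1+T] → ℝ satisfying l''(t) = (l(t)³ − l(t))/ζ(t) for t ∈ (−1,−1+T], together with l(−1) = −1, l'(−1) = 0 and l''(−1) = α (one-sided derivatives at −1). Moreover, for each fixed t ∈ (−1,−1+T], the values l(t) and l'(t) depend continuously on α. -/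
/-- A `C²` solution on `[-1,-1+T]` of `l'' = (l³ - l)/ζ` on `(-1,-1+T]` with
`l(-1) = -1`, `l'(-1) = 0`, `l''(-1) = α` (one-sided derivatives at `-1`, taken
within `[-1,-1+T]`). -/
def SolCubic (ζ : ℝ → ℝ) (α T : ℝ) (l : ℝ → ℝ) : Prop :=
  ContDiffOn ℝ 2 l (Set.Icc (-1) (-1 + T)) ∧
  (∀ t ∈ Set.Ioc (-1 : ℝ) (-1 + T),
    derivWithin (derivWithin l (Set.Icc (-1) (-1 + T))) (Set.Icc (-1) (-1 + T)) t
      = (l t ^ 3 - l t) / ζ t) ∧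
  l (-1) = -1 ∧ derivWithin l (Set.Icc (-1) (-1 + T)) (-1) = 0 ∧
  derivWithin (derivWithin l (Set.Icc (-1) (-1 + T))) (Set.Icc (-1) (-1 + T)) (-1) = α

open Set Filter Topology

/-- Core estimate. -/
lemma core_est {u p γ : ℝ → ℝ} {b M : ℝ} 
    (hu : ContinuousOn u (Icc 0 b)) (hp : ContinuousOn p (Icc 0 b)) (hp0 : p 0 = 0)
    (hu' : ∀ s ∈ Ioo 0 b, HasDerivAt u (p s / s ^ 4) s)
    (hp' : ∀ s ∈ Ioo 0 b, HasDerivAt p (s ^ 4 * γ s) s)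
    (hM : ∀ s ∈ Ioo 0 b, |γ s| ≤ M) {s : ℝ} (hs : s ∈ Icc 0 b) :
    |p s| ≤ s ^ 5 * M ∧ |u s - u 0| ≤ s ^ 2 * M := by
  have key : ∀ x ∈ Icc 0 b, |p x| ≤ x ^ 5 * M := by
    intro x hx
    rcases eq_or_lt_of_le hx.1 with h | h
    · subst h; simp [hp0]
    obtain ⟨c, hc, hce⟩ := exists_hasDerivAt_eq_slope p (fun s => s ^ 4 * γ s) h
      (hp.mono (Icc_subset_Icc_right hx.2)) (fun y hy => hp' y ⟨hy.1, hy.2.trans_le hx.2⟩)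
    have e : p x = x * (c ^ 4 * γ c) := by
      rw [hce, hp0]; field_simp; ring
    have hc4 : c ^ 4 ≤ x ^ 4 := pow_le_pow_left₀ hc.1.le hc.2.le 4
    have hg := hM c ⟨hc.1, hc.2.trans_le hx.2⟩
    rw [e, abs_mul, abs_mul, abs_of_pos h, abs_of_nonneg (by positivity : (0:ℝ) ≤ c ^ 4)]
    calc x * (c ^ 4 * |γ c|) ≤ x * (x ^ 4 * M) := by gcongr
      _ = x ^ 5 * M := by ring
  refine ⟨key s hs, ?_⟩
  rcases eq_or_lt_of_le hs.1 with h | h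
  · subst h; simp
  obtain ⟨c, hc, hce⟩ := exists_hasDerivAt_eq_slope u (fun s => p s / s ^ 4) h
      (hu.mono (Icc_subset_Icc_right hs.2)) (fun y hy => hu' y ⟨hy.1, hy.2.trans_le hs.2⟩)
  have e : u s - u 0 = s * (p c / c ^ 4) := by
    rw [hce]; field_simp; ring
  have hg := hM c ⟨hc.1, hc.2.trans_le hs.2⟩
  have hM0 : 0 ≤ M := (abs_nonneg _).trans hg
  have hk := key c ⟨hc.1.le, hc.2.le.trans hs.2⟩
  have hc0 := hc.1
  have : |p c / c ^ 4| ≤ c * M := by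
    rw [abs_div, abs_of_pos (by positivity : (0:ℝ) < c ^ 4), div_le_iff₀ (by positivity)]
    linarith
  rw [e, abs_mul, abs_of_pos h]
  calc s * |p c / c ^ 4| ≤ s * (s * M) := by
        gcongr; exact this.trans (by have := hc.2.le; gcongr)
    _ = s ^ 2 * M := by ring

def gg (σ : ℝ → ℝ) (s u : ℝ) : ℝ :=
  σ s * (2 * u - 3 * s ^ 2 * u ^ 2 + s ^ 4 * u ^ 3) - 3 * u ^ 2 + s ^ 2 * u ^ 3

lemma gg_bounds (σ : ℝ → ℝ) (hσ : Continuous σ) (B : ℝ) :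
    ∃ L : ℝ, 0 < L ∧ ∀ s ∈ Icc (0:ℝ) 1, ∀ u ∈ Icc (-B) B, |gg σ s u| ≤ L ∧
      ∀ v ∈ Icc (-B) B, |gg σ s u - gg σ s v| ≤ L * |u - v| := by
  obtain ⟨C1, h1⟩ := (isCompact_Icc.prod isCompact_Icc :
      IsCompact (Icc (0:ℝ) 1 ×ˢ Icc (-B) B)).exists_bound_of_continuousOn
      (f := fun x => gg σ x.1 x.2) (by unfold gg; fun_prop)
  obtain ⟨C2, h2⟩ := (isCompact_Icc.prod (isCompact_Icc.prod isCompact_Icc) :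
      IsCompact (Icc (0:ℝ) 1 ×ˢ (Icc (-B) B ×ˢ Icc (-B) B))).exists_bound_of_continuousOn
      (f := fun x : ℝ × ℝ × ℝ => σ x.1 * (2 - 3 * x.1 ^ 2 * (x.2.1 + x.2.2)
        + x.1 ^ 4 * (x.2.1 ^ 2 + x.2.1 * x.2.2 + x.2.2 ^ 2)) - 3 * (x.2.1 + x.2.2)
        + x.1 ^ 2 * (x.2.1 ^ 2 + x.2.1 * x.2.2 + x.2.2 ^ 2)) (by fun_prop)
  refine ⟨|C1| + |C2| + 1, by positivity, fun s hs u hu => ⟨?_, fun v hv => ?_⟩⟩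
  · have := h1 (s, u) ⟨hs, hu⟩
    rw [Real.norm_eq_abs] at this
    linarith [le_abs_self C1, abs_nonneg C2]
  · have := h2 (s, u, v) ⟨hs, hu, hv⟩
    rw [Real.norm_eq_abs] at this
    simp only at this
    have e : gg σ s u - gg σ s v = (σ s * (2 - 3 * s ^ 2 * (u + v)
        + s ^ 4 * (u ^ 2 + u * v + v ^ 2)) - 3 * (u + v)
        + s ^ 2 * (u ^ 2 + u * v + v ^ 2)) * (u - v) := by unfold gg; ring
    rw [e, abs_mul]
    gcongr
    linarith [le_abs_self C2, abs_nonneg C1]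

structure USol (σ : ℝ → ℝ) (a b : ℝ) (u p : ℝ → ℝ) : Prop where
  hu : ContinuousOn u (Icc 0 b)
  hp : ContinuousOn p (Icc 0 b)
  hu0 : u 0 = a
  hp0 : p 0 = 0
  hu' : ∀ s ∈ Ioo 0 b, HasDerivAt u (p s / s ^ 4) s
  hp' : ∀ s ∈ Ioo 0 b, HasDerivAt p (s ^ 4 * gg σ s (u s)) s

lemma USol.apriori {σ : ℝ → ℝ} {a b B L : ℝ} {u p : ℝ → ℝ} (h : USol σ a b u p)
    (hb : b ≤ 1) (hL0 : 0 < L)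
    (hL : ∀ s ∈ Icc (0:ℝ) 1, ∀ u ∈ Icc (-B) B, |gg σ s u| ≤ L ∧
      ∀ v ∈ Icc (-B) B, |gg σ s u - gg σ s v| ≤ L * |u - v|)
    (hbL : b ^ 2 * L ≤ 1 / 2) (haB : |a| + 1 ≤ B) :
    ∀ s ∈ Icc 0 b, u s ∈ Icc (-B) B := by
  have aux : ∀ x, |x - a| ≤ 1 → x ∈ Icc (-B) B := by
    intro x hx
    rw [abs_le] at hx
    constructor <;> linarith [le_abs_self a, neg_abs_le a]
  suffices H : ∀ s ∈ Icc 0 b, |u s - a| < 1 from fun s hs => aux _ (H s hs).le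
  by_contra! hcon
  obtain ⟨s0, hs0, hs0'⟩ := hcon
  set E := Icc 0 b ∩ (fun s => |u s - a|) ⁻¹' Ici 1 with hE
  have hEc : IsCompact E := by
    refine isCompact_Icc.of_isClosed_subset ?_ inter_subset_left
    refine ContinuousOn.preimage_isClosed_of_isClosed ?_ isClosed_Icc isClosed_Ici
    exact (h.hu.sub continuousOn_const).abs
  obtain ⟨m, hm, hmin⟩ := hEc.exists_isLeast ⟨s0, hs0, hs0'⟩
  have hlt : ∀ s ∈ Ioo 0 m, |u s - a| ≤ 1 := by
    intro s hs
    by_contra! hc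
    have := hmin (show s ∈ E from ⟨⟨hs.1.le, hs.2.le.trans hm.1.2⟩, hc.le⟩)
    linarith [hs.2]
  have := (core_est (M := L) (γ := fun s => gg σ s (u s)) (b := m)
    (h.hu.mono (Icc_subset_Icc_right hm.1.2)) (h.hp.mono (Icc_subset_Icc_right hm.1.2)) h.hp0
    (fun s hs => h.hu' s ⟨hs.1, hs.2.trans_le hm.1.2⟩)
    (fun s hs => h.hp' s ⟨hs.1, hs.2.trans_le hm.1.2⟩)
    (fun s hs => (hL s ⟨hs.1.le, hs.2.le.trans (hm.1.2.trans hb)⟩ _ (aux _ (hlt s hs))).1)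
    (s := m) ⟨hm.1.1, le_rfl⟩).2
  rw [h.hu0] at this
  have h1 : 1 ≤ |u m - a| := hm.2
  have h2 : m ^ 2 * L ≤ b ^ 2 * L := by have := hm.1.1; have := hm.1.2; gcongr
  linarith

lemma USol.diff {σ : ℝ → ℝ} {a₁ a₂ b B L : ℝ} {u₁ p₁ u₂ p₂ : ℝ → ℝ} 
    (h₁ : USol σ a₁ b u₁ p₁) (h₂ : USol σ a₂ b u₂ p₂)
    (hb0 : 0 ≤ b) (hb : b ≤ 1) (hL0 : 0 < L)
    (hL : ∀ s ∈ Icc (0:ℝ) 1, ∀ u ∈ Icc (-B) B, |gg σ s u| ≤ L ∧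
      ∀ v ∈ Icc (-B) B, |gg σ s u - gg σ s v| ≤ L * |u - v|)
    (hbL : b ^ 2 * L ≤ 1 / 2) (haB₁ : |a₁| + 1 ≤ B) (haB₂ : |a₂| + 1 ≤ B) :
    ∀ s ∈ Icc 0 b, |u₁ s - u₂ s| ≤ 2 * |a₁ - a₂| ∧
      |p₁ s - p₂ s| ≤ s ^ 5 * (L * (2 * |a₁ - a₂|)) := by
  have hB₁ := h₁.apriori hb hL0 hL hbL haB₁
  have hB₂ := h₂.apriori hb hL0 hL hbL haB₂
  have est : ∀ D, (∀ s ∈ Icc 0 b, |u₁ s - u₂ s| ≤ D) → ∀ s ∈ Icc 0 b, 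
      |p₁ s - p₂ s| ≤ s ^ 5 * (L * D) ∧ |(u₁ s - u₂ s) - (u₁ 0 - u₂ 0)| ≤ s ^ 2 * (L * D) := by
    intro D hD s hs
    refine core_est (u := fun s => u₁ s - u₂ s) (p := fun s => p₁ s - p₂ s)
      (γ := fun s => gg σ s (u₁ s) - gg σ s (u₂ s)) (h₁.hu.sub h₂.hu) (h₁.hp.sub h₂.hp)
      (by simp [h₁.hp0, h₂.hp0]) ?_ ?_ ?_ hs
    · intro x hx
      rw [sub_div]
      exact (h₁.hu' x hx).sub (h₂.hu' x hx)
    · intro x hx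
      rw [mul_sub]
      exact (h₁.hp' x hx).sub (h₂.hp' x hx)
    · intro x hx
      have hx' := Ioo_subset_Icc_self hx
      refine ((hL x ⟨hx'.1, hx'.2.trans hb⟩ _ (hB₁ x hx')).2 _ (hB₂ x hx')).trans ?_
      gcongr
      exact hD x hx'
  obtain ⟨m, hm, hmax⟩ := isCompact_Icc.exists_isMaxOn (nonempty_Icc.2 hb0)
    ((h₁.hu.sub h₂.hu).abs)
  have hD : ∀ s ∈ Icc 0 b, |u₁ s - u₂ s| ≤ |u₁ m - u₂ m| := fun s hs => hmax hs
  have hfin : |u₁ m - u₂ m| ≤ 2 * |a₁ - a₂| := by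
    have := (est _ hD m hm).2
    rw [h₁.hu0, h₂.hu0] at this
    have h3 := abs_sub_abs_le_abs_sub (u₁ m - u₂ m) (a₁ - a₂)
    have h4 : m ^ 2 * (L * |u₁ m - u₂ m|) ≤ 1 / 2 * |u₁ m - u₂ m| := by
      calc m ^ 2 * (L * |u₁ m - u₂ m|) ≤ b ^ 2 * (L * |u₁ m - u₂ m|) := by
            have := hm.1; have := hm.2; gcongr
        _ = b ^ 2 * L * |u₁ m - u₂ m| := by ring
        _ ≤ _ := by gcongr
    linarith
  intro s hs
  exact ⟨(hD s hs).trans hfin, (est _ (fun s hs => (hD s hs).trans hfin) s hs).1⟩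

noncomputable def JJ (γ : ℝ → ℝ) (s : ℝ) : ℝ := s * ∫ θ in (0:ℝ)..1, θ ^ 4 * γ (s * θ)

lemma JJ_cont {γ : ℝ → ℝ} (h : Continuous γ) : Continuous (JJ γ) := by
  unfold JJ
  refine continuous_id.mul ?_
  exact intervalIntegral.continuous_parametric_intervalIntegral_of_continuous' (by fun_prop) 0 1

lemma JJ_eq (γ : ℝ → ℝ) (s : ℝ) : s ^ 4 * JJ γ s = ∫ τ in (0:ℝ)..s, τ ^ 4 * γ τ := by
  have := intervalIntegral.mul_integral_comp_mul_left (a := 0) (b := 1) 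
    (f := fun τ => τ ^ 4 * γ τ) (c := s)
  rw [mul_zero, mul_one] at this
  rw [← this, JJ]
  have : ∀ θ, (s * θ) ^ 4 * γ (s * θ) = s ^ 4 * (θ ^ 4 * γ (s * θ)) := by intro θ; ring
  simp_rw [this]
  rw [intervalIntegral.integral_const_mul]
  ring

lemma JJ_deriv {γ : ℝ → ℝ} (h : Continuous γ) (s : ℝ) :
    HasDerivAt (fun s => s ^ 4 * JJ γ s) (s ^ 4 * γ s) s := by
  simp_rw [JJ_eq]
  exact intervalIntegral.integral_hasDerivAt_right
    (Continuous.intervalIntegrable (by fun_prop) _ _)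
    (Continuous.stronglyMeasurableAtFilter (by fun_prop) _ _) (by fun_prop)

noncomputable def VV (a : ℝ) (γ : ℝ → ℝ) (s : ℝ) : ℝ := a + ∫ τ in (0:ℝ)..s, JJ γ τ

lemma VV_deriv (a : ℝ) {γ : ℝ → ℝ} (h : Continuous γ) (s : ℝ) :
    HasDerivAt (VV a γ) (JJ γ s) s := by
  have hJ := JJ_cont h
  unfold VV
  exact (intervalIntegral.integral_hasDerivAt_right
    (Continuous.intervalIntegrable (by fun_prop) _ _)
    (Continuous.stronglyMeasurableAtFilter (by fun_prop) _ _) (by fun_prop)).const_add a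

lemma VV_cont (a : ℝ) {γ : ℝ → ℝ} (h : Continuous γ) : Continuous (VV a γ) :=
  continuous_iff_continuousAt.2 fun s => (VV_deriv a h s).continuousAt

lemma VV_est (a : ℝ) {γ₁ γ₂ : ℝ → ℝ} (h₁ : Continuous γ₁) (h₂ : Continuous γ₂) {M b s: ℝ}
    (hM : ∀ s ∈ Ioo 0 b, |γ₁ s - γ₂ s| ≤ M) (hs : s ∈ Icc 0 b) :
    |VV a γ₁ s - VV a γ₂ s| ≤ s ^ 2 * M := by
  have J1 := JJ_cont h₁
  have J2 := JJ_cont h₂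
  have := (core_est (u := fun s => VV a γ₁ s - VV a γ₂ s)
    (p := fun s => s ^ 4 * JJ γ₁ s - s ^ 4 * JJ γ₂ s) (γ := fun s => γ₁ s - γ₂ s)
    ((VV_cont a h₁).sub (VV_cont a h₂)).continuousOn (by fun_prop) (by simp)
    (fun x hx => by
      have hx0 : x ≠ 0 := hx.1.ne'
      have := (VV_deriv a h₁ x).sub (VV_deriv a h₂ x)
      refine this.congr_deriv ?_
      rw [← mul_sub, mul_div_cancel_left₀ _ (pow_ne_zero 4 hx0)])
    (fun x hx => by
      rw [mul_sub]
      exact (JJ_deriv h₁ x).sub (JJ_deriv h₂ x)) hM hs).2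
  simpa [VV] using this

lemma exists_fixed (σ : ℝ → ℝ) (hσ : Continuous σ) {a T B L : ℝ} (hT : 0 < T) (hT1 : T ≤ 1) (hL0 : 0 < L)
    (hL : ∀ s ∈ Icc (0:ℝ) 1, ∀ u ∈ Icc (-B) B, |gg σ s u| ≤ L ∧
      ∀ v ∈ Icc (-B) B, |gg σ s u - gg σ s v| ≤ L * |u - v|)
    (hTL : T ^ 2 * L ≤ 1 / 2) (haB : |a| + 1 ≤ B) :
    ∃ γ : ℝ → ℝ, Continuous γ ∧ ∀ s ∈ Icc 0 T, γ s = gg σ s (VV a γ s) := by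
  have hB : -B ≤ B := by linarith [abs_nonneg a]
  have h01 : (0:ℝ) ≤ 1 := zero_le_one
  let pB : ℝ → ℝ := fun x => (projIcc (-B) B hB x : ℝ)
  let p1 : ℝ → ℝ := fun x => (projIcc (0:ℝ) 1 h01 x : ℝ)
  have hpB : Continuous pB := continuous_subtype_val.comp continuous_projIcc
  have hp1 : Continuous p1 := continuous_subtype_val.comp continuous_projIcc
  have hpBm : ∀ x, pB x ∈ Icc (-B) B := fun x => (projIcc (-B) B hB x).2
  have hp1m : ∀ x, p1 x ∈ Icc (0:ℝ) 1 := fun x => (projIcc (0:ℝ) 1 h01 x).2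
  have hpBl : ∀ x y, |pB x - pB y| ≤ |x - y| := fun x y => abs_projIcc_sub_projIcc hB
  let Γ : C(Icc 0 T, ℝ) → ℝ → ℝ := fun f s => gg σ (p1 s) (pB (IccExtend hT.le f s))
  have hΓ : ∀ f, Continuous (Γ f) := by
    intro f
    have hf : Continuous (IccExtend hT.le f) := f.continuous.Icc_extend'
    simp only [Γ, gg]
    fun_prop
  let Φ : C(Icc 0 T, ℝ) → C(Icc 0 T, ℝ) := fun f =>
    ⟨fun s => VV a (Γ f) s, (VV_cont a (hΓ f)).comp continuous_subtype_val⟩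
  have hΦ : ContractingWith (1/2) Φ := by
    refine ⟨by norm_num, LipschitzWith.of_dist_le_mul fun f g => ?_⟩
    rw [ContinuousMap.dist_le (by positivity)]
    intro s
    have := VV_est a (hΓ f) (hΓ g) (M := L * dist f g) (b := T) (s := s) (fun x hx => by
      refine ((hL _ (hp1m x) _ (hpBm _)).2 _ (hpBm _)).trans ?_
      gcongr
      refine (hpBl _ _).trans ?_
      rw [← Real.dist_eq]
      exact ContinuousMap.dist_apply_le_dist _) s.2
    rw [Real.dist_eq]
    refine this.trans ?_
    have hs := s.2
    calc (s:ℝ) ^ 2 * (L * dist f g) ≤ T ^ 2 * (L * dist f g) := by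
          have := hs.1; have := hs.2; gcongr
      _ = T ^ 2 * L * dist f g := by ring
      _ ≤ 1 / 2 * dist f g := by gcongr
      _ = _ := by norm_num
  have : Nonempty C(Icc 0 T, ℝ) := ⟨0⟩
  obtain ⟨f, hf⟩ : ∃ f, Φ f = f := ⟨_, hΦ.fixedPoint_isFixedPt⟩
  refine ⟨Γ f, hΓ f, fun s hs => ?_⟩
  have e1 : IccExtend hT.le f s = VV a (Γ f) s := by
    rw [IccExtend_of_mem _ _ hs]
    conv_lhs => rw [← hf]
    rfl
  have e2 : p1 s = s := by
    have : s ∈ Icc (0:ℝ) 1 := ⟨hs.1, hs.2.trans hT1⟩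
    simp only [p1]; rw [projIcc_of_mem _ this]
  have e3 : VV a (Γ f) s ∈ Icc (-B) B := by
    have h0 : JJ (fun _ => 0) = fun _ => 0 := by funext s; simp [JJ]
    have := VV_est a (hΓ f) (continuous_const (y := (0:ℝ))) (M := L) (b := T) (s := s) (fun x hx => by
      rw [sub_zero]
      exact (hL _ (hp1m x) _ (hpBm _)).1) hs
    have h1 : VV a (fun _ => 0) s = a := by simp [VV, h0]
    rw [h1] at this
    have h2 : s ^ 2 * L ≤ T ^ 2 * L := by have := hs.1; have := hs.2; gcongr
    have h3 := abs_le.1 (this.trans (h2.trans hTL))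
    constructor <;> linarith [le_abs_self a, neg_abs_le a]
  have e4 : pB (VV a (Γ f) s) = VV a (Γ f) s := by
    simp only [pB]; rw [projIcc_of_mem _ e3]
  change gg σ (p1 s) (pB (IccExtend hT.le f s)) = _
  rw [e1, e2, e4]

/-- The function `w = s² u` is `C²`. -/
lemma w_derivs (a : ℝ) {γ : ℝ → ℝ} (h : Continuous γ) (s : ℝ) :
    HasDerivAt (fun s => s ^ 2 * VV a γ s) (2 * s * VV a γ s + s ^ 2 * JJ γ s) s ∧
    HasDerivAt (fun s => 2 * s * VV a γ s + s ^ 2 * JJ γ s) (2 * VV a γ s + s ^ 2 * γ s) s := by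
  have hV := VV_cont a h
  have hJ := JJ_cont h
  constructor
  · have := (hasDerivAt_pow 2 s).mul (VV_deriv a h s)
    exact this.congr_deriv (by norm_num)
  · have key : ∀ y, y ≠ 0 → HasDerivAt (fun s => 2 * s * VV a γ s + s ^ 2 * JJ γ s)
        (2 * VV a γ y + y ^ 2 * γ y) y := by
      intro y hy
      have h1 := ((hasDerivAt_id y).const_mul 2).mul (VV_deriv a h y)
      have h2 := (JJ_deriv h y).div (hasDerivAt_pow 2 y) (pow_ne_zero 2 hy)
      have h3 := h1.add h2
      refine (h3.congr_of_eventuallyEq ?_).congr_deriv ?_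
      · filter_upwards [isOpen_ne.mem_nhds hy] with x hx
        have hx : x ≠ 0 := hx
        simp
        field_simp
      · simp
        field_simp
        ring
    by_cases hs : s = 0
    · subst hs
      exact hasDerivAt_of_hasDerivAt_of_ne (g := fun s => 2 * VV a γ s + s ^ 2 * γ s) key
        (by fun_prop) (by fun_prop)
    · exact key s hs

lemma sol_to_usol {ζ σ : ℝ → ℝ} {α T b : ℝ} {l : ℝ → ℝ} (h : SolCubic ζ α T l)
    (hb0 : 0 < b) (hbT : b ≤ T)
    (hσ : ∀ s ∈ Ioo (0:ℝ) b, 1 / ζ (-1 + s) = 1 / s ^ 2 + σ s) :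
    USol σ (α / 2) b (fun s => if s = 0 then α / 2 else (l (-1 + s) + 1) / s ^ 2)
      (fun s => s ^ 2 * derivWithin l (Icc (-1) (-1 + T)) (-1 + s) - 2 * s * (l (-1 + s) + 1)) := by
  obtain ⟨hC, hode, hl0, hv0, ha0⟩ := h
  set I := Icc (-1) (-1 + T) with hI
  set v := derivWithin l I with hv
  have hIu : UniqueDiffOn ℝ I := uniqueDiffOn_Icc (by linarith)
  have hlc : ContinuousOn l I := hC.continuousOn
  have hvC : ContDiffOn ℝ 1 v I := hC.derivWithin hIu (by norm_num)
  have hvc : ContinuousOn v I := hvC.continuousOn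
  have hmem : ∀ s ∈ Ioo 0 b, I ∈ 𝓝 (-1 + s) := fun s hs =>
    Icc_mem_nhds (by linarith [hs.1]) (by linarith [hs.2])
  have hld : ∀ s ∈ Ioo 0 b, HasDerivAt (fun s => l (-1 + s) + 1) (v (-1 + s)) s := by
    intro s hs
    have h1 := ((hC.differentiableOn (by norm_num)) _ (mem_of_mem_nhds (hmem s hs))).hasDerivWithinAt
    exact ((h1.hasDerivAt (hmem s hs)).comp_const_add (-1) s).add_const 1
  have hvd : ∀ s ∈ Ioo 0 b, HasDerivAt (fun s => v (-1 + s))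
      ((l (-1 + s) ^ 3 - l (-1 + s)) / ζ (-1 + s)) s := by
    intro s hs
    have h1 := ((hvC.differentiableOn (by norm_num)) _ (mem_of_mem_nhds (hmem s hs))).hasDerivWithinAt
    rw [hode _ ⟨by linarith [hs.1], by linarith [hs.2]⟩] at h1
    exact (h1.hasDerivAt (hmem s hs)).comp_const_add (-1) s
  have hmaps : MapsTo (fun s : ℝ => -1 + s) (Icc 0 b) I := fun s hs =>
    ⟨by linarith [hs.1], by linarith [hs.2]⟩
  have hshift : ContinuousOn (fun s : ℝ => -1 + s) (Icc 0 b) := by fun_prop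
  have hlc' : ContinuousOn (fun s => l (-1 + s)) (Icc 0 b) := hlc.comp hshift hmaps
  have hvc' : ContinuousOn (fun s => v (-1 + s)) (Icc 0 b) := hvc.comp hshift hmaps
  have hv0d : HasDerivWithinAt (fun s => v (-1 + s)) α (Ici 0) 0 := by
    have hm1 : (-1:ℝ) ∈ I := ⟨le_rfl, by linarith⟩
    have h1 := ((hvC.differentiableOn (by norm_num)) _ hm1).hasDerivWithinAt
    rw [ha0] at h1
    have h1' : HasDerivWithinAt v α I (-1 + 0) := by simpa using h1
    have h2 : HasDerivWithinAt (fun s : ℝ => -1 + s) 1 (Icc 0 b) 0 :=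
      ((hasDerivAt_id (0:ℝ)).const_add (-1)).hasDerivWithinAt
    have h3 := HasDerivWithinAt.comp (h₂ := v) (0:ℝ) h1' h2 hmaps
    rw [mul_one] at h3
    exact h3.mono_of_mem_nhdsWithin (Icc_mem_nhdsGE hb0)
  have hlim : Tendsto (fun s => (l (-1 + s) + 1) / s ^ 2) (𝓝[>] 0) (𝓝 (α / 2)) := by
    refine HasDerivAt.lhopital_zero_nhdsGT (f' := fun s => v (-1 + s)) (g' := fun s => 2 * s)
      ?_ ?_ ?_ ?_ ?_ ?_
    · filter_upwards [Ioo_mem_nhdsGT hb0] with s hs using hld s hs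
    · filter_upwards with s
      simpa using hasDerivAt_pow 2 s
    · filter_upwards [self_mem_nhdsWithin] with s hs
      have : (0:ℝ) < s := hs
      positivity
    · have h1 := (hlc' 0 ⟨le_rfl, hb0.le⟩).mono_of_mem_nhdsWithin 
        (s := Ioi 0) (mem_of_superset (Ioo_mem_nhdsGT hb0) Ioo_subset_Icc_self)
      have h2 := h1.add_const 1
      simpa [ContinuousWithinAt, hl0] using h2.tendsto
    · have : Continuous (fun s : ℝ => s ^ 2) := by fun_prop
      simpa using (this.tendsto 0).mono_left nhdsWithin_le_nhds
    · have h1 := (hasDerivWithinAt_iff_tendsto_slope.1 hv0d)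
      rw [Ici_sdiff_left] at h1
      refine (h1.div_const 2).congr fun s => ?_
      simp [slope_def_field, hv0]
      rw [div_div, mul_comm]
  refine ⟨?_, ?_, by simp, by simp, ?_, ?_⟩
  · intro s hs
    rcases eq_or_lt_of_le hs.1 with h0 | h0
    · subst h0
      have : ContinuousWithinAt (fun s => if s = 0 then α / 2 else (l (-1 + s) + 1) / s ^ 2)
          (Ioi 0) 0 := by
        simp only [ContinuousWithinAt, if_true]
        refine hlim.congr' ?_
        filter_upwards [self_mem_nhdsWithin] with s hs
        have : s ≠ 0 := ne_of_gt hs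
        simp [this]
      exact (continuousWithinAt_Ioi_iff_Ici.1 this).mono Icc_subset_Ici_self
    · have h1 : ContinuousWithinAt (fun s => (l (-1 + s) + 1) / s ^ 2) (Icc 0 b) s :=
        ((hlc' s hs).add_const 1).div (by fun_prop) (by positivity)
      refine h1.congr_of_eventuallyEq ?_ (by simp [h0.ne'])
      filter_upwards [mem_nhdsWithin_of_mem_nhds (isOpen_ne.mem_nhds h0.ne')] with x hx
      have : x ≠ 0 := hx
      simp [this]
  · fun_prop
  · intro s hs
    have hs0 : s ≠ 0 := hs.1.ne'
    have h1 := (hld s hs).div (hasDerivAt_pow 2 s) (pow_ne_zero 2 hs0)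
    refine (h1.congr_of_eventuallyEq ?_).congr_deriv ?_
    · filter_upwards [isOpen_ne.mem_nhds hs0] with x hx
      have : x ≠ 0 := hx
      simp [this]
    · field_simp
      norm_num
      ring
  · intro s hs
    have hs0 : s ≠ 0 := hs.1.ne'
    have h1 := ((hasDerivAt_pow 2 s).mul (hvd s hs)).sub
      (((hasDerivAt_id s).const_mul 2).mul (hld s hs))
    refine h1.congr_deriv ?_
    rw [div_eq_mul_one_div _ (ζ _), hσ s hs]
    simp only [hs0, if_false, gg]
    generalize l (-1 + s) = y
    simp only [id]
    field_simp
    norm_num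
    ring

/-- short-time existence, uniqueness and continuous dependence for
the `SO(3)` equation near the singular orbit.  `ζ` is smooth on `[-1,1]`, positive
on `(-1,1]`, and `1/ζ - 1/(1+r)²` extends smoothly to `[-1,1)`. -/
theorem stmt_11 (ζ : ℝ → ℝ)
    (hζ : ContDiffOn ℝ (⊤ : ℕ∞) ζ (Set.Icc (-1) 1))
    (hζpos : ∀ r ∈ Set.Ioc (-1 : ℝ) 1, 0 < ζ r)
    (hζext : ∃ S : ℝ → ℝ, ContDiffOn ℝ (⊤ : ℕ∞) S (Set.Ico (-1) 1) ∧
      ∀ r ∈ Set.Ioo (-1 : ℝ) 1, 1 / ζ r - 1 / (1 + r) ^ 2 = S r)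
    (α : ℝ) :
    ∃ T : ℝ, 0 < T ∧ T ≤ 2 ∧
      ∃ l : ℝ → ℝ, SolCubic ζ α T l ∧
        (∀ l' : ℝ → ℝ, SolCubic ζ α T l' → Set.EqOn l' l (Set.Icc (-1) (-1 + T))) ∧
        (∀ t ∈ Set.Ioc (-1 : ℝ) (-1 + T), ∀ ε > (0 : ℝ), ∃ δ > (0 : ℝ),
          ∀ α' T' : ℝ, ∀ l' : ℝ → ℝ,
            |α' - α| < δ → 0 < T' → T' ≤ 2 → t ≤ -1 + T' →
            SolCubic ζ α' T' l' →
            |l' t - l t| < ε ∧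
            |derivWithin l' (Set.Icc (-1) (-1 + T')) t
              - derivWithin l (Set.Icc (-1) (-1 + T)) t| < ε) := by
  obtain ⟨S, hS, hSe⟩ := hζext
  let σ : ℝ → ℝ := fun s => S (-1 + (projIcc (0:ℝ) 1 zero_le_one s : ℝ))
  have hσ : Continuous σ := by
    refine hS.continuousOn.comp_continuous
      (continuous_const.add (continuous_subtype_val.comp continuous_projIcc)) fun s => ?_
    have := (projIcc (0:ℝ) 1 zero_le_one s).2
    exact ⟨by linarith [this.1], by linarith [this.2]⟩
  have hσe' : ∀ s ∈ Ioc (0:ℝ) 1, 1 / ζ (-1 + s) = 1 / s ^ 2 + σ s := by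
    intro s hs
    have h1 := hSe (-1 + s) ⟨by linarith [hs.1], by linarith [hs.2]⟩
    have h2 : σ s = S (-1 + s) := by
      simp only [σ]; rw [projIcc_of_mem _ ⟨hs.1.le, hs.2⟩]
    rw [h2, ← h1, show 1 + (-1 + s) = s by ring]
    ring
  obtain ⟨L, hL0, hL⟩ := gg_bounds σ hσ (|α| / 2 + 2)
  obtain ⟨T, hT0, hT1, hTL⟩ : ∃ T : ℝ, 0 < T ∧ T ≤ 1 ∧ T ^ 2 * L ≤ 1 / 2 := by
    refine ⟨min 1 (1 / (2 * L)), by positivity, min_le_left _ _, ?_⟩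
    set T := min 1 (1 / (2 * L)) with hT
    have h0 : 0 < T := by positivity
    have h1 : T ≤ 1 := min_le_left _ _
    have h2 : T ≤ 1 / (2 * L) := min_le_right _ _
    calc T ^ 2 * L ≤ T * L := by gcongr; nlinarith
      _ ≤ 1 / (2 * L) * L := by gcongr
      _ = 1 / 2 := by field_simp
  have habs : |α / 2| = |α| / 2 := by rw [abs_div]; norm_num
  obtain ⟨γ, hγ, hγe⟩ := exists_fixed σ hσ (a := α / 2) hT0 hT1 hL0 hL hTL (by linarith)
  have hV := VV_cont (α / 2) hγ
  have hJ := JJ_cont hγ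
  let l : ℝ → ℝ := fun t => -1 + (fun s => s ^ 2 * VV (α / 2) γ s) (1 + t)
  let v : ℝ → ℝ := fun t => (fun s => 2 * s * VV (α / 2) γ s + s ^ 2 * JJ γ s) (1 + t)
  let A : ℝ → ℝ := fun t => (fun s => 2 * VV (α / 2) γ s + s ^ 2 * γ s) (1 + t)
  have hl : ∀ t, HasDerivAt l (v t) t := fun t =>
    ((w_derivs (α / 2) hγ (1 + t)).1.comp_const_add 1 t).const_add (-1)
  have hv : ∀ t, HasDerivAt v (A t) t := fun t =>
    (w_derivs (α / 2) hγ (1 + t)).2.comp_const_add 1 t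
  have hA : Continuous A := by simp only [A]; fun_prop
  have hdl : deriv l = v := funext fun t => (hl t).deriv
  have hdv : deriv v = A := funext fun t => (hv t).deriv
  have hl2 : ContDiff ℝ 2 l := by
    rw [show (2 : WithTop ℕ∞) = 1 + 1 by norm_num, contDiff_succ_iff_deriv]
    refine ⟨fun t => (hl t).differentiableAt, by simp, ?_⟩
    rw [hdl, contDiff_one_iff_deriv, hdv]
    exact ⟨fun t => (hv t).differentiableAt, hA⟩
  have hIu : UniqueDiffOn ℝ (Icc (-1) (-1 + T)) := uniqueDiffOn_Icc (by linarith)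
  have hdw : ∀ t ∈ Icc (-1) (-1 + T), derivWithin l (Icc (-1) (-1 + T)) t = v t := fun t ht =>
    (hl t).hasDerivWithinAt.derivWithin (hIu t ht)
  have hdw2 : ∀ t ∈ Icc (-1) (-1 + T),
      derivWithin (derivWithin l (Icc (-1) (-1 + T))) (Icc (-1) (-1 + T)) t = A t := fun t ht => by
    rw [derivWithin_congr hdw (hdw t ht)]
    exact (hv t).hasDerivWithinAt.derivWithin (hIu t ht)
  have hm1 : (-1 : ℝ) ∈ Icc (-1) (-1 + T) := ⟨le_rfl, by linarith⟩
  have hsol : SolCubic ζ α T l := by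
    refine ⟨hl2.contDiffOn, ?_, by simp [l], ?_, ?_⟩
    · intro t ht
      rw [hdw2 t ⟨ht.1.le, ht.2⟩]
      have hs0 : 1 + t ≠ 0 := by linarith [ht.1]
      have h1 := hσe' (1 + t) ⟨by linarith [ht.1], by linarith [ht.2]⟩
      have h2 := hγe (1 + t) ⟨by linarith [ht.1], by linarith [ht.2]⟩
      rw [show -1 + (1 + t) = t by ring] at h1
      rw [div_eq_mul_one_div, h1]
      simp only [A, l, h2, gg]
      generalize VV (α / 2) γ (1 + t) = y
      generalize σ (1 + t) = z
      generalize 1 + t = s at hs0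
      field_simp
      ring
    · rw [hdw _ hm1]; simp [v]
    · rw [hdw2 _ hm1]; simp [A, VV]; ring
  have main : ∀ t ∈ Ioc (-1 : ℝ) (-1 + T), ∀ α' T' : ℝ, ∀ l' : ℝ → ℝ, |α' - α| < 1 →
      t ≤ -1 + T' → SolCubic ζ α' T' l' → |l' t - l t| ≤ (L + 2) * |α' - α| ∧
            |derivWithin l' (Set.Icc (-1) (-1 + T')) t
              - derivWithin l (Set.Icc (-1) (-1 + T)) t| ≤ (L + 2) * |α' - α| := by
    intro t ht α' T' l' hα ht' hsol'
    obtain ⟨s, rfl⟩ : ∃ s, t = -1 + s := ⟨1 + t, by ring⟩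
    have hs0 : 0 < s := by linarith [ht.1]
    have hsT : s ≤ T := by linarith [ht.2]
    have hs1 : s ≤ 1 := hsT.trans hT1
    have hσs : ∀ x ∈ Ioo (0:ℝ) s, 1 / ζ (-1 + x) = 1 / x ^ 2 + σ x := fun x hx =>
      hσe' x ⟨hx.1, hx.2.le.trans hs1⟩
    have u1 := sol_to_usol hsol' hs0 (by linarith : s ≤ T') hσs
    have u2 := sol_to_usol hsol hs0 hsT hσs
    have habs' : |α' / 2| = |α'| / 2 := by rw [abs_div]; norm_num
    have htri := abs_sub_abs_le_abs_sub α' α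
    have hsL : s ^ 2 * L ≤ 1 / 2 := le_trans (by gcongr) hTL
    have hd := u1.diff u2 hs0.le hs1 hL0 hL hsL (by linarith) (by linarith) s ⟨hs0.le, le_rfl⟩
    have hD : 2 * |α' / 2 - α / 2| = |α' - α| := by
      rw [← sub_div, abs_div]; norm_num; ring
    rw [hD] at hd
    simp only [hs0.ne', if_false] at hd
    obtain ⟨hd1, hd2⟩ := hd
    generalize derivWithin l' (Icc (-1) (-1 + T')) (-1 + s) = v1 at *
    generalize derivWithin l (Icc (-1) (-1 + T)) (-1 + s) = v2 at *
    generalize l' (-1 + s) = y1 at *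
    generalize l (-1 + s) = y2 at *
    generalize |α' - α| = D at *
    have hD0 : 0 ≤ D := (abs_nonneg _).trans hd1
    have e1 : (y1 + 1) / s ^ 2 - (y2 + 1) / s ^ 2 = (y1 - y2) / s ^ 2 := by ring
    rw [e1, abs_div, abs_of_pos (by positivity : (0:ℝ) < s ^ 2), div_le_iff₀ (by positivity)] at hd1
    have hs2 : s ^ 2 ≤ 1 := pow_le_one₀ hs0.le hs1
    constructor
    · nlinarith
    · have e2 : s ^ 2 * (v1 - v2) = (s ^ 2 * v1 - 2 * s * (y1 + 1) - (s ^ 2 * v2 - 2 * s * (y2 + 1)))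
          + 2 * s * (y1 - y2) := by ring
      have h3 : s ^ 2 * |v1 - v2| ≤ s ^ 5 * (L * D) + 2 * s * (D * s ^ 2) := by
        rw [← abs_of_pos (by positivity : (0:ℝ) < s ^ 2), ← abs_mul, e2,
          abs_of_pos (by positivity : (0:ℝ) < s ^ 2)]
        refine (abs_add_le _ _).trans (add_le_add hd2 ?_)
        rw [abs_mul, abs_of_pos (by positivity : 0 < 2 * s)]
        gcongr
      have h4 : s ^ 2 * |v1 - v2| ≤ s ^ 2 * ((L + 2) * D) := by
        refine h3.trans ?_
        have : s ^ 3 ≤ 1 := pow_le_one₀ hs0.le hs1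
        have hLD : 0 ≤ L * D := by positivity
        calc s ^ 5 * (L * D) + 2 * s * (D * s ^ 2) = s ^ 2 * (s ^ 3 * (L * D) + s * (2 * D)) := by ring
          _ ≤ s ^ 2 * (1 * (L * D) + 1 * (2 * D)) := by gcongr
          _ = _ := by ring
      exact le_of_mul_le_mul_left h4 (by positivity)
  refine ⟨T, hT0, by linarith, l, hsol, ?_, ?_⟩
  · intro l' hl' t ht
    rcases eq_or_lt_of_le ht.1 with h | h
    · rw [← h, hl'.2.2.1, hsol.2.2.1]
    · have := (main t ⟨h, ht.2⟩ α T l' (by simp) ht.2 hl').1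
      simp only [sub_self, abs_zero, mul_zero] at this
      exact sub_eq_zero.1 (abs_eq_zero.1 (le_antisymm this (abs_nonneg _)))
  · intro t ht ε hε
    refine ⟨min 1 (ε / (L + 2)), by positivity, ?_⟩
    intro α' T' l' hα hT' hT2 htT hl'
    have h1 := main t ht α' T' l' (hα.trans_le (min_le_left _ _)) htT hl'
    have h2 : (L + 2) * |α' - α| < ε := by
      have := hα.trans_le (min_le_right _ _)
      rw [lt_div_iff₀ (by positivity)] at this
      linarith
    exact ⟨h1.1.trans_lt h2, h1.2.trans_lt h2⟩
end
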